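/- Let U be a nonempty open subset of ℂ^N and let A : U → Matrix (Fin p) (Fin n) ℂ be a matrix-valued map all of whose entries are holomorphic (complex-analytic) on U. Let L = {(x,v) ∈ U × ℂ^n : A(x)v = 0} with the subspace topology and projection π : L → U, and for i ∈ ℕ let X_i = {x ∈ U : dim_ℂ ker A(x) ≥ i}, k = min_{x ∈ U} dim_ℂ ker A(x). Then: (1) each X_i is closed in U, X_k = U, and the restriction of π over X_i \ X_{i+1} (when nonempty) is a locally trivial ℂ-vector bundle of rank i; (2) for each i there exist an open neighbourhood U_i of X_{i+1} in X_i (subspace topology), a strong deformation retraction r : U_i × [0,1] → U_i of U_i onto X_{i+1}, and a strong deformation retraction ρ : π^{-1}(U_i) × [0,1] → π^{-1}(U_i) of π^{-1}(U_i) onto π^{-1}(X_{i+1}), such that π(ρ(e,t)) = r(π(e),t) for all e ∈ π^{-1}(U_i) and t ∈ [0,1], and such that for each x ∈ U_i the time-1 map restricted to the fibre, ker A(x) → ker A(r(x,1)), is an injective ℂ-linear map. -/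

import Mathlib

open unitInterval

/-- A strong deformation retraction of `Z` onto the subset `S`. -/
def IsStrongDeformationRetraction {Z : Type*} [TopologicalSpace Z] (S : Set Z)
    (H : Z × unitInterval → Z) : Prop :=
  Continuous H ∧ (∀ z, H (z, 0) = z) ∧ (∀ z, H (z, 1) ∈ S) ∧
    ∀ z ∈ S, ∀ t, H (z, t) = z

section Piece1
open unitInterval Topology Set Filter

/-- radial cell complex -/
structure RC (E : Type) [TopologicalSpace E] where
  ι : Type
  dim : ι → ℕ
  op : ι → Set E
  cl : ι → Set E
  nrm : ι → E → ℝ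
  th : ι → E → ℝ → E
  cl_compact : ∀ c, IsCompact (cl c)
  op_sub : ∀ c, op c ⊆ cl c
  cover : ∀ c, ∀ x ∈ cl c, ∃ c', x ∈ op c'
  disj : ∀ c c' x, x ∈ op c → x ∈ op c' → c = c'
  lf : LocallyFinite cl
  front : ∀ c c' x, x ∈ cl c → x ∈ op c' → op c' ⊆ cl c
  front_dim : ∀ c c' x, x ∈ cl c → x ∈ op c' → c' = c ∨ dim c' < dim c
  conn : ∀ c, IsPreconnected (op c)
  lconn : ∀ c, ∀ x ∈ cl c, ∀ V ∈ 𝓝 x, ∃ V' ∈ 𝓝 x, V' ⊆ V ∧ (V' ∩ op c).Nonempty ∧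
    IsPreconnected (V' ∩ op c)
  nrm_cont : ∀ c, ContinuousOn (nrm c) (cl c)
  nrm_nonneg : ∀ c, ∀ x ∈ cl c, 0 ≤ nrm c x
  nrm_le : ∀ c, ∀ x ∈ cl c, nrm c x ≤ 1
  nrm_eq : ∀ c, ∀ x ∈ cl c, (nrm c x = 1 ↔ x ∉ op c)
  th_cont : ∀ c, ContinuousOn (fun q : E × ℝ => th c q.1 q.2)
    {q | q.1 ∈ cl c ∧ 1 ≤ q.2 ∧ q.2 * nrm c q.1 ≤ 1}
  th_mem : ∀ c, ∀ x ∈ cl c, ∀ s, 1 ≤ s → s * nrm c x ≤ 1 → th c x s ∈ cl c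
  th_nrm : ∀ c, ∀ x ∈ cl c, ∀ s, 1 ≤ s → s * nrm c x ≤ 1 → nrm c (th c x s) = s * nrm c x
  th_one : ∀ c, ∀ x ∈ cl c, th c x 1 = x
  th_th : ∀ c, ∀ x ∈ cl c, ∀ s s', 1 ≤ s → 1 ≤ s' → s * s' * nrm c x ≤ 1 →
    th c (th c x s) s' = th c x (s * s')
  bdd : ∃ d, ∀ c, dim c ≤ d

theorem band_preconn {E : Type} [TopologicalSpace E] {S : Set E} (hS : IsPreconnected S)
    {f g : E → ℝ} (hf : ContinuousOn f S) (hg : ContinuousOn g S) (hfg : ∀ b ∈ S, f b < g b) :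
    IsPreconnected {q : E × ℝ | q.1 ∈ S ∧ f q.1 < q.2 ∧ q.2 < g q.1} := by
  have h1 : IsPreconnected (S ×ˢ Ioo (0:ℝ) 1) := hS.prod isPreconnected_Ioo
  have hc : ContinuousOn (fun q : E × ℝ => (q.1, f q.1 + q.2 * (g q.1 - f q.1)))
      (S ×ˢ Ioo (0:ℝ) 1) := by
    have hf' : ContinuousOn (fun q : E × ℝ => f q.1) (S ×ˢ Ioo (0:ℝ) 1) :=
      hf.comp continuousOn_fst (fun q hq => hq.1)
    have hg' : ContinuousOn (fun q : E × ℝ => g q.1) (S ×ˢ Ioo (0:ℝ) 1) :=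
      hg.comp continuousOn_fst (fun q hq => hq.1)
    exact continuousOn_fst.prodMk (hf'.add (continuousOn_snd.mul (hg'.sub hf')))
  convert h1.image _ hc using 1
  ext ⟨b, y⟩
  simp only [mem_ofPred_eq, mem_image, mem_prod, mem_Ioo, Prod.mk.injEq, Prod.exists]
  constructor
  · rintro ⟨hb, h2, h3⟩
    have h4 := hfg b hb
    refine ⟨b, (y - f b) / (g b - f b), ⟨hb, div_pos (by linarith) (by linarith), ?_⟩, rfl, ?_⟩
    · rw [div_lt_one (by linarith)]; linarith
    · rw [div_mul_cancel₀ _ (by linarith)]; ring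
  · rintro ⟨b', t, ⟨hb, h2, h3⟩, rfl, rfl⟩
    have h4 := hfg b' hb
    refine ⟨hb, ?_, ?_⟩
    · nlinarith
    · nlinarith

theorem graph_preconn {E : Type} [TopologicalSpace E] {S : Set E} (hS : IsPreconnected S)
    {f : E → ℝ} (hf : ContinuousOn f S) :
    IsPreconnected {q : E × ℝ | q.1 ∈ S ∧ q.2 = f q.1} := by
  have hc : ContinuousOn (fun b : E => (b, f b)) S := continuousOn_id.prodMk hf
  convert hS.image _ hc using 1
  ext ⟨b, y⟩
  simp only [mem_ofPred_eq, mem_image, Prod.mk.injEq]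
  constructor
  · rintro ⟨hb, rfl⟩; exact ⟨b, hb, rfl, rfl⟩
  · rintro ⟨b', hb, rfl, rfl⟩; exact ⟨hb, rfl⟩

namespace LiftAux
variable {E : Type} [TopologicalSpace E]

noncomputable def q (lo hi : E → ℝ) (x : E × ℝ) : ℝ := |2 * x.2 - lo x.1 - hi x.1| / (hi x.1 - lo x.1)
noncomputable def nrm (n : E → ℝ) (lo hi : E → ℝ) (x : E × ℝ) : ℝ := max (n x.1) (q lo hi x)
noncomputable def th (t : E → ℝ → E) (lo hi : E → ℝ) (x : E × ℝ) (s : ℝ) : E × ℝ :=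
  (t x.1 s, (lo (t x.1 s) + hi (t x.1 s)) / 2 +
    s * (2 * x.2 - lo x.1 - hi x.1) / (hi x.1 - lo x.1) * ((hi (t x.1 s) - lo (t x.1 s)) / 2))
def cl (K : Set E) (lo hi : E → ℝ) : Set (E × ℝ) := {x | x.1 ∈ K ∧ lo x.1 ≤ x.2 ∧ x.2 ≤ hi x.1}

variable {K : Set E} {n : E → ℝ} {t : E → ℝ → E} {lo hi : E → ℝ}

theorem q_nonneg {x : E × ℝ} (hx : x ∈ cl K lo hi) : 0 ≤ q lo hi x := by
  obtain ⟨h1, h2, h3⟩ := hx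
  exact div_nonneg (abs_nonneg _) (by linarith)

theorem q_le {x : E × ℝ} (hx : x ∈ cl K lo hi) : q lo hi x ≤ 1 := by
  obtain ⟨h1, h2, h3⟩ := hx
  apply div_le_one_of_le₀ _ (by linarith)
  rw [abs_le]; constructor <;> linarith

theorem q_eq_one {x : E × ℝ} (hx : x ∈ cl K lo hi) (hne : lo x.1 < hi x.1) :
    q lo hi x = 1 ↔ (x.2 = lo x.1 ∨ x.2 = hi x.1) := by
  obtain ⟨h1, h2, h3⟩ := hx
  unfold q
  rw [div_eq_one_iff_eq (by linarith)]
  constructor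
  · intro h
    rcases abs_cases (2 * x.2 - lo x.1 - hi x.1) with ⟨h4, _⟩ | ⟨h4, _⟩
    · right; linarith
    · left; linarith
  · rintro (h | h) <;> rw [h]
    · rw [abs_of_nonpos (by linarith)]; ring
    · rw [abs_of_nonneg (by linarith)]; ring

theorem cl_compact (hK : IsCompact K) (hlo : ContinuousOn lo K) (hhi : ContinuousOn hi K)
    (hle : ∀ b ∈ K, lo b ≤ hi b) : IsCompact (cl K lo hi) := by
  have h1 : IsCompact (K ×ˢ Icc (0:ℝ) 1) := hK.prod isCompact_Icc
  have hc : ContinuousOn (fun q : E × ℝ => (q.1, lo q.1 + q.2 * (hi q.1 - lo q.1)))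
      (K ×ˢ Icc (0:ℝ) 1) := by
    have hf' : ContinuousOn (fun q : E × ℝ => lo q.1) (K ×ˢ Icc (0:ℝ) 1) :=
      hlo.comp continuousOn_fst (fun q hq => hq.1)
    have hg' : ContinuousOn (fun q : E × ℝ => hi q.1) (K ×ˢ Icc (0:ℝ) 1) :=
      hhi.comp continuousOn_fst (fun q hq => hq.1)
    exact continuousOn_fst.prodMk (hf'.add (continuousOn_snd.mul (hg'.sub hf')))
  convert h1.image_of_continuousOn hc using 1
  ext ⟨b, y⟩
  simp only [cl, mem_ofPred_eq, mem_image, mem_prod, mem_Icc, Prod.mk.injEq, Prod.exists]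
  constructor
  · rintro ⟨hb, h2, h3⟩
    rcases (hle b hb).eq_or_lt with h4 | h4
    · exact ⟨b, 0, ⟨hb, le_rfl, zero_le_one⟩, rfl, by linarith⟩
    refine ⟨b, (y - lo b) / (hi b - lo b), ⟨hb, div_nonneg (by linarith) (by linarith), ?_⟩, rfl, ?_⟩
    · rw [div_le_one (by linarith)]; linarith
    · rw [div_mul_cancel₀ _ (by linarith)]; ring
  · rintro ⟨b', t, ⟨hb, h2, h3⟩, rfl, rfl⟩
    have h4 := hle b' hb
    refine ⟨hb, ?_, ?_⟩
    · nlinarith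
    · nlinarith

theorem loc_cont (hlo : ContinuousOn lo K) : ContinuousOn (fun x : E × ℝ => lo x.1) (cl K lo hi) :=
  hlo.comp continuousOn_fst (fun _ hq => hq.1)

theorem hic_cont (hhi : ContinuousOn hi K) : ContinuousOn (fun x : E × ℝ => hi x.1) (cl K lo hi) :=
  hhi.comp continuousOn_fst (fun _ hq => hq.1)

theorem nrm_cont (hlo : ContinuousOn lo K) (hhi : ContinuousOn hi K)
    (hn : ContinuousOn n K) (hn1 : ∀ b ∈ K, n b ≤ 1)
    (hdeg : ∀ b ∈ K, lo b = hi b → n b = 1 ∨ ∀ b' ∈ K, lo b' = hi b') :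
    ContinuousOn (nrm n lo hi) (cl K lo hi) := by
  intro x hx
  have hnc : ContinuousWithinAt (fun x : E × ℝ => n x.1) (cl K lo hi) x :=
    (hn.comp continuousOn_fst (fun _ hq => hq.1)) x hx
  by_cases h : lo x.1 = hi x.1
  · rcases hdeg _ hx.1 h with h1 | h1
    · have h2 : nrm n lo hi x = 1 := by
        unfold nrm; rw [h1]; exact max_eq_left (q_le hx)
      unfold ContinuousWithinAt at hnc ⊢
      rw [h2]
      simp only [h1] at hnc
      refine tendsto_of_tendsto_of_tendsto_of_le_of_le' hnc tendsto_const_nhds ?_ ?_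
      · exact Eventually.of_forall (fun y => le_max_left _ _)
      · filter_upwards [self_mem_nhdsWithin] with y hy
        exact max_le (hn1 _ hy.1) (q_le hy)
    · have : ∀ y ∈ cl K lo hi, nrm n lo hi y = max (n y.1) 0 := by
        intro y hy
        unfold nrm q; rw [h1 _ hy.1]; simp
      refine ContinuousWithinAt.congr (hnc.max continuousWithinAt_const) this (this x hx)
  · refine hnc.max ?_
    refine ContinuousWithinAt.div ?_ ?_ ?_
    · exact (((continuousWithinAt_const.mul continuousWithinAt_snd).sub (loc_cont hlo x hx)).sub (hic_cont hhi x hx)).abs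
    · exact (hic_cont hhi x hx).sub (loc_cont hlo x hx)
    · intro h'; apply h; linarith
  
theorem fac_le {x : E × ℝ} (hx : x ∈ cl K lo hi) {s : ℝ} (hs : 1 ≤ s) (hsn : s * nrm n lo hi x ≤ 1) :
    |s * (2 * x.2 - lo x.1 - hi x.1) / (hi x.1 - lo x.1)| ≤ 1 := by
  have h1 : s * q lo hi x ≤ 1 :=
    le_trans (mul_le_mul_of_nonneg_left (le_max_right _ _) (by linarith)) hsn
  obtain ⟨h2, h3, h4⟩ := hx
  unfold q at h1
  rw [abs_div, abs_mul, abs_of_nonneg (show (0:ℝ) ≤ s by linarith), abs_of_nonneg (show 0 ≤ hi x.1 - lo x.1 by linarith), mul_div_assoc]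
  exact h1

theorem sn_le {x : E × ℝ} {s : ℝ} (hs : 1 ≤ s) (hsn : s * nrm n lo hi x ≤ 1) : s * n x.1 ≤ 1 :=
  le_trans (mul_le_mul_of_nonneg_left (le_max_left _ _) (by linarith)) hsn

theorem th_cont (hlo : ContinuousOn lo K) (hhi : ContinuousOn hi K)
    (ht : ContinuousOn (fun q : E × ℝ => t q.1 q.2) {q | q.1 ∈ K ∧ 1 ≤ q.2 ∧ q.2 * n q.1 ≤ 1})
    (htm : ∀ x ∈ K, ∀ s, 1 ≤ s → s * n x ≤ 1 → t x s ∈ K)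
    (ht1 : ∀ x ∈ K, t x 1 = x)
    (hle : ∀ b ∈ K, lo b ≤ hi b)
    (hdeg : ∀ b ∈ K, lo b = hi b → n b = 1 ∨ ∀ b' ∈ K, lo b' = hi b') :
    ContinuousOn (fun q : (E × ℝ) × ℝ => th t lo hi q.1 q.2)
      {q | q.1 ∈ cl K lo hi ∧ 1 ≤ q.2 ∧ q.2 * nrm n lo hi q.1 ≤ 1} := by
  set D := {q : (E × ℝ) × ℝ | q.1 ∈ cl K lo hi ∧ 1 ≤ q.2 ∧ q.2 * nrm n lo hi q.1 ≤ 1} with hD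
  have hDK : ∀ q ∈ D, t q.1.1 q.2 ∈ K := fun q hq =>
    htm _ hq.1.1 _ hq.2.1 (sn_le hq.2.1 hq.2.2)
  have c1 : ContinuousOn (fun q : (E × ℝ) × ℝ => t q.1.1 q.2) D := by
    refine ht.comp (f := fun q : (E × ℝ) × ℝ => (q.1.1, q.2)) (by fun_prop) ?_
    intro q hq
    exact ⟨hq.1.1, hq.2.1, sn_le (x := q.1) hq.2.1 hq.2.2⟩
  have c2 : ContinuousOn (fun q : (E × ℝ) × ℝ => lo (t q.1.1 q.2)) D := hlo.comp c1 hDK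
  have c3 : ContinuousOn (fun q : (E × ℝ) × ℝ => hi (t q.1.1 q.2)) D := hhi.comp c1 hDK
  have c4 : ContinuousOn (fun q : (E × ℝ) × ℝ => lo q.1.1) D :=
    (loc_cont hlo).comp continuousOn_fst (fun q hq => hq.1)
  have c5 : ContinuousOn (fun q : (E × ℝ) × ℝ => hi q.1.1) D :=
    (hic_cont hhi).comp continuousOn_fst (fun q hq => hq.1)
  refine c1.prodMk ((((c2.add c3).div_const 2)).add ?_)
  intro x hx
  by_cases h : lo x.1.1 = hi x.1.1
  · have h' : lo (t x.1.1 x.2) = hi (t x.1.1 x.2) := by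
      rcases hdeg _ hx.1.1 h with h1 | h1
      · have : x.2 = 1 := by
          have := sn_le hx.2.1 hx.2.2
          rw [h1] at this; linarith [hx.2.1]
        rw [this, ht1 _ hx.1.1, h]
      · exact h1 _ (hDK x hx)
    have c6 := ((c3.sub c2).div_const 2) x hx
    unfold ContinuousWithinAt at c6 ⊢
    simp only [Pi.sub_apply, h', sub_self, zero_div, mul_zero] at c6 ⊢
    refine squeeze_zero_norm' ?_ c6
    filter_upwards [self_mem_nhdsWithin] with y hy
    rw [norm_mul]
    have h3 := fac_le hy.1 hy.2.1 hy.2.2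
    have h4 := hle _ (hDK y hy)
    rw [Real.norm_eq_abs, Real.norm_eq_abs, abs_of_nonneg (show 0 ≤ (hi (t y.1.1 y.2) - lo (t y.1.1 y.2)) / 2 by linarith)]
    exact mul_le_of_le_one_left (by linarith) h3
  · refine ContinuousWithinAt.mul (ContinuousWithinAt.div ?_ ((c5 x hx).sub (c4 x hx)) (fun h' => h (by linarith))) (((c3.sub c2).div_const 2) x hx)
    refine continuousWithinAt_snd.mul (ContinuousWithinAt.sub (ContinuousWithinAt.sub ?_ (c4 x hx)) (c5 x hx))
    fun_prop

theorem th_mem (htm : ∀ x ∈ K, ∀ s, 1 ≤ s → s * n x ≤ 1 → t x s ∈ K)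
    (hle : ∀ b ∈ K, lo b ≤ hi b) :
    ∀ x ∈ cl K lo hi, ∀ s, 1 ≤ s → s * nrm n lo hi x ≤ 1 → th t lo hi x s ∈ cl K lo hi := by
  intro x hx s hs hsn
  have h1 := htm _ hx.1 s hs (sn_le hs hsn)
  have h2 := fac_le hx hs hsn
  rw [abs_le] at h2
  have h3 := hle _ h1
  refine ⟨h1, ?_, ?_⟩
  · simp only [th]; nlinarith
  · simp only [th]; nlinarith

theorem th_nrm (htm : ∀ x ∈ K, ∀ s, 1 ≤ s → s * n x ≤ 1 → t x s ∈ K)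
    (htn : ∀ x ∈ K, ∀ s, 1 ≤ s → s * n x ≤ 1 → n (t x s) = s * n x)
    (hdeg : ∀ b ∈ K, lo b = hi b → n b = 1 ∨ ∀ b' ∈ K, lo b' = hi b')
    (hle : ∀ b ∈ K, lo b ≤ hi b) :
    ∀ x ∈ cl K lo hi, ∀ s, 1 ≤ s → s * nrm n lo hi x ≤ 1 →
      nrm n lo hi (th t lo hi x s) = s * nrm n lo hi x := by
  intro x hx s hs hsn
  have h1 := htm _ hx.1 s hs (sn_le hs hsn)
  have h0 := htn _ hx.1 s hs (sn_le hs hsn)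
  have h2 := fac_le hx hs hsn
  have hs0 : 0 ≤ s := by linarith
  have h3 := hle _ h1
  have h4 := hle _ hx.1
  have hq : s * nrm n lo hi x = max (n (t x.1 s)) (|s * (2 * x.2 - lo x.1 - hi x.1) / (hi x.1 - lo x.1)|) := by
    unfold nrm q
    rw [h0, mul_max_of_nonneg _ _ hs0, abs_div, abs_mul, abs_of_nonneg hs0, abs_of_nonneg (show 0 ≤ hi x.1 - lo x.1 by linarith), mul_div_assoc]
  rw [hq]
  by_cases h : lo (t x.1 s) = hi (t x.1 s)
  · have h5 : q lo hi (th t lo hi x s) = 0 := by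
      unfold q th; simp only [h, sub_self, div_zero]
    unfold nrm
    rw [h5]
    rcases hdeg _ h1 h with h6 | h6
    · simp only [th]
      rw [h6, max_eq_left h2, max_eq_left zero_le_one]
    · simp only [th, h6 _ hx.1, sub_self, div_zero, abs_zero]
  · have h5 : 0 < hi (t x.1 s) - lo (t x.1 s) := by
      have := lt_of_le_of_ne h3 h; linarith
    unfold nrm q
    simp only [th]
    congr 1
    set u := s * (2 * x.2 - lo x.1 - hi x.1) / (hi x.1 - lo x.1)
    rw [show 2 * ((lo (t x.1 s) + hi (t x.1 s)) / 2 + u * ((hi (t x.1 s) - lo (t x.1 s)) / 2)) - lo (t x.1 s) - hi (t x.1 s) = u * (hi (t x.1 s) - lo (t x.1 s)) by ring, abs_mul, abs_of_pos h5, mul_div_assoc, div_self h5.ne', mul_one]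

theorem th_one (ht1 : ∀ x ∈ K, t x 1 = x) : ∀ x ∈ cl K lo hi, th t lo hi x 1 = x := by
  intro x hx
  unfold th
  rw [ht1 _ hx.1]
  obtain ⟨h1, h2, h3⟩ := hx
  ext
  · rfl
  · by_cases h : lo x.1 = hi x.1
    · simp only [h, sub_self, zero_div, mul_zero]; linarith
    · have : hi x.1 - lo x.1 ≠ 0 := fun h' => h (by linarith)
      simp only
      field_simp
      ring

theorem th_th (htm : ∀ x ∈ K, ∀ s, 1 ≤ s → s * n x ≤ 1 → t x s ∈ K)
    (htn : ∀ x ∈ K, ∀ s, 1 ≤ s → s * n x ≤ 1 → n (t x s) = s * n x)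
    (hn0 : ∀ x ∈ K, 0 ≤ n x)
    (ht1 : ∀ x ∈ K, t x 1 = x)
    (htt : ∀ x ∈ K, ∀ s s', 1 ≤ s → 1 ≤ s' → s * s' * n x ≤ 1 → t (t x s) s' = t x (s * s'))
    (hdeg : ∀ b ∈ K, lo b = hi b → n b = 1 ∨ ∀ b' ∈ K, lo b' = hi b') :
    ∀ x ∈ cl K lo hi, ∀ s s', 1 ≤ s → 1 ≤ s' → s * s' * nrm n lo hi x ≤ 1 →
      th t lo hi (th t lo hi x s) s' = th t lo hi x (s * s') := by
  intro x hx s s' hs hs' hsn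
  have hss : 1 ≤ s * s' := by nlinarith
  have h0 := sn_le hss hsn
  have hn := hn0 _ hx.1
  have h1 : s * n x.1 ≤ 1 := by nlinarith [mul_nonneg (show 0 ≤ s by linarith) hn]
  have h2 := htm _ hx.1 s hs h1
  have h3 := htt _ hx.1 s s' hs hs' h0
  have h4 := htn _ hx.1 s hs h1
  have h5 := htm _ hx.1 (s * s') hss h0
  unfold th
  simp only [h3]
  ext
  · rfl
  · simp only
    set u := (2 * x.2 - lo x.1 - hi x.1) / (hi x.1 - lo x.1) with hu
    rw [show s * (2 * x.2 - lo x.1 - hi x.1) / (hi x.1 - lo x.1) = s * u by rw [hu]; ring]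
    rw [show s * s' * (2 * x.2 - lo x.1 - hi x.1) / (hi x.1 - lo x.1) = s * s' * u by rw [hu]; ring]
    by_cases h : lo (t x.1 s) = hi (t x.1 s)
    · have h6 : lo (t x.1 (s * s')) = hi (t x.1 (s * s')) := by
        rcases hdeg _ h2 h with h7 | h7
        · have : s' = 1 := by nlinarith
          rw [this, mul_one, h]
        · exact h7 _ h5
      rw [h6]; simp
    · have : hi (t x.1 s) - lo (t x.1 s) ≠ 0 := fun h' => h (by linarith)
      congr 1
      field_simp
      ring

end LiftAux
end Piece1

section Piece2
open unitInterval Topology Set Filter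

/-- transport along a homeomorphism -/
def RC.map {E E' : Type} [TopologicalSpace E] [TopologicalSpace E'] (C : RC E) (h : E ≃ₜ E') :
    RC E' where
  ι := C.ι
  dim := C.dim
  op c := h.symm ⁻¹' C.op c
  cl c := h.symm ⁻¹' C.cl c
  nrm c x := C.nrm c (h.symm x)
  th c x s := h (C.th c (h.symm x) s)
  cl_compact c := by
    have := (C.cl_compact c).image h.continuous
    rwa [h.image_eq_preimage_symm] at this
  op_sub c := preimage_mono (C.op_sub c)
  cover c x hx := C.cover c _ hx
  disj c c' x h1 h2 := C.disj c c' _ h1 h2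
  lf := C.lf.preimage_continuous h.symm.continuous
  front c c' x h1 h2 := preimage_mono (C.front c c' _ h1 h2)
  front_dim c c' x h1 h2 := C.front_dim c c' _ h1 h2
  conn c := by
    have := (C.conn c).image h h.continuous.continuousOn
    rwa [h.image_eq_preimage_symm] at this
  lconn c x hx V hV := by
    obtain ⟨V', h1, h2, h3, h4⟩ := C.lconn c _ hx (h ⁻¹' V) (h.continuous.continuousAt.preimage_mem_nhds (by simpa using hV))
    refine ⟨h.symm ⁻¹' V', h.symm.continuous.continuousAt.preimage_mem_nhds h1, ?_, ?_, ?_⟩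
    · intro y hy
      have := h2 hy
      simpa using this
    · obtain ⟨y, hy⟩ := h3
      exact ⟨h y, by simpa using hy⟩
    · have := h4.image h h.continuous.continuousOn
      rwa [h.image_eq_preimage_symm] at this
  nrm_cont c := (C.nrm_cont c).comp h.symm.continuous.continuousOn (fun x hx => hx)
  nrm_nonneg c x hx := C.nrm_nonneg c _ hx
  nrm_le c x hx := C.nrm_le c _ hx
  nrm_eq c x hx := C.nrm_eq c _ hx
  th_cont c := by
    refine h.continuous.comp_continuousOn ?_
    refine (C.th_cont c).comp (f := fun q : E' × ℝ => (h.symm q.1, q.2)) (by fun_prop) ?_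
    intro q hq; exact hq
  th_mem c x hx s h1 h2 := by simpa using C.th_mem c _ hx s h1 h2
  th_nrm c x hx s h1 h2 := by simpa using C.th_nrm c _ hx s h1 h2
  th_one c x hx := by simpa using congrArg h (C.th_one c _ hx)
  th_th c x hx s s' h1 h2 h3 := by simpa using (C.th_th c _ hx s s' h1 h2 h3)
  bdd := C.bdd

structure RC.Sections {E : Type} [TopologicalSpace E] (C : RC E) where
  k : C.ι → ℕ
  ξ : C.ι → ℕ → E → ℝ
  cont : ∀ c, ∀ j ≤ k c, ContinuousOn (ξ c j) (C.cl c)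
  mono : ∀ c, ∀ i j, i < j → j ≤ k c → ∀ b ∈ C.op c, ξ c i b < ξ c j b
  face : ∀ c c', (C.op c').Nonempty → C.op c' ⊆ C.cl c → ∀ j ≤ k c, ∃ j' ≤ k c', ∀ b ∈ C.op c',
    ξ c j b = ξ c' j' b

namespace RC.Sections
variable {E : Type} [TopologicalSpace E] {C : RC E} (S : C.Sections)

theorem mono_le (c : C.ι) {i j : ℕ} (hij : i ≤ j) (hj : j ≤ S.k c) {b : E} (hb : b ∈ C.op c) :
    S.ξ c i b ≤ S.ξ c j b := by
  rcases hij.eq_or_lt with h | h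
  · rw [h]
  · exact (S.mono c i j h hj b hb).le

theorem le_of_le (c : C.ι) {i j : ℕ} (hi : i ≤ S.k c) {b : E} (hb : b ∈ C.op c)
    (h : S.ξ c i b ≤ S.ξ c j b) : i ≤ j := by
  by_contra h'
  have := S.mono c j i (by omega) hi b hb
  linarith

theorem lt_of_lt (c : C.ι) {i j : ℕ} (hj : j ≤ S.k c) (hi : i ≤ S.k c) {b : E} (hb : b ∈ C.op c)
    (h : S.ξ c i b < S.ξ c j b) : i < j := by
  by_contra h'
  have := S.mono_le c (i := j) (j := i) (by omega) hi hb
  linarith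

theorem mono_le_cl (c : C.ι) {i j : ℕ} (hij : i ≤ j) (hj : j ≤ S.k c) {b : E} (hb : b ∈ C.cl c) :
    S.ξ c i b ≤ S.ξ c j b := by
  obtain ⟨c', hc'⟩ := C.cover c b hb
  by_contra h
  push Not at h
  have hcont : ContinuousWithinAt (fun x => S.ξ c j x - S.ξ c i x) (C.cl c) b :=
    (S.cont c j hj b hb).sub (S.cont c i (hij.trans hj) b hb)
  have : ∀ᶠ x in 𝓝[C.cl c] b, S.ξ c j x - S.ξ c i x < 0 :=
    hcont.eventually_lt continuousWithinAt_const (by linarith)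
  rw [eventually_nhdsWithin_iff] at this
  obtain ⟨V', h1, h2, ⟨x, hx1, hx2⟩, -⟩ := C.lconn c b hb _ this
  have h3 := h2 hx1 (C.op_sub c hx2)
  have h4 := S.mono_le c hij hj hx2
  linarith

/-- index set of lifted cells -/
def ix : Type := {p : C.ι × ℕ × ℕ // p.2.2 ≤ 1 ∧ p.2.1 + p.2.2 ≤ S.k p.1}

def lo (p : S.ix) : E → ℝ := S.ξ p.1.1 p.1.2.1
def hi (p : S.ix) : E → ℝ := S.ξ p.1.1 (p.1.2.1 + p.1.2.2)
def cl (p : S.ix) : Set (E × ℝ) := LiftAux.cl (C.cl p.1.1) (S.lo p) (S.hi p)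
def op (p : S.ix) : Set (E × ℝ) := {x | x.1 ∈ C.op p.1.1 ∧
  if p.1.2.2 = 0 then x.2 = S.lo p x.1 else S.lo p x.1 < x.2 ∧ x.2 < S.hi p x.1}

theorem lo_le_hi (p : S.ix) (b) (hb : b ∈ C.cl p.1.1) : S.lo p b ≤ S.hi p b :=
  S.mono_le_cl _ (by omega) p.2.2 hb

theorem locont (p : S.ix) : ContinuousOn (S.lo p) (C.cl p.1.1) := S.cont _ _ (by have := p.2.2; omega)
theorem hicont (p : S.ix) : ContinuousOn (S.hi p) (C.cl p.1.1) := S.cont _ _ p.2.2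

theorem deg (p : S.ix) (b) (hb : b ∈ C.cl p.1.1) (h : S.lo p b = S.hi p b) :
    C.nrm p.1.1 b = 1 ∨ ∀ b' ∈ C.cl p.1.1, S.lo p b' = S.hi p b' := by
  by_cases h0 : p.1.2.2 = 0
  · right; intro b' hb'; unfold lo hi; rw [h0]; rfl
  · left
    rw [C.nrm_eq _ _ hb]
    intro hb'
    have := S.mono p.1.1 p.1.2.1 (p.1.2.1 + p.1.2.2) (by omega) p.2.2 b hb'
    unfold lo hi at h
    linarith

theorem op_sub (p : S.ix) : S.op p ⊆ S.cl p := by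
  rintro x ⟨h1, h2⟩
  refine ⟨C.op_sub _ h1, ?_⟩
  have h3 := S.lo_le_hi p x.1 (C.op_sub _ h1)
  split_ifs at h2
  · rw [h2]; exact ⟨le_rfl, h3⟩
  · exact ⟨h2.1.le, h2.2.le⟩

/-- sandwich: location of a point in the partition of a cell -/
theorem loc (c : C.ι) {b : E} (hb : b ∈ C.op c) {y : ℝ} {j1 j2 : ℕ} (h1 : S.ξ c j1 b ≤ y)
    (h2 : y ≤ S.ξ c j2 b) (hj1 : j1 ≤ S.k c) (hj2 : j2 ≤ S.k c) : ∃ p : S.ix, p.1.1 = c ∧ (b, y) ∈ S.op p := by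
  classical
  let j := Nat.findGreatest (fun j => S.ξ c j b ≤ y) (S.k c)
  have hj : S.ξ c j b ≤ y := Nat.findGreatest_spec (P := fun j => S.ξ c j b ≤ y) hj1 h1
  have hjk : j ≤ S.k c := Nat.findGreatest_le _
  rcases hj.eq_or_lt with h | h
  · exact ⟨⟨(c, j, 0), by simp, by simpa using hjk⟩, rfl, hb, by simp [lo, h]⟩
  · have h3 : j < j2 := S.lt_of_lt c hj2 hjk hb (lt_of_lt_of_le h h2)
    refine ⟨⟨(c, j, 1), by simp, by simp; omega⟩, rfl, hb, ?_⟩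
    simp only [one_ne_zero, if_false, lo, hi]
    refine ⟨h, ?_⟩
    by_contra h'
    exact Nat.findGreatest_is_greatest (P := fun j => S.ξ c j b ≤ y) (Nat.lt_succ_self j) (by show j + 1 ≤ _; omega) (not_lt.mp h')

theorem face_idx (p p' : S.ix) (x) (h1 : x ∈ S.cl p) (h2 : x ∈ S.op p') :
    ∃ j1 j2, j1 ≤ p'.1.2.1 ∧ p'.1.2.1 + p'.1.2.2 ≤ j2 ∧ j2 ≤ S.k p'.1.1 ∧
    (∀ b ∈ C.op p'.1.1, S.lo p b = S.ξ p'.1.1 j1 b) ∧ (∀ b ∈ C.op p'.1.1, S.hi p b = S.ξ p'.1.1 j2 b) := by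
  have hsub := C.front _ _ _ h1.1 h2.1
  have hne : (C.op p'.1.1).Nonempty := ⟨_, h2.1⟩
  obtain ⟨j1, hj1, e1⟩ := S.face _ _ hne hsub p.1.2.1 (by have := p.2.2; omega)
  obtain ⟨j2, hj2, e2⟩ := S.face _ _ hne hsub _ p.2.2
  refine ⟨j1, j2, ?_, ?_, hj2, e1, e2⟩
  · have h3 := h1.2.1
    unfold lo at h3
    rw [e1 _ h2.1] at h3
    have h4 := h2.2
    split_ifs at h4 with h5
    · rw [h4] at h3
      exact S.le_of_le _ hj1 h2.1 h3
    · have h6 := S.lt_of_lt p'.1.1 p'.2.2 hj1 h2.1 (lt_of_le_of_lt h3 h4.2)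
      have := p'.2.1; omega
  · have h3 := h1.2.2
    unfold hi at h3
    rw [e2 _ h2.1] at h3
    have h4 := h2.2
    have h7 := p'.2.2
    split_ifs at h4 with h5
    · rw [h4] at h3
      rw [h5]
      exact S.le_of_le _ (by omega) h2.1 h3
    · have h6 := S.lt_of_lt p'.1.1 hj2 (by omega) h2.1 (lt_of_lt_of_le h4.1 h3)
      have := p'.2.1; omega

theorem lf : LocallyFinite S.cl := by
  intro x
  obtain ⟨t, ht, hf⟩ := C.lf x.1
  refine ⟨Prod.fst ⁻¹' t, continuous_fst.continuousAt.preimage_mem_nhds ht, ?_⟩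
  have hfin : ({c | (C.cl c ∩ t).Nonempty} : Set C.ι).Finite := hf
  let M : C.ι → Set (C.ι × ℕ × ℕ) := fun c => {c} ×ˢ (Set.Iic (S.k c) ×ˢ Set.Iic 1)
  have hM : ∀ c, (M c).Finite := fun c => (finite_singleton c).prod ((finite_Iic _).prod (finite_Iic _))
  have hU : (⋃ c ∈ {c | (C.cl c ∩ t).Nonempty}, M c).Finite := hfin.biUnion (fun c _ => hM c)
  refine Set.Finite.subset (hU.preimage (f := Subtype.val) Subtype.val_injective.injOn) ?_
  rintro p ⟨y, hy1, hy2⟩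
  simp only [mem_preimage, mem_iUnion]
  refine ⟨p.1.1, ⟨y.1, hy1.1, hy2⟩, rfl, ?_, p.2.1⟩
  have := p.2.2
  simp only [mem_Iic]; omega

theorem conn (p : S.ix) : IsPreconnected (S.op p) := by
  unfold op
  by_cases h : p.1.2.2 = 0
  · simp only [h, if_true]
    exact graph_preconn (C.conn _) ((S.locont p).mono (C.op_sub _))
  · simp only [h, if_false]
    refine band_preconn (C.conn _) ((S.locont p).mono (C.op_sub _)) ((S.hicont p).mono (C.op_sub _)) ?_
    intro b hb
    exact S.mono p.1.1 _ _ (by omega) p.2.2 b hb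

theorem lconn (p : S.ix) (x) (hx : x ∈ S.cl p) (V) (hV : V ∈ 𝓝 x) : ∃ V' ∈ 𝓝 x, V' ⊆ V ∧
    (V' ∩ S.op p).Nonempty ∧ IsPreconnected (V' ∩ S.op p) := by
  obtain ⟨b, y⟩ := x
  rw [nhds_prod_eq, mem_prod_iff] at hV
  obtain ⟨V1, hV1, V2, hV2, hVV⟩ := hV
  obtain ⟨ε, hε, hball⟩ := Metric.mem_nhds_iff.mp hV2
  have hb : b ∈ C.cl p.1.1 := hx.1
  have hylo : S.lo p b ≤ y := hx.2.1
  have hyhi : y ≤ S.hi p b := hx.2.2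
  by_cases h : p.1.2.2 = 0
  · have hlh : ∀ b, S.lo p b = S.hi p b := by intro b; simp [lo, hi, h]
    have hyy : y = S.lo p b := le_antisymm (by rw [hlh]; exact hyhi) hylo
    have hc : ∀ᶠ b' in 𝓝[C.cl p.1.1] b, S.lo p b' ∈ Metric.ball y ε := by
      refine (S.locont p b hb).eventually ?_
      rw [hyy]; exact Metric.ball_mem_nhds _ hε
    rw [eventually_nhdsWithin_iff] at hc
    obtain ⟨W, hW, hW1, hW2, hW3⟩ := C.lconn _ b hb _ (inter_mem hV1 hc)
    have heq : (W ×ˢ Metric.ball y ε) ∩ S.op p = {q | q.1 ∈ W ∩ C.op p.1.1 ∧ q.2 = S.lo p q.1} := by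
      ext q
      simp only [op, h, if_true, mem_inter_iff, mem_prod, mem_ofPred_eq]
      constructor
      · rintro ⟨⟨h1, h2⟩, h3, h4⟩; exact ⟨⟨h1, h3⟩, h4⟩
      · rintro ⟨⟨h1, h3⟩, h4⟩
        refine ⟨⟨h1, ?_⟩, h3, h4⟩
        rw [h4]; exact (hW1 h1).2 (C.op_sub _ h3)
    refine ⟨W ×ˢ Metric.ball y ε, prod_mem_nhds hW (Metric.ball_mem_nhds _ hε), ?_, ?_, ?_⟩
    · exact (prod_mono (hW1.trans inter_subset_left) hball).trans hVV
    · rw [heq]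
      obtain ⟨b', hb'⟩ := hW2
      exact ⟨(b', S.lo p b'), hb', rfl⟩
    · rw [heq]
      exact graph_preconn hW3 ((S.locont p).mono (inter_subset_right.trans (C.op_sub _)))
  · have hc : ∀ᶠ b' in 𝓝[C.cl p.1.1] b, S.lo p b' < y + ε ∧ y - ε < S.hi p b' := by
      refine ((S.locont p b hb).eventually_lt continuousWithinAt_const (by linarith)).and
        (continuousWithinAt_const.eventually_lt (S.hicont p b hb) (by linarith))
    rw [eventually_nhdsWithin_iff] at hc
    obtain ⟨W, hW, hW1, hW2, hW3⟩ := C.lconn _ b hb _ (inter_mem hV1 hc)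
    have heq : (W ×ˢ Metric.ball y ε) ∩ S.op p = {q | q.1 ∈ W ∩ C.op p.1.1 ∧
        max (S.lo p q.1) (y - ε) < q.2 ∧ q.2 < min (S.hi p q.1) (y + ε)} := by
      ext q
      simp only [op, h, if_false, mem_inter_iff, mem_prod, mem_ofPred_eq, Real.ball_eq_Ioo, mem_Ioo,
        max_lt_iff, lt_min_iff]
      tauto
    have hlt : ∀ b' ∈ W ∩ C.op p.1.1, max (S.lo p b') (y - ε) < min (S.hi p b') (y + ε) := by
      rintro b' ⟨h1, h2⟩
      have h3 := (hW1 h1).2 (C.op_sub _ h2)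
      have h4 : S.lo p b' < S.hi p b' := S.mono p.1.1 _ _ (by omega) p.2.2 b' h2
      simp only [max_lt_iff, lt_min_iff]
      exact ⟨⟨h4, h3.2⟩, h3.1, by linarith⟩
    refine ⟨W ×ˢ Metric.ball y ε, prod_mem_nhds hW (Metric.ball_mem_nhds _ hε), ?_, ?_, ?_⟩
    · exact (prod_mono (hW1.trans inter_subset_left) hball).trans hVV
    · rw [heq]
      obtain ⟨b', hb'⟩ := hW2
      obtain ⟨z, hz1, hz2⟩ := exists_between (hlt b' hb')
      exact ⟨(b', z), hb', hz1, hz2⟩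
    · rw [heq]
      have hs : W ∩ C.op p.1.1 ⊆ C.cl p.1.1 := inter_subset_right.trans (C.op_sub _)
      exact band_preconn hW3 (ContinuousOn.sup ((S.locont p).mono hs) continuousOn_const)
        (ContinuousOn.inf ((S.hicont p).mono hs) continuousOn_const) hlt

/-- the lifted complex -/
noncomputable def lift : RC (E × ℝ) where
  ι := S.ix
  dim p := C.dim p.1.1 + p.1.2.2
  op := S.op
  cl := S.cl
  nrm p := LiftAux.nrm (C.nrm p.1.1) (S.lo p) (S.hi p)
  th p := LiftAux.th (C.th p.1.1) (S.lo p) (S.hi p)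
  cl_compact p := LiftAux.cl_compact (C.cl_compact _) (S.locont p) (S.hicont p) (S.lo_le_hi p)
  op_sub := S.op_sub
  cover p x hx := by
    obtain ⟨c', hc'⟩ := C.cover _ _ hx.1
    have hsub := C.front _ _ _ hx.1 hc'
    obtain ⟨j1, hj1, e1⟩ := S.face _ _ ⟨_, hc'⟩ hsub p.1.2.1 (by have := p.2.2; omega)
    obtain ⟨j2, hj2, e2⟩ := S.face _ _ ⟨_, hc'⟩ hsub _ p.2.2
    have h1 := hx.2.1
    have h2 := hx.2.2
    unfold lo at h1
    unfold hi at h2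
    rw [e1 _ hc'] at h1
    rw [e2 _ hc'] at h2
    obtain ⟨p', -, h⟩ := S.loc c' hc' h1 h2 hj1 hj2
    exact ⟨p', h⟩
  disj p p' x h1 h2 := by
    have h3 := C.disj _ _ _ h1.1 h2.1
    obtain ⟨⟨c, j, e⟩, hp⟩ := p
    obtain ⟨⟨c', j', e'⟩, hp'⟩ := p'
    simp only at h3
    subst h3
    have a1 := h1.2
    have a2 := h2.2
    have hb : x.1 ∈ C.op c := h1.1
    simp only [lo, hi] at a1 a2 hp hp'
    apply Subtype.ext
    have : j = j' ∧ e = e' := by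
      split_ifs at a1 a2 with h4 h5 h5
      · have l1 := S.le_of_le c (i := j) (j := j') (by omega) hb (by linarith)
        have l2 := S.le_of_le c (i := j') (j := j) (by omega) hb (by linarith)
        omega
      · have l1 := S.lt_of_lt c (i := j) (j := j' + e') (by omega) (by omega) hb (by linarith)
        have l2 := S.lt_of_lt c (i := j') (j := j) (by omega) (by omega) hb (by linarith)
        omega
      · have l1 := S.lt_of_lt c (i := j') (j := j + e) (by omega) (by omega) hb (by linarith)
        have l2 := S.lt_of_lt c (i := j) (j := j') (by omega) (by omega) hb (by linarith)
        omega
      · have l1 := S.lt_of_lt c (i := j) (j := j' + e') (by omega) (by omega) hb (by linarith)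
        have l2 := S.lt_of_lt c (i := j') (j := j + e) (by omega) (by omega) hb (by linarith)
        omega
    simp [this.1, this.2]
  lf := S.lf
  front p p' x h1 h2 := by
    obtain ⟨j1, j2, l1, l2, l3, e1, e2⟩ := S.face_idx p p' x h1 h2
    intro y hy
    refine ⟨C.front _ _ _ h1.1 h2.1 hy.1, ?_, ?_⟩
    · rw [e1 _ hy.1]
      refine le_trans (S.mono_le _ l1 (by omega) hy.1) (S.op_sub _ hy).2.1
    · rw [e2 _ hy.1]
      exact le_trans (S.op_sub _ hy).2.2 (S.mono_le _ l2 l3 hy.1)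
  front_dim p p' x h1 h2 := by
    obtain ⟨j1, j2, l1, l2, l3, e1, e2⟩ := S.face_idx p p' x h1 h2
    have he : p'.1.2.2 ≤ p.1.2.2 := by
      by_contra h
      have h3 := p'.2.1
      have h4 : p.1.2.2 = 0 := by omega
      have h5 : p'.1.2.2 = 1 := by omega
      have h6 : S.lo p x.1 = S.hi p x.1 := by simp [lo, hi, h4]
      rw [e1 _ h2.1, e2 _ h2.1] at h6
      have := S.mono _ j1 j2 (by omega) l3 _ h2.1
      linarith
    rcases C.front_dim _ _ _ h1.1 h2.1 with h | h
    · obtain ⟨⟨c, j, e⟩, hp⟩ := p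
      obtain ⟨⟨c', j', e'⟩, hp'⟩ := p'
      simp only at h
      subst h
      simp only at he ⊢
      rcases he.eq_or_lt with h3 | h3
      · left
        simp only [lo, hi] at e1 e2 l1 l2 l3 hp hp'
        have hb : x.1 ∈ C.op c' := h2.1
        have a1 := S.le_of_le c' (by omega) hb (e1 _ hb).le
        have a2 := S.le_of_le c' (by omega) hb (e1 _ hb).ge
        have a3 := S.le_of_le c' (by omega) hb (e2 _ hb).le
        have a4 := S.le_of_le c' (by omega) hb (e2 _ hb).ge
        apply Subtype.ext
        simp only [Prod.mk.injEq, true_and]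
        omega
      · right; omega
    · right; omega
  conn := S.conn
  lconn p x hx V hV := S.lconn p x hx V hV
  nrm_cont p := LiftAux.nrm_cont (S.locont p) (S.hicont p) (C.nrm_cont _) (C.nrm_le _) (S.deg p)
  nrm_nonneg p x hx := le_max_of_le_left (C.nrm_nonneg _ _ hx.1)
  nrm_le p x hx := max_le (C.nrm_le _ _ hx.1) (LiftAux.q_le hx)
  nrm_eq p x hx := by
    have h0 := C.nrm_eq _ _ hx.1
    have h1 := C.nrm_le _ _ hx.1
    have h2 := LiftAux.q_le hx
    have h3 : LiftAux.nrm (C.nrm p.1.1) (S.lo p) (S.hi p) x = 1 ↔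
        (C.nrm p.1.1 x.1 = 1 ∨ LiftAux.q (S.lo p) (S.hi p) x = 1) := by
      unfold LiftAux.nrm
      constructor
      · intro h
        rcases max_choice (C.nrm p.1.1 x.1) (LiftAux.q (S.lo p) (S.hi p) x) with h' | h' <;> rw [h'] at h
        · exact Or.inl h
        · exact Or.inr h
      · rintro (h | h)
        · rw [h]; exact max_eq_left h2
        · rw [h]; exact max_eq_right h1
    rw [h3, h0]
    unfold op
    simp only [mem_ofPred_eq, not_and]
    by_cases hb : x.1 ∈ C.op p.1.1
    · simp only [hb, not_true_eq_false, false_or, true_imp_iff]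
      by_cases he : p.1.2.2 = 0
      · have h4 : S.lo p x.1 = S.hi p x.1 := by simp [lo, hi, he]
        have h5 : x.2 = S.lo p x.1 := le_antisymm (by rw [h4]; exact hx.2.2) hx.2.1
        simp [he, h5, LiftAux.q, h4]
      · have h4 : S.lo p x.1 < S.hi p x.1 := S.mono p.1.1 _ _ (by omega) p.2.2 _ hb
        rw [LiftAux.q_eq_one hx h4]
        simp only [he, if_false, not_and_or, not_lt]
        have h5 := hx.2.1
        have h6 := hx.2.2
        constructor
        · rintro (h | h)
          · left; exact h.le
          · right; exact h.ge
        · rintro (h | h)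
          · left; linarith
          · right; linarith
    · simp [hb]
  th_cont p := LiftAux.th_cont (S.locont p) (S.hicont p) (C.th_cont _) (C.th_mem _) (C.th_one _) (S.lo_le_hi p) (S.deg p)
  th_mem p := LiftAux.th_mem (C.th_mem _) (S.lo_le_hi p)
  th_nrm p := LiftAux.th_nrm (C.th_mem _) (C.th_nrm _) (S.deg p) (S.lo_le_hi p)
  th_one p := LiftAux.th_one (C.th_one _)
  th_th p := LiftAux.th_th (C.th_mem _) (C.th_nrm _) (C.nrm_nonneg _) (C.th_one _) (C.th_th _) (S.deg p)
  bdd := by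
    obtain ⟨d, hd⟩ := C.bdd
    exact ⟨d + 1, fun p => add_le_add (hd p.1.1) p.2.1⟩

end RC.Sections
end Piece2

section Piece3
open unitInterval Topology Set Filter

/-- neighbourhood strong deformation retraction with trajectory control -/
def HasSDR {E : Type} [TopologicalSpace E] (X A : Set E) : Prop :=
  ∃ (W : Set E) (H : E → ℝ → E), A ⊆ W ∧ (∃ O, IsOpen O ∧ W = O ∩ X) ∧
    ContinuousOn (fun q : E × ℝ => H q.1 q.2) (W ×ˢ Icc 0 1) ∧
    (∀ x ∈ W, ∀ t ∈ Icc (0:ℝ) 1, H x t ∈ W) ∧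
    (∀ x ∈ W, H x 0 = x) ∧ (∀ x ∈ W, H x 1 ∈ A) ∧ (∀ x ∈ A, ∀ t ∈ Icc (0:ℝ) 1, H x t = x) ∧
    (∀ x ∈ W, ∀ s ∈ Icc (0:ℝ) 1, ∀ t ∈ Icc (0:ℝ) 1, ∃ u ∈ Icc (0:ℝ) 1, H (H x s) t = H x u) ∧
    (∀ x ∈ W, ∀ s ∈ Icc (0:ℝ) 1, H (H x s) 1 = H x 1)

theorem HasSDR.refl {E : Type} [TopologicalSpace E] (A : Set E) : HasSDR A A :=
  ⟨A, fun x _ => x, subset_rfl, ⟨univ, isOpen_univ, by simp⟩, continuousOn_fst, fun x hx _ _ => hx,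
    fun _ _ => rfl, fun x hx => hx, fun _ _ _ _ => rfl, fun x _ s hs t ht => ⟨s, hs, rfl⟩, fun _ _ _ _ => rfl⟩

theorem HasSDR.trans {E : Type} [TopologicalSpace E] {X' X A : Set E} (hX : X ⊆ X') (h1 : HasSDR X' X)
    (h2 : HasSDR X A) : HasSDR X' A := by
  obtain ⟨W1, G, a1, ⟨O1, hO1, rfl⟩, a3, a4, a5, a6, a7, a8, a9⟩ := h1
  obtain ⟨W2, H, b1, ⟨O2, hO2, rfl⟩, b3, b4, b5, b6, b7, b8, b9⟩ := h2
  have one_mem : (1:ℝ) ∈ Icc (0:ℝ) 1 := ⟨zero_le_one, le_rfl⟩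
  have zero_mem : (0:ℝ) ∈ Icc (0:ℝ) 1 := ⟨le_rfl, zero_le_one⟩
  set W1 := O1 ∩ X' with hW1
  set W := {x ∈ W1 | G x 1 ∈ O2} with hW
  have hr : ContinuousOn (fun x => G x 1) W1 :=
    a3.comp (f := fun x => (x, (1:ℝ))) (by fun_prop) (fun x hx => ⟨hx, one_mem⟩)
  have hWr : ∀ x ∈ W, G x 1 ∈ O2 ∩ X := fun x hx => ⟨hx.2, a6 x hx.1⟩
  have hW2W : O2 ∩ X ⊆ W := fun x hx => ⟨a1 hx.2, by rw [a7 x hx.2 1 one_mem]; exact hx.1⟩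
  have hGW : ∀ x ∈ W, ∀ t ∈ Icc (0:ℝ) 1, G x t ∈ W := fun x hx t ht =>
    ⟨a4 x hx.1 t ht, by rw [a9 x hx.1 t ht]; exact hx.2⟩
  have hd : ∀ t ∈ Icc (0:ℝ) 1, t ≤ 1/2 → 2 * t ∈ Icc (0:ℝ) 1 := fun t ht h => ⟨by linarith [ht.1], by linarith⟩
  have hu : ∀ t ∈ Icc (0:ℝ) 1, ¬ t ≤ 1/2 → 2 * t - 1 ∈ Icc (0:ℝ) 1 := fun t ht h => ⟨by linarith, by linarith [ht.2]⟩
  let K : E → ℝ → E := fun x t => if t ≤ 1/2 then G x (2*t) else H (G x 1) (2*t-1)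
  have Klo : ∀ x t, t ≤ 1/2 → K x t = G x (2*t) := fun x t h => if_pos h
  have Khi : ∀ x t, ¬ t ≤ 1/2 → K x t = H (G x 1) (2*t-1) := fun x t h => if_neg h
  have Khi' : ∀ x ∈ W, ∀ t, 1/2 ≤ t → K x t = H (G x 1) (2*t-1) := by
    intro x hx t h
    rcases h.eq_or_lt with h | h
    · rw [Klo _ _ h.ge, ← h]; norm_num
      rw [b5 _ (hWr x hx)]
    · exact Khi _ _ (not_le.mpr h)
  refine ⟨W, K, fun x hx => hW2W (b1 hx), ?_, ?_, ?_, ?_, ?_, ?_, ?_, ?_⟩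
  · obtain ⟨O3, hO3, h⟩ := (continuousOn_iff'.mp hr) O2 hO2
    refine ⟨O1 ∩ O3, hO1.inter hO3, ?_⟩
    have : W = (fun x => G x 1) ⁻¹' O2 ∩ W1 := by ext x; simp [hW, and_comm]
    rw [this, h, hW1]; ext x; simp; tauto
  · have c1 : ContinuousOn (fun q : E × ℝ => G q.1 (2 * q.2)) ((W ×ˢ Icc (0:ℝ) 1) ∩ {q | q.2 ≤ 1/2}) := by
      refine a3.comp (f := fun q : E × ℝ => (q.1, 2 * q.2)) (by fun_prop) ?_
      rintro q ⟨⟨h1, h2⟩, h3⟩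
      exact ⟨h1.1, hd _ h2 h3⟩
    have c2 : ContinuousOn (fun q : E × ℝ => H (G q.1 1) (2 * q.2 - 1)) ((W ×ˢ Icc (0:ℝ) 1) ∩ {q | 1/2 ≤ q.2}) := by
      refine b3.comp (f := fun q : E × ℝ => (G q.1 1, 2 * q.2 - 1)) ?_ ?_
      · refine ContinuousOn.prodMk ?_ (by fun_prop)
        exact hr.comp continuousOn_fst (fun q hq => hq.1.1.1)
      · rintro q ⟨⟨h1, h2⟩, h3⟩
        exact ⟨hWr _ h1, ⟨by have : (1:ℝ)/2 ≤ q.2 := h3; linarith, by linarith [h2.2]⟩⟩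
    have c1' : ContinuousOn (fun q : E × ℝ => K q.1 q.2) ((W ×ˢ Icc (0:ℝ) 1) ∩ {q | q.2 ≤ 1/2}) :=
      c1.congr (fun q hq => Klo _ _ hq.2)
    have c2' : ContinuousOn (fun q : E × ℝ => K q.1 q.2) ((W ×ˢ Icc (0:ℝ) 1) ∩ {q | 1/2 ≤ q.2}) :=
      c2.congr (fun q hq => Khi' _ hq.1.1 _ hq.2)
    intro q hq
    have hcl1 : IsClosed {q : E × ℝ | q.2 ≤ 1/2} := isClosed_le continuous_snd continuous_const
    have hcl2 : IsClosed {q : E × ℝ | 1/2 ≤ q.2} := isClosed_le continuous_const continuous_snd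
    have key : ∀ S : Set (E × ℝ), IsClosed S → ContinuousOn (fun q : E × ℝ => K q.1 q.2) ((W ×ˢ Icc (0:ℝ) 1) ∩ S) →
        ContinuousWithinAt (fun q : E × ℝ => K q.1 q.2) ((W ×ˢ Icc (0:ℝ) 1) ∩ S) q := by
      intro S hS hc
      by_cases h : q ∈ S
      · exact hc q ⟨hq, h⟩
      · refine continuousWithinAt_of_notMem_closure (fun h' => h ?_)
        exact hS.closure_subset_iff.mpr inter_subset_right h'
    have := (key _ hcl1 c1').union (key _ hcl2 c2')
    rw [← inter_union_distrib_left] at this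
    refine this.mono (fun z hz => ⟨hz, ?_⟩)
    exact le_total z.2 (1/2)
  · intro x hx t ht
    by_cases h : t ≤ 1/2
    · rw [Klo _ _ h]; exact hGW x hx _ (hd t ht h)
    · rw [Khi _ _ h]; exact hW2W (b4 _ (hWr x hx) _ (hu t ht h))
  · intro x hx; rw [Klo _ _ (by norm_num), mul_zero]; exact a5 x hx.1
  · intro x hx; rw [Khi _ _ (by norm_num)]; norm_num; exact b6 _ (hWr x hx)
  · intro x hx t ht
    have hxX : x ∈ X := (b1 hx).2
    by_cases h : t ≤ 1/2
    · rw [Klo _ _ h]; exact a7 x hxX _ (hd t ht h)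
    · rw [Khi _ _ h, a7 x hxX 1 one_mem]; exact b7 x hx _ (hu t ht h)
  · intro x hx s hs t ht
    by_cases h : s ≤ 1/2
    · rw [Klo x s h]
      by_cases h' : t ≤ 1/2
      · rw [Klo _ t h']
        obtain ⟨u, hu1, hu2⟩ := a8 x hx.1 _ (hd s hs h) _ (hd t ht h')
        refine ⟨u/2, ⟨by linarith [hu1.1], by linarith [hu1.2]⟩, ?_⟩
        rw [Klo _ _ (by linarith [hu1.2]), hu2]; congr 1; ring
      · refine ⟨t, ht, ?_⟩
        rw [Khi _ t h', a9 x hx.1 _ (hd s hs h), Khi _ t h']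
    · have hy := b4 _ (hWr x hx) _ (hu s hs h)
      rw [Khi x s h]
      by_cases h' : t ≤ 1/2
      · refine ⟨s, hs, ?_⟩
        rw [Klo _ t h', Khi x s h, a7 _ hy.2 _ (hd t ht h')]
      · obtain ⟨u, hu1, hu2⟩ := b8 _ (hWr x hx) _ (hu s hs h) _ (hu t ht h')
        refine ⟨(u+1)/2, ⟨by linarith [hu1.1], by linarith [hu1.2]⟩, ?_⟩
        rw [Khi _ t h', a7 _ hy.2 _ one_mem, hu2, Khi' x hx _ (by linarith [hu1.1])]
        congr 1; ring
  · intro x hx s hs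
    have n1 : ¬ (1:ℝ) ≤ 1/2 := by norm_num
    by_cases h : s ≤ 1/2
    · rw [Klo x s h, Khi _ _ n1, Khi _ _ n1, a9 x hx.1 _ (hd s hs h)]
    · have hy := b4 _ (hWr x hx) _ (hu s hs h)
      rw [Khi x s h, Khi _ _ n1, Khi _ _ n1, a7 _ hy.2 _ one_mem]
      norm_num
      exact b9 _ (hWr x hx) _ (hu s hs h)

theorem continuousOn_of_lf {Y Y' κ : Type*} [TopologicalSpace Y] [TopologicalSpace Y'] {g : Y → Y'}
    {f : κ → Set Y} (hf : LocallyFinite f) (hcl : ∀ i, IsClosed (f i)) {Z : Set Y} (hZ : Z ⊆ ⋃ i, f i)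
    (hg : ∀ i, ContinuousOn g (Z ∩ f i)) : ContinuousOn g Z := by
  rw [continuousOn_iff_continuous_restrict]
  have h1 : LocallyFinite (fun i => (Subtype.val : Z → Y) ⁻¹' f i) :=
    hf.preimage_continuous continuous_subtype_val
  refine h1.continuous ?_ (fun i => (hcl i).preimage continuous_subtype_val) ?_
  · rw [← preimage_iUnion]
    exact eq_univ_of_forall (fun z => hZ z.2)
  · intro i
    refine (hg i).comp continuous_subtype_val.continuousOn ?_
    intro z hz; exact ⟨z.2, hz⟩

namespace RC
variable {E : Type} [TopologicalSpace E] [T2Space E] (C : RC E)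

theorem cl_sub_closure (c : C.ι) : C.cl c ⊆ closure (C.op c) := by
  intro x hx
  rw [mem_closure_iff_nhds]
  intro t ht
  obtain ⟨V', h1, h2, ⟨y, h3⟩, -⟩ := C.lconn c x hx t ht
  exact ⟨y, h2 h3.1, h3.2⟩

def skel (X A : Set E) (d : ℕ) : Set E := A ∪ ⋃ c : {c : C.ι // C.op c ⊆ X ∧ C.dim c < d}, C.cl c

theorem skel_closed {X A : Set E} (hA : IsClosed A) (d : ℕ) : IsClosed (C.skel X A d) := by
  refine hA.union ?_
  refine LocallyFinite.isClosed_iUnion ?_ (fun c => (C.cl_compact _).isClosed)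
  exact C.lf.comp_injective Subtype.val_injective

theorem mem_skel_of_op {X A : Set E} (hAo : ∀ c, (C.op c ∩ A).Nonempty → C.op c ⊆ A) {d : ℕ} {c : C.ι} (hd : d ≤ C.dim c)
    {x : E} (hx : x ∈ C.op c) (h : x ∈ C.skel X A d) : C.op c ⊆ A := by
  rcases h with h | h
  · exact hAo c ⟨x, hx, h⟩
  · rw [mem_iUnion] at h
    obtain ⟨⟨c', h1, h2⟩, h3⟩ := h
    rcases C.front_dim _ _ _ h3 hx with h4 | h4
    · subst h4; omega
    · have h5 : C.dim c < C.dim c' := h4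
      omega

theorem stage {X A : Set E} (hX : IsClosed X) (hA : IsClosed A)
    (hXo : ∀ c, (C.op c ∩ X).Nonempty → C.op c ⊆ X)
    (hAo : ∀ c, (C.op c ∩ A).Nonempty → C.op c ⊆ A) (d : ℕ) :
    HasSDR (C.skel X A (d+1)) (C.skel X A d) := by
  classical
  have one_mem : (1:ℝ) ∈ Icc (0:ℝ) 1 := ⟨zero_le_one, le_rfl⟩
  let P : C.ι → Prop := fun c => C.op c ⊆ X ∧ C.dim c = d ∧ ¬ C.op c ⊆ A
  have hclX : ∀ c, C.op c ⊆ X → C.cl c ⊆ X := fun c hc =>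
    (C.cl_sub_closure c).trans (hX.closure_subset_iff.mpr hc)
  have hnotin : ∀ c, P c → ∀ x ∈ C.op c, x ∉ C.skel X A d := fun c hc x hx h =>
    hc.2.2 (C.mem_skel_of_op hAo hc.2.1.ge hx h)
  have hbd : ∀ c, P c → ∀ x ∈ C.cl c, x ∉ C.op c → x ∈ C.skel X A d := by
    intro c hc x hx hx'
    obtain ⟨c', hc'⟩ := C.cover c x hx
    refine Or.inr (mem_iUnion.mpr ⟨⟨c', ?_, ?_⟩, C.op_sub _ hc'⟩)
    · exact hXo c' ⟨x, hc', hclX c hc.1 hx⟩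
    · rcases C.front_dim _ _ _ hx hc' with h | h
      · subst h; exact absurd hc' hx'
      · rw [← hc.2.1]; exact h
  have hdecomp : ∀ x ∈ C.skel X A (d+1), x ∈ C.skel X A d ∨ ∃ c, P c ∧ x ∈ C.op c := by
    rintro x (h | h)
    · exact Or.inl (Or.inl h)
    · rw [mem_iUnion] at h
      obtain ⟨⟨c, h1, h2⟩, h3⟩ := h
      by_cases h4 : C.op c ⊆ A
      · left; left
        exact hA.closure_subset_iff.mpr h4 (C.cl_sub_closure c h3)
      · by_cases h5 : C.dim c = d
        · by_cases h6 : x ∈ C.op c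
          · exact Or.inr ⟨c, ⟨h1, h5, h4⟩, h6⟩
          · exact Or.inl (hbd c ⟨h1, h5, h4⟩ x h3 h6)
        · left; right
          exact mem_iUnion.mpr ⟨⟨c, h1, by omega⟩, h3⟩
  have hsub : C.skel X A d ⊆ C.skel X A (d+1) := by
    rintro x (h | h)
    · exact Or.inl h
    · rw [mem_iUnion] at h
      obtain ⟨⟨c, h1, h2⟩, h3⟩ := h
      exact Or.inr (mem_iUnion.mpr ⟨⟨c, h1, by omega⟩, h3⟩)
  have hclsub : ∀ c, P c → C.cl c ⊆ C.skel X A (d+1) := fun c hc x hx =>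
    Or.inr (mem_iUnion.mpr ⟨⟨c, hc.1, by have := hc.2.1; omega⟩, hx⟩)
  -- centres
  let Z : Set E := ⋃ c : {c : C.ι // P c}, {x ∈ C.cl c | C.nrm c x = 0}
  have hZcl : IsClosed Z := by
    refine LocallyFinite.isClosed_iUnion ?_ ?_
    · refine (C.lf.comp_injective (g := (Subtype.val : {c : C.ι // P c} → C.ι)) Subtype.val_injective).subset ?_
      intro c x hx; exact hx.1
    · intro c
      have := (C.nrm_cont c).preimage_isClosed_of_isClosed (C.cl_compact c).isClosed (isClosed_singleton (x := (0:ℝ)))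
      exact this
  let W : Set E := Zᶜ ∩ C.skel X A (d+1)
  let s : C.ι → E → ℝ → ℝ := fun c x u => 1 - u + u / C.nrm c x
  let G : E → ℝ → E := fun x u => if h : ∃ c, P c ∧ x ∈ C.op c then C.th h.choose x (s h.choose x u) else x
  have G1 : ∀ c, P c → ∀ x ∈ C.op c, ∀ u, G x u = C.th c x (s c x u) := by
    intro c hc x hx u
    have h : ∃ c, P c ∧ x ∈ C.op c := ⟨c, hc, hx⟩
    have h2 : h.choose = c := C.disj _ _ x h.choose_spec.2 hx
    simp only [G, dif_pos h, h2]
  have G2 : ∀ x ∈ C.skel X A d, ∀ u, G x u = x := by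
    intro x hx u
    have h : ¬ ∃ c, P c ∧ x ∈ C.op c := by
      rintro ⟨c, h1, h2⟩; exact hnotin c h1 x h2 hx
    simp only [G, dif_neg h]
  have pos : ∀ c, P c → ∀ x ∈ W, x ∈ C.cl c → 0 < C.nrm c x := by
    intro c hc x hx hxc
    refine lt_of_le_of_ne (C.nrm_nonneg c x hxc) (fun h => hx.1 ?_)
    exact mem_iUnion.mpr ⟨⟨c, hc⟩, hxc, h.symm⟩
  have G1' : ∀ c, P c → ∀ x ∈ W, x ∈ C.cl c → ∀ u, G x u = C.th c x (s c x u) := by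
    intro c hc x hx hxc u
    by_cases h : x ∈ C.op c
    · exact G1 c hc x h u
    · rw [G2 x (hbd c hc x hxc h)]
      have h1 := (C.nrm_eq c x hxc).mpr h
      simp only [s, h1]
      rw [show 1 - u + u / 1 = 1 by ring, C.th_one c x hxc]
  have hs1 : ∀ c, P c → ∀ x ∈ W, x ∈ C.cl c → ∀ u ∈ Icc (0:ℝ) 1, 1 ≤ s c x u ∧ s c x u * C.nrm c x ≤ 1
      ∧ 0 < s c x u * C.nrm c x := by
    intro c hc x hx hxc u hu
    have h1 := pos c hc x hx hxc
    have h2 := C.nrm_le c x hxc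
    have h3 : u ≤ u / C.nrm c x := by rw [le_div_iff₀ h1]; nlinarith [hu.1]
    have h4 : s c x u * C.nrm c x = (1-u) * C.nrm c x + u := by
      simp only [s]; field_simp
    refine ⟨by simp only [s]; linarith, ?_, ?_⟩
    · rw [h4]; nlinarith [hu.2, hu.1]
    · have : 1 ≤ s c x u := by simp only [s]; linarith
      positivity
  have hW0 : C.skel X A d ⊆ W := by
    intro x hx
    refine ⟨?_, hsub hx⟩
    rintro h
    rw [mem_iUnion] at h
    obtain ⟨⟨c, hc⟩, h1, h2⟩ := h
    have h3 : x ∈ C.op c := by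
      by_contra h3
      have := (C.nrm_eq c x h1).mpr h3
      simp only at h2
      linarith
    exact hnotin c hc x h3 hx
  have hmem : ∀ c, P c → ∀ x ∈ C.cl c, 0 < C.nrm c x → x ∈ W := by
    intro c hc x hx h
    refine ⟨?_, hclsub c hc hx⟩
    intro h'
    rw [mem_iUnion] at h'
    obtain ⟨⟨c', hc'⟩, h1, h2⟩ := h'
    simp only at h1 h2
    have h3 : x ∈ C.op c' := by
      by_contra h3
      have := (C.nrm_eq c' x h1).mpr h3
      linarith
    rcases C.front_dim _ _ _ hx h3 with h4 | h4
    · subst h4; linarith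
    · have := hc.2.1; have := hc'.2.1; omega
  have hwdec : ∀ x ∈ W, x ∈ C.skel X A d ∨ ∃ c, P c ∧ x ∈ C.op c := fun x hx => hdecomp x hx.2
  have hthcl : ∀ c, P c → ∀ x ∈ W, x ∈ C.cl c → ∀ u ∈ Icc (0:ℝ) 1, C.th c x (s c x u) ∈ C.cl c ∧
      C.nrm c (C.th c x (s c x u)) = s c x u * C.nrm c x ∧ C.th c x (s c x u) ∈ W := by
    intro c hc x hx hxc u hu
    obtain ⟨a1, a2, a3⟩ := hs1 c hc x hx hxc u hu
    have b1 := C.th_mem c x hxc _ a1 a2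
    have b2 := C.th_nrm c x hxc _ a1 a2
    exact ⟨b1, b2, hmem c hc _ b1 (by rw [b2]; exact a3)⟩
  -- composition
  have hcomp : ∀ c, P c → ∀ x ∈ W, x ∈ C.cl c → ∀ u ∈ Icc (0:ℝ) 1, ∀ v ∈ Icc (0:ℝ) 1,
      G (G x u) v = G x (u + v - u * v) := by
    intro c hc x hx hxc u hu v hv
    obtain ⟨a1, a2, a3⟩ := hs1 c hc x hx hxc u hu
    obtain ⟨b1, b2, b3⟩ := hthcl c hc x hx hxc u hu
    obtain ⟨d1, d2, d3⟩ := hs1 c hc _ b3 b1 v hv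
    have hp := pos c hc x hx hxc
    have hss : s c x u * s c (C.th c x (s c x u)) v = s c x (u + v - u * v) := by
      have : s c (C.th c x (s c x u)) v = 1 - v + v / (s c x u * C.nrm c x) := by
        simp only [s] at b2 ⊢; rw [b2]
      rw [this]
      have h5 : 0 < s c x u := by linarith
      have h6 : s c x u * (v / (s c x u * C.nrm c x)) = v / C.nrm c x := by
        field_simp
      rw [mul_add, h6]
      simp only [s]; field_simp; ring
    rw [G1' c hc x hx hxc u, G1' c hc _ b3 b1 v, G1' c hc x hx hxc]
    rw [C.th_th c x hxc _ _ a1 d1, hss]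
    rw [hss]
    exact (hs1 c hc x hx hxc (u + v - u * v) ⟨by nlinarith [hu.1, hu.2, hv.1, hv.2], by nlinarith [hu.1, hu.2, hv.1, hv.2]⟩).2.1
  refine ⟨W, G, hW0, ⟨Zᶜ, hZcl.isOpen_compl, rfl⟩, ?_, ?_, ?_, ?_, ?_, ?_, ?_⟩
  · let f : Option {c : C.ι // P c} → Set (E × ℝ) := fun o => match o with
      | none => C.skel X A d ×ˢ univ
      | some c => C.cl c ×ˢ univ
    have hf : LocallyFinite f := by
      rintro ⟨x, t⟩
      obtain ⟨V, hV, hfin⟩ := C.lf x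
      refine ⟨V ×ˢ univ, prod_mem_nhds hV univ_mem, ?_⟩
      have h1 : {c : {c : C.ι // P c} | (C.cl c ∩ V).Nonempty}.Finite :=
        hfin.preimage (f := Subtype.val) Subtype.val_injective.injOn
      refine ((h1.image some).insert none).subset ?_
      rintro (_ | c) ⟨⟨y, r⟩, h2, h3⟩
      · exact mem_insert _ _
      · exact mem_insert_of_mem _ ⟨c, ⟨y, h2.1, h3.1⟩, rfl⟩
    refine continuousOn_of_lf hf ?_ ?_ ?_
    · rintro (_ | c)
      · exact (C.skel_closed hA d).prod isClosed_univ
      · exact (C.cl_compact c).isClosed.prod isClosed_univ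
    · rintro ⟨x, t⟩ ⟨hx, ht⟩
      rcases hwdec x hx with h | ⟨c, hc, h⟩
      · exact mem_iUnion.mpr ⟨none, h, trivial⟩
      · exact mem_iUnion.mpr ⟨some ⟨c, hc⟩, C.op_sub _ h, trivial⟩
    · rintro (_ | ⟨c, hc⟩)
      · refine continuousOn_fst.congr ?_
        rintro ⟨x, t⟩ ⟨h1, h2⟩
        exact G2 x h2.1 t
      · have hn : ContinuousOn (fun q : E × ℝ => C.nrm c q.1) (W ×ˢ Icc 0 1 ∩ f (some ⟨c, hc⟩)) :=
          (C.nrm_cont c).comp continuousOn_fst (fun q hq => hq.2.1)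
        have : ContinuousOn (fun q : E × ℝ => C.th c q.1 (s c q.1 q.2)) (W ×ˢ Icc 0 1 ∩ f (some ⟨c, hc⟩)) := by
          refine (C.th_cont c).comp (f := fun q : E × ℝ => (q.1, s c q.1 q.2)) ?_ ?_
          · refine continuousOn_fst.prodMk ?_
            refine (continuousOn_const.sub continuousOn_snd).add (continuousOn_snd.div hn ?_)
            rintro q ⟨h1, h2⟩
            exact (pos c hc _ h1.1 h2.1).ne'
          · rintro q ⟨h1, h2⟩
            obtain ⟨a1, a2, a3⟩ := hs1 c hc q.1 h1.1 h2.1 q.2 h1.2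
            exact ⟨h2.1, a1, a2⟩
        refine this.congr ?_
        rintro q ⟨h1, h2⟩
        exact G1' c hc _ h1.1 h2.1 _
  · intro x hx t ht
    rcases hwdec x hx with h | ⟨c, hc, h⟩
    · rw [G2 x h]; exact hx
    · rw [G1 c hc x h]; exact (hthcl c hc x hx (C.op_sub _ h) t ht).2.2
  · intro x hx
    rcases hwdec x hx with h | ⟨c, hc, h⟩
    · rw [G2 x h]
    · rw [G1 c hc x h]; simp only [s, sub_zero, zero_div, add_zero]; exact C.th_one c x (C.op_sub _ h)
  · intro x hx
    rcases hwdec x hx with h | ⟨c, hc, h⟩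
    · rw [G2 x h]; exact h
    · obtain ⟨b1, b2, b3⟩ := hthcl c hc x hx (C.op_sub _ h) 1 one_mem
      rw [G1 c hc x h]
      refine hbd c hc _ b1 ?_
      rw [← C.nrm_eq c _ b1, b2]
      have := pos c hc x hx (C.op_sub _ h)
      simp only [s]; field_simp; ring
  · intro x hx t ht; exact G2 x hx t
  · intro x hx u hu v hv
    refine ⟨u + v - u * v, ⟨by nlinarith [hu.1, hu.2, hv.1, hv.2], by nlinarith [hu.1, hu.2, hv.1, hv.2]⟩, ?_⟩
    rcases hwdec x hx with h | ⟨c, hc, h⟩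
    · rw [G2 x h, G2 x h, G2 x h]
    · exact hcomp c hc x hx (C.op_sub _ h) u hu v hv
  · intro x hx u hu
    rcases hwdec x hx with h | ⟨c, hc, h⟩
    · rw [G2 x h]
    · rw [hcomp c hc x hx (C.op_sub _ h) u hu 1 one_mem]; congr 1; ring

theorem hasSDR {X A : Set E} (hX : IsClosed X) (hA : IsClosed A) (hAX : A ⊆ X)
    (hXc : ∀ x ∈ X, ∃ c, x ∈ C.op c)
    (hXo : ∀ c, (C.op c ∩ X).Nonempty → C.op c ⊆ X)
    (hAo : ∀ c, (C.op c ∩ A).Nonempty → C.op c ⊆ A) : HasSDR X A := by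
  have h : ∀ d, HasSDR (C.skel X A d) A := by
    intro d
    induction d with
    | zero =>
      have : C.skel X A 0 = A := by
        unfold skel
        ext x; simp
      rw [this]; exact HasSDR.refl A
    | succ d ih =>
      refine HasSDR.trans ?_ (C.stage hX hA hXo hAo d) ih
      rintro x (h | h)
      · exact Or.inl h
      · rw [mem_iUnion] at h
        obtain ⟨⟨c, h1, h2⟩, h3⟩ := h
        exact Or.inr (mem_iUnion.mpr ⟨⟨c, h1, by omega⟩, h3⟩)
  obtain ⟨d, hd⟩ := C.bdd
  have : C.skel X A (d+1) = X := by
    apply Subset.antisymm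
    · rintro x (h | h)
      · exact hAX h
      · rw [mem_iUnion] at h
        obtain ⟨⟨c, h1, h2⟩, h3⟩ := h
        exact hX.closure_subset_iff.mpr h1 (C.cl_sub_closure c h3)
    · intro x hx
      obtain ⟨c, hc⟩ := hXc x hx
      exact Or.inr (mem_iUnion.mpr ⟨⟨c, hXo c ⟨x, hc, hx⟩, by have := hd c; omega⟩, C.op_sub _ hc⟩)
  rw [← this]; exact h _

end RC
end Piece3

section Piece4
open unitInterval Topology Set Filter Polynomial

/-- real root set -/
noncomputable def rr (p : ℝ[X]) : Finset ℝ := p.roots.toFinset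
/-- complex root set -/
noncomputable def cr (p : ℝ[X]) : Finset ℂ := (p.map (algebraMap ℝ ℂ)).roots.toFinset

theorem mem_rr {p : ℝ[X]} (hp : p.Monic) {y : ℝ} : y ∈ rr p ↔ p.eval y = 0 := by
  simp [rr, mem_roots hp.ne_zero, IsRoot]

theorem mem_cr {p : ℝ[X]} (hp : p.Monic) {z : ℂ} : z ∈ cr p ↔ aeval z p = 0 := by
  simp [cr, mem_roots (hp.map _).ne_zero, IsRoot, eval_map_algebraMap]

theorem rr_cr {p : ℝ[X]} (hp : p.Monic) {y : ℝ} : (y : ℂ) ∈ cr p ↔ y ∈ rr p := by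
  rw [mem_cr hp, mem_rr hp]
  have : aeval (y : ℂ) p = ((p.eval y : ℝ) : ℂ) := by
    have := Polynomial.aeval_algebraMap_apply ℂ y p
    simpa using this
  rw [this]; exact Complex.ofReal_eq_zero

theorem conj_cr {p : ℝ[X]} (hp : p.Monic) {z : ℂ} (h : z ∈ cr p) : (starRingEnd ℂ) z ∈ cr p := by
  rw [mem_cr hp] at h ⊢
  rw [Polynomial.aeval_conj, h, map_zero]

theorem norm_aeval_ge {p : ℝ[X]} (hp : p.Monic) (z : ℂ) (ε : ℝ) (hε : 0 ≤ ε)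
    (h : ∀ w ∈ cr p, ε ≤ ‖w - z‖) : ε ^ p.natDegree ≤ ‖aeval z p‖ := by
  have hs : (p.map (algebraMap ℝ ℂ)).Splits := IsAlgClosed.splits _
  have h1 := hs.eq_prod_roots
  rw [(hp.map (algebraMap ℝ ℂ)).leadingCoeff] at h1
  have h2 : aeval z p = ((p.map (algebraMap ℝ ℂ)).roots.map (fun w => z - w)).prod := by
    rw [← eval_map_algebraMap]
    conv_lhs => rw [h1]
    simp [eval_multiset_prod]
  have hcard : (p.map (algebraMap ℝ ℂ)).roots.card = p.natDegree := by
    rw [← hs.natDegree_eq_card_roots, natDegree_map]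
  have h3 : ∀ w ∈ (p.map (algebraMap ℝ ℂ)).roots, ε ≤ ‖z - w‖ := by
    intro w hw
    rw [norm_sub_rev]; exact h w (by simpa [cr] using hw)
  rw [h2, ← hcard]
  generalize (p.map (algebraMap ℝ ℂ)).roots = s at h3
  induction s using Multiset.induction_on with
  | empty => simp
  | cons a s ih =>
    simp only [Multiset.card_cons, Multiset.map_cons, Multiset.prod_cons, norm_mul]
    rw [pow_succ, mul_comm]
    exact mul_le_mul (h3 a (by simp)) (ih (fun w hw => h3 w (by simp [hw]))) (by positivity) (norm_nonneg _)

section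
variable {E : Type} [TopologicalSpace E]

theorem cont_aeval {S : Set E} {b0 : E} {P : E → ℝ[X]} {n : ℕ} (hdeg : ∀ b ∈ S, (P b).natDegree = n)
    (hb0 : b0 ∈ S)
    (hc : ∀ i, ContinuousWithinAt (fun b => (P b).coeff i) S b0) (z : ℂ) :
    ContinuousWithinAt (fun b => aeval z (P b)) S b0 := by
  have h : ∀ b ∈ S, aeval z (P b) = ∑ i ∈ Finset.range (n+1), ((P b).coeff i : ℂ) * z ^ i := by
    intro b hb
    rw [aeval_eq_sum_range, hdeg b hb]
    simp
  refine ContinuousWithinAt.congr ?_ h (h b0 hb0)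
  refine tendsto_finsetSum _ (fun i _ => ?_)
  exact ((Complex.continuous_ofReal.continuousAt.comp_continuousWithinAt (hc i))).mul continuousWithinAt_const

theorem cont_eval {S : Set E} {P : E → ℝ[X]} {n : ℕ} (hdeg : ∀ b ∈ S, (P b).natDegree = n)
    (hc : ∀ i, ContinuousOn (fun b => (P b).coeff i) S) :
    ContinuousOn (fun q : E × ℝ => (P q.1).eval q.2) (S ×ˢ univ) := by
  have h : ∀ q ∈ S ×ˢ (univ : Set ℝ), (P q.1).eval q.2 = ∑ i ∈ Finset.range (n+1), ((P q.1).coeff i) * q.2 ^ i := by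
    intro b hb
    rw [eval_eq_sum_range, hdeg _ hb.1]
  refine ContinuousOn.congr ?_ h
  refine continuousOn_finsetSum _ (fun i _ => ?_)
  exact ((hc i).comp continuousOn_fst (fun q hq => hq.1)).mul (by fun_prop)

theorem root_near {S : Set E} {b0 : E} {P : E → ℝ[X]} {n : ℕ} (hm : ∀ b ∈ S, (P b).Monic)
    (hdeg : ∀ b ∈ S, (P b).natDegree = n) (hb0 : b0 ∈ S)
    (hc : ∀ i, ContinuousWithinAt (fun b => (P b).coeff i) S b0) {z : ℂ} (hz : z ∈ cr (P b0))
    {ε : ℝ} (hε : 0 < ε) : ∀ᶠ b in 𝓝[S] b0, ∃ w ∈ cr (P b), ‖w - z‖ < ε := by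
  have h1 := cont_aeval hdeg hb0 hc z
  have h2 : ∀ᶠ b in 𝓝[S] b0, ‖aeval z (P b)‖ < ε ^ n := by
    refine (h1.norm).eventually_lt continuousWithinAt_const ?_
    show ‖aeval z (P b0)‖ < ε ^ n
    rw [(mem_cr (hm b0 hb0)).mp hz, norm_zero]; positivity
  filter_upwards [h2, self_mem_nhdsWithin] with b hb hbS
  by_contra h
  push Not at h
  have := norm_aeval_ge (hm b hbS) z ε hε.le h
  rw [hdeg b hbS] at this
  linarith

theorem roots_bij {S : Set E} {P : E → ℝ[X]} {n m : ℕ} (hm : ∀ b ∈ S, (P b).Monic)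
    (hdeg : ∀ b ∈ S, (P b).natDegree = n)
    (hc : ∀ i, ContinuousOn (fun b => (P b).coeff i) S)
    (hcard : ∀ b ∈ S, (cr (P b)).card = m) {b0 : E} (hb0 : b0 ∈ S) {ε : ℝ} (hε : 0 < ε) :
    ∀ᶠ b in 𝓝[S] b0, ∃ g : ℝ → ℝ, BijOn g (rr (P b0)) (rr (P b)) ∧ ∀ y ∈ rr (P b0), |g y - y| < ε := by
  have hδ : ∀ᶠ δ in 𝓝[>] (0:ℝ), δ ≤ ε ∧ 0 < δ ∧ (∀ z ∈ cr (P b0), z.im ≠ 0 → δ ≤ |z.im|) ∧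
      ∀ z ∈ cr (P b0), ∀ z' ∈ cr (P b0), z ≠ z' → 2 * δ ≤ ‖z - z'‖ := by
    have hlt : ∀ r : ℝ, 0 < r → ∀ᶠ δ in 𝓝[>] (0:ℝ), δ ≤ r := fun r hr =>
      (eventually_le_nhds hr).filter_mono nhdsWithin_le_nhds
    refine (hlt ε hε).and (Eventually.and self_mem_nhdsWithin (Eventually.and ?_ ?_))
    · rw [Finset.eventually_all]
      intro z _
      by_cases h : z.im = 0
      · simp [h]
      · filter_upwards [hlt _ (abs_pos.mpr h)] with δ hδ _ using hδ
    · rw [Finset.eventually_all]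
      intro z _
      rw [Finset.eventually_all]
      intro z' _
      by_cases h : z = z'
      · simp [h]
      · have : 0 < ‖z - z'‖ := norm_pos_iff.mpr (sub_ne_zero.mpr h)
        filter_upwards [hlt (‖z - z'‖/2) (by positivity)] with δ hδ _
        linarith
  obtain ⟨δ, h1, h2, h3, h4⟩ := hδ.exists
  have hev : ∀ᶠ b in 𝓝[S] b0, ∀ z ∈ cr (P b0), ∃ w ∈ cr (P b), ‖w - z‖ < δ := by
    rw [Finset.eventually_all]
    intro z hz
    exact root_near hm hdeg hb0 (fun i => hc i b0 hb0) hz h2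
  filter_upwards [hev, self_mem_nhdsWithin] with b hb hbS
  choose! f hf1 hf2 using hb
  have huniq : ∀ z ∈ cr (P b0), ∀ z' ∈ cr (P b0), ∀ w, ‖w - z‖ < δ → ‖w - z'‖ < δ → z = z' := by
    intro z hz z' hz' w h5 h6
    by_contra h
    have h7 := h4 z hz z' hz' h
    have : ‖z - z'‖ ≤ ‖w - z‖ + ‖w - z'‖ := by
      rw [show z - z' = (w - z') - (w - z) by ring]
      linarith [norm_sub_le (w - z') (w - z)]
    linarith
  have hinj : InjOn f (cr (P b0)) := by
    intro z hz z' hz' h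
    exact huniq z hz z' hz' (f z) (hf2 z hz) (by rw [h]; exact hf2 z' hz')
  have hsurj : ∀ w ∈ cr (P b), ∃ z ∈ cr (P b0), f z = w := by
    have := Finset.surj_on_of_inj_on_of_card_le (s := cr (P b0)) (t := cr (P b)) (fun z _ => f z)
      (fun z hz => hf1 z hz) (fun z z' hz hz' h => hinj hz hz' h)
      (by rw [hcard b hbS, hcard b0 hb0])
    intro w hw
    obtain ⟨z, hz, h⟩ := this w hw
    exact ⟨z, hz, h.symm⟩
  have hreal : ∀ y ∈ rr (P b0), (f (y:ℂ)).im = 0 := by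
    intro y hy
    have hy' := (rr_cr (hm b0 hb0)).mpr hy
    obtain ⟨z', hz', h⟩ := hsurj _ (conj_cr (hm b hbS) (hf1 _ hy'))
    have h5 : ‖(starRingEnd ℂ) (f y) - y‖ < δ := by
      have : (starRingEnd ℂ) (f y) - y = (starRingEnd ℂ) (f y - y) := by simp
      rw [this, RCLike.norm_conj]; exact hf2 _ hy'
    have h6 : z' = y := huniq _ hz' _ hy' ((starRingEnd ℂ) (f y)) (by rw [← h]; exact hf2 _ hz') h5
    rw [h6] at h
    exact Complex.conj_eq_iff_im.mp h.symm
  have hfe : ∀ y ∈ rr (P b0), (((f (y:ℂ)).re : ℝ) : ℂ) = f (y:ℂ) := by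
    intro y hy
    apply Complex.ext <;> simp [hreal y hy]
  refine ⟨fun y => (f (y:ℂ)).re, ⟨?_, ?_, ?_⟩, ?_⟩
  · intro y hy
    have hy' := (rr_cr (hm b0 hb0)).mpr hy
    show _ ∈ rr (P b)
    rw [← rr_cr (hm b hbS), hfe y hy]
    exact hf1 _ hy'
  · intro y hy y' hy' h
    have e1 := hfe y hy
    have e2 := hfe y' hy'
    simp only at h
    rw [h, e2] at e1
    exact (Complex.ofReal_injective (hinj ((rr_cr (hm b0 hb0)).mpr hy') ((rr_cr (hm b0 hb0)).mpr hy) e1)).symm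
  · intro w hw
    obtain ⟨z, hz, h⟩ := hsurj _ ((rr_cr (hm b hbS)).mpr hw)
    have him : z.im = 0 := by
      by_contra h'
      have h5 := h3 z hz h'
      have h6 := hf2 z hz
      rw [h] at h6
      have h7 := Complex.abs_im_le_norm ((w:ℂ) - z)
      simp at h7
      linarith
    have hz2 : ((z.re : ℝ) : ℂ) = z := by apply Complex.ext <;> simp [him]
    refine ⟨z.re, ?_, ?_⟩
    · show z.re ∈ rr (P b0)
      rw [← rr_cr (hm b0 hb0), hz2]; exact hz
    · simp only [hz2, h, Complex.ofReal_re]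
  · intro y hy
    have hy' := (rr_cr (hm b0 hb0)).mpr hy
    have h5 := hf2 _ hy'
    have h7 := Complex.abs_re_le_norm (f y - y)
    simp at h7
    linarith

/-- locally constant on preconnected set -/
theorem preconn_const {S : Set E} (hS : IsPreconnected S) {φ : E → ℕ}
    (h : ∀ b0 ∈ S, ∀ᶠ b in 𝓝[S] b0, φ b = φ b0) {b b' : E} (hb : b ∈ S) (hb' : b' ∈ S) : φ b = φ b' := by
  have hc : ContinuousOn φ S := by
    intro b0 hb0
    unfold ContinuousWithinAt
    rw [nhds_discrete]
    exact tendsto_pure.mpr (h b0 hb0)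
  exact (hS.image φ hc).subsingleton (mem_image_of_mem _ hb) (mem_image_of_mem _ hb')

/-- ordered enumeration of roots -/
noncomputable def enum (s : Finset ℝ) (j : ℕ) : ℝ :=
  if h : j < s.card then s.orderEmbOfFin rfl ⟨j, h⟩ else 0

theorem enum_mem {s : Finset ℝ} {j : ℕ} (h : j < s.card) : enum s j ∈ s := by
  rw [enum, dif_pos h]; exact Finset.orderEmbOfFin_mem _ _ _

theorem enum_lt {s : Finset ℝ} {i j : ℕ} (hij : i < j) (h : j < s.card) : enum s i < enum s j := by
  unfold enum
  rw [dif_pos (hij.trans h), dif_pos h]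
  exact (s.orderEmbOfFin rfl).strictMono hij

theorem enum_surj {s : Finset ℝ} {y : ℝ} (h : y ∈ s) : ∃ j < s.card, enum s j = y := by
  have : y ∈ range (s.orderEmbOfFin rfl) := by rw [Finset.range_orderEmbOfFin]; exact h
  obtain ⟨⟨j, hj⟩, h2⟩ := this
  exact ⟨j, hj, by rw [enum, dif_pos hj]; exact h2⟩

theorem enum_bij {s t : Finset ℝ} {g : ℝ → ℝ} (hg : BijOn g s t) (hmono : StrictMonoOn g s) :
    s.card = t.card ∧ ∀ j < s.card, enum t j = g (enum s j) := by
  have hcard : s.card = t.card := by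
    have : s.image g = t := by
      apply Finset.coe_injective; rw [Finset.coe_image]; exact hg.image_eq
    rw [← this, Finset.card_image_of_injOn hg.injOn]
  refine ⟨hcard, fun j hj => ?_⟩
  let f : Fin s.card → ℝ := fun i => g (s.orderEmbOfFin rfl i)
  have hf : ∀ i, f i ∈ t := fun i => hg.mapsTo (Finset.orderEmbOfFin_mem _ _ _)
  have hfm : StrictMono f := fun i i' hii => hmono (Finset.orderEmbOfFin_mem _ _ _) (Finset.orderEmbOfFin_mem _ _ _) ((s.orderEmbOfFin rfl).strictMono hii)
  have := Finset.orderEmbOfFin_unique hcard.symm hf hfm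
  rw [enum, dif_pos (hcard ▸ hj), enum, dif_pos hj]
  have h2 := congrFun this ⟨j, hj⟩
  simp only [f] at h2
  rw [h2]
  simp only [Finset.orderEmbOfFin_apply]
  rfl

theorem enum_props {S : Set E} {R : E → Finset ℝ} 
    (hR : ∀ b0 ∈ S, ∀ ε > 0, ∀ᶠ b in 𝓝[S] b0, ∃ g : ℝ → ℝ, BijOn g (R b0) (R b) ∧ ∀ y ∈ R b0, |g y - y| < ε) :
    (∀ b0 ∈ S, ∀ᶠ b in 𝓝[S] b0, (R b).card = (R b0).card) ∧
    ∀ j, (∀ b ∈ S, j < (R b).card) → ContinuousOn (fun b => enum (R b) j) S := by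
  have key : ∀ b0 ∈ S, ∀ ε > 0, ∀ᶠ b in 𝓝[S] b0, (R b).card = (R b0).card ∧ ∀ j < (R b0).card, 
      |enum (R b) j - enum (R b0) j| < ε := by
    intro b0 hb0 ε hε
    have hδ : ∀ᶠ δ in 𝓝[>] (0:ℝ), δ ≤ ε ∧ 0 < δ ∧ 
      ∀ z ∈ R b0, ∀ z' ∈ R b0, z < z' → 2 * δ ≤ z' - z := by
      have hlt : ∀ r : ℝ, 0 < r → ∀ᶠ δ in 𝓝[>] (0:ℝ), δ ≤ r := fun r hr =>
        (eventually_le_nhds hr).filter_mono nhdsWithin_le_nhds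
      refine (hlt ε hε).and (Eventually.and self_mem_nhdsWithin ?_)
      rw [Finset.eventually_all]
      intro z _
      rw [Finset.eventually_all]
      intro z' _
      by_cases h : z < z'
      · filter_upwards [hlt ((z' - z)/2) (by linarith)] with δ hδ _
        linarith
      · simp [h]
    obtain ⟨δ, h1, h2, h3⟩ := hδ.exists
    filter_upwards [hR b0 hb0 δ h2] with b hb
    obtain ⟨g, hg1, hg2⟩ := hb
    have hmono : StrictMonoOn g (R b0) := by
      intro y hy y' hy' hlt
      have a1 := abs_lt.mp (hg2 y hy)
      have a2 := abs_lt.mp (hg2 y' hy')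
      have a3 := h3 y hy y' hy' hlt
      linarith
    obtain ⟨b1, b2⟩ := enum_bij hg1 hmono
    refine ⟨b1.symm, fun j hj => ?_⟩
    rw [b2 j hj]
    exact lt_of_lt_of_le (hg2 _ (enum_mem hj)) h1
  refine ⟨fun b0 hb0 => (key b0 hb0 1 one_pos).mono (fun b h => h.1), fun j hj b0 hb0 => ?_⟩
  rw [ContinuousWithinAt, Metric.tendsto_nhds]
  intro ε hε
  filter_upwards [key b0 hb0 ε hε] with b hb
  exact hb.2 j (hj b0 hb0)

/-- a continuous selection among ordered sections is one section -/
theorem select_section {S : Set E} (hS : IsPreconnected S) (hne : S.Nonempty) {f : E → ℝ} {k : ℕ} {g : ℕ → E → ℝ}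
    (hf : ContinuousOn f S) (hg : ∀ j ≤ k, ContinuousOn (g j) S)
    (hlt : ∀ i j, i < j → j ≤ k → ∀ b ∈ S, g i b < g j b)
    (hsel : ∀ b ∈ S, ∃ j ≤ k, f b = g j b) : ∃ j ≤ k, ∀ b ∈ S, f b = g j b := by
  choose! φ hφ1 hφ2 using hsel
  obtain ⟨b1, hb1⟩ := hne
  refine ⟨φ b1, hφ1 b1 hb1, fun b hb => ?_⟩
  have : φ b = φ b1 := by
    refine preconn_const hS ?_ hb hb1
    intro b0 hb0
    have hne : ∀ j ≤ k, j ≠ φ b0 → ∀ᶠ b in 𝓝[S] b0, f b ≠ g j b := by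
      intro j hj hjne
      have h1 : f b0 - g j b0 ≠ 0 := by
        rw [hφ2 b0 hb0, sub_ne_zero]
        rcases lt_or_gt_of_ne hjne with h | h
        · exact (hlt _ _ h (hφ1 b0 hb0) b0 hb0).ne'
        · exact (hlt _ _ h hj b0 hb0).ne
      have := ((hf b0 hb0).sub (hg j hj b0 hb0)).eventually_ne h1
      filter_upwards [this] with b hb h
      exact hb (by simp [h])
    have h2 : ∀ᶠ b in 𝓝[S] b0, ∀ j ∈ Finset.range (k+1), j ≠ φ b0 → f b ≠ g j b := by
      rw [Finset.eventually_all]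
      intro j hj
      by_cases h : j = φ b0
      · simp [h]
      · filter_upwards [hne j (by simp at hj; omega) h] with b hb _ using hb
    filter_upwards [h2, self_mem_nhdsWithin] with b hb hbS
    by_contra h
    exact hb (φ b) (by have := hφ1 b hbS; simp; omega) h (hφ2 b hbS)
  rw [hφ2 b hb, this]

end
end Piece4

section Piece5
open unitInterval Topology Set Filter Polynomial

section
variable {E : Type} [TopologicalSpace E]

theorem lim_exists {S : Set E} {x : E} 
    (hl : ∀ V ∈ 𝓝 x, ∃ V' ∈ 𝓝 x, V' ⊆ V ∧ (V' ∩ S).Nonempty ∧ IsPreconnected (V' ∩ S)) {f : E → ℝ}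
    (hf : ContinuousOn f S) (R : Finset ℝ)
    (hR : ∀ ε > 0, ∀ᶠ b in 𝓝[S] x, ∃ z ∈ R, |f b - z| < ε) : ∃ z ∈ R, Tendsto f (𝓝[S] x) (𝓝 z) := by
  have hδ : ∀ᶠ δ in 𝓝[>] (0:ℝ), 0 < δ ∧ 
      ∀ z ∈ R, ∀ z' ∈ R, z ≠ z' → 2 * δ ≤ |z - z'| := by
    have hlt : ∀ r : ℝ, 0 < r → ∀ᶠ δ in 𝓝[>] (0:ℝ), δ ≤ r := fun r hr =>
      (eventually_le_nhds hr).filter_mono nhdsWithin_le_nhds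
    refine (Eventually.and self_mem_nhdsWithin ?_)
    rw [Finset.eventually_all]
    intro z _
    rw [Finset.eventually_all]
    intro z' _
    by_cases h : z = z'
    · simp [h]
    · have : 0 < |z - z'| := abs_pos.mpr (sub_ne_zero.mpr h)
      filter_upwards [hlt (|z - z'|/2) (by positivity)] with δ hδ _
      linarith
  obtain ⟨δ, h2, h3⟩ := hδ.exists
  have hsep : ∀ z ∈ R, ∀ z' ∈ R, ∀ y, |y - z| < δ → |y - z'| < δ → z = z' := by
    intro z hz z' hz' y a b
    by_contra h
    have := h3 z hz z' hz' h
    have : |z - z'| ≤ |y - z| + |y - z'| := by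
      rw [show z - z' = (y - z') - (y - z) by ring]
      linarith [abs_sub (y - z') (y - z)]
    linarith
  have h4 := hR δ h2
  rw [eventually_nhdsWithin_iff] at h4
  obtain ⟨V', hV', hsub, ⟨b0, hb0⟩, hpre⟩ := hl _ h4
  have hcov : ∀ b ∈ V' ∩ S, ∃ z ∈ R, |f b - z| < δ := fun b hb => hsub hb.1 hb.2
  obtain ⟨z0, hz0, hz0'⟩ := hcov b0 hb0
  have himg : f '' (V' ∩ S) ⊆ Metric.ball z0 δ := by
    refine (hpre.image f (hf.mono inter_subset_right)).subset_left_of_subset_union (v := ⋃ z ∈ ({z | z ∈ R ∧ z ≠ z0} : Set ℝ), Metric.ball z δ)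
      Metric.isOpen_ball (isOpen_biUnion fun _ _ => Metric.isOpen_ball) ?_ ?_ ?_
    · rw [Set.disjoint_left]
      intro y hy hy'
      simp only [mem_iUnion] at hy'
      obtain ⟨z, ⟨hz, hne⟩, hy'⟩ := hy'
      exact hne (hsep z hz z0 hz0 y hy' hy)
    · rintro _ ⟨b, hb, rfl⟩
      obtain ⟨z, hz, h⟩ := hcov b hb
      by_cases hzz : z = z0
      · left; subst hzz; exact h
      · right; simp only [mem_iUnion]; exact ⟨z, ⟨hz, hzz⟩, h⟩
    · exact ⟨f b0, ⟨b0, hb0, rfl⟩, hz0'⟩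
  refine ⟨z0, hz0, ?_⟩
  rw [Metric.tendsto_nhds]
  intro ε hε
  have h5 := hR (min ε δ) (lt_min hε h2)
  filter_upwards [h5, self_mem_nhdsWithin, nhdsWithin_le_nhds hV'] with b hb hbS hbV
  obtain ⟨z, hz, hzb⟩ := hb
  have h6 : |f b - z0| < δ := himg ⟨b, ⟨hbV, hbS⟩, rfl⟩
  have := hsep z hz z0 hz0 (f b) (hzb.trans_le (min_le_right _ _)) h6
  subst this
  exact hzb.trans_le (min_le_left _ _)

theorem roots_accum {S : Set E} {x : E} (hx : x ∈ S) {P : E → ℝ[X]} {n : ℕ} {R : ℝ} (hm : ∀ b ∈ S, (P b).Monic)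
    (hdeg : ∀ b ∈ S, (P b).natDegree = n)
    (hc : ∀ i, ContinuousOn (fun b => (P b).coeff i) S) {ε : ℝ} (hε : 0 < ε) :
    ∀ᶠ b in 𝓝[S] x, ∀ y, |y| ≤ R → (P b).eval y = 0 → ∃ z ∈ rr (P x), |y - z| < ε := by
  have hK : IsCompact ((Icc (-R) R) \ ⋃ z ∈ rr (P x), Metric.ball z ε) :=
    isCompact_Icc.diff (isOpen_biUnion fun _ _ => Metric.isOpen_ball)
  have h := hK.eventually_forall_of_forall_eventually (x₀ := x) (P := fun b y => b ∈ S → (P b).eval y ≠ 0) ?_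
  · rw [eventually_nhdsWithin_iff]
    filter_upwards [h] with b hb hbS y hy hy0
    by_contra hcon
    push Not at hcon
    refine hb y ⟨abs_le.mp hy, ?_⟩ hbS hy0
    simp only [mem_iUnion, not_exists]
    intro z hz hyz
    exact absurd hyz (not_lt.mpr (hcon z hz))
  · intro y hy
    have h1 : (P x).eval y ≠ 0 := by
      intro h0
      apply hy.2
      simp only [mem_iUnion]
      exact ⟨y, (mem_rr (hm x hx)).mpr h0, Metric.mem_ball_self hε⟩
    have h2 := (cont_eval hdeg hc (x, y) ⟨hx, mem_univ _⟩).eventually_ne h1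
    rw [eventually_nhdsWithin_iff] at h2
    filter_upwards [h2] with q hq hqS using hq ⟨hqS, mem_univ _⟩

theorem roots_sep {S : Set E} {P : E → ℝ[X]} {n m : ℕ} (hm : ∀ b ∈ S, (P b).Monic)
    (hdeg : ∀ b ∈ S, (P b).natDegree = n)
    (hc : ∀ i, ContinuousOn (fun b => (P b).coeff i) S)
    (hcard : ∀ b ∈ S, (cr (P b)).card = m) {b0 : E} (hb0 : b0 ∈ S) :
    ∃ δ > 0, ∀ᶠ b in 𝓝[S] b0, ∀ z ∈ cr (P b0), ∀ w ∈ cr (P b), ∀ w' ∈ cr (P b), ‖w - z‖ < δ → ‖w' - z‖ < δ → w = w' := by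
  have hδ : ∀ᶠ δ in 𝓝[>] (0:ℝ), 0 < δ ∧ 
      ∀ z ∈ cr (P b0), ∀ z' ∈ cr (P b0), z ≠ z' → 2 * δ ≤ ‖z - z'‖ := by
    have hlt : ∀ r : ℝ, 0 < r → ∀ᶠ δ in 𝓝[>] (0:ℝ), δ ≤ r := fun r hr =>
      (eventually_le_nhds hr).filter_mono nhdsWithin_le_nhds
    refine (Eventually.and self_mem_nhdsWithin ?_)
    · rw [Finset.eventually_all]
      intro z _
      rw [Finset.eventually_all]
      intro z' _
      by_cases h : z = z'
      · simp [h]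
      · have : 0 < ‖z - z'‖ := norm_pos_iff.mpr (sub_ne_zero.mpr h)
        filter_upwards [hlt (‖z - z'‖/2) (by positivity)] with δ hδ _
        linarith
  obtain ⟨δ, h2, h4⟩ := hδ.exists
  have hev : ∀ᶠ b in 𝓝[S] b0, ∀ z ∈ cr (P b0), ∃ w ∈ cr (P b), ‖w - z‖ < δ := by
    rw [Finset.eventually_all]
    intro z hz
    exact root_near hm hdeg hb0 (fun i => hc i b0 hb0) hz h2
  refine ⟨δ, h2, ?_⟩
  filter_upwards [hev, self_mem_nhdsWithin] with b hb hbS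
  choose! f hf1 hf2 using hb
  have huniq : ∀ z ∈ cr (P b0), ∀ z' ∈ cr (P b0), ∀ w, ‖w - z‖ < δ → ‖w - z'‖ < δ → z = z' := by
    intro z hz z' hz' w h5 h6
    by_contra h
    have h7 := h4 z hz z' hz' h
    have : ‖z - z'‖ ≤ ‖w - z‖ + ‖w - z'‖ := by
      rw [show z - z' = (w - z') - (w - z) by ring]
      linarith [norm_sub_le (w - z') (w - z)]
    linarith
  have hinj : InjOn f (cr (P b0)) := by
    intro z hz z' hz' h
    exact huniq z hz z' hz' (f z) (hf2 z hz) (by rw [h]; exact hf2 z' hz')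
  have hsurj : ∀ w ∈ cr (P b), ∃ z ∈ cr (P b0), f z = w := by
    have := Finset.surj_on_of_inj_on_of_card_le (s := cr (P b0)) (t := cr (P b)) (fun z _ => f z)
      (fun z hz => hf1 z hz) (fun z z' hz hz' h => hinj hz hz' h)
      (by rw [hcard b hbS, hcard b0 hb0])
    intro w hw
    obtain ⟨z, hz, h⟩ := this w hw
    exact ⟨z, hz, h.symm⟩
  have hall : ∀ z ∈ cr (P b0), ∀ w ∈ cr (P b), ‖w - z‖ < δ → w = f z := by
    intro z hz w hw h
    obtain ⟨z', hz', rfl⟩ := hsurj w hw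
    rw [huniq z hz z' hz' (f z') h (hf2 z' hz')]
  intro z hz w hw w' hw' h h'
  rw [hall z hz w hw h, hall z hz w' hw' h']

/-- vanishing of a monic factor along a root section is locally constant -/
theorem factor_const {S : Set E} (hS : IsPreconnected S) {P G : E → ℝ[X]} {n m d : ℕ} (hm : ∀ b ∈ S, (P b).Monic)
    (hdeg : ∀ b ∈ S, (P b).natDegree = n)
    (hc : ∀ i, ContinuousOn (fun b => (P b).coeff i) S)
    (hcard : ∀ b ∈ S, (cr (P b)).card = m)
    (hmG : ∀ b ∈ S, (G b).Monic)
    (hdegG : ∀ b ∈ S, (G b).natDegree = d)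
    (hcG : ∀ i, ContinuousOn (fun b => (G b).coeff i) S)
    (hdvd : ∀ b ∈ S, G b ∣ P b) {ξ : E → ℝ} (hξ : ContinuousOn ξ S) (hroot : ∀ b ∈ S, (P b).eval (ξ b) = 0) :
    (∀ b ∈ S, (G b).eval (ξ b) = 0) ∨ (∀ b ∈ S, (G b).eval (ξ b) ≠ 0) := by
  classical
  let φ : E → ℕ := fun b => if (G b).eval (ξ b) = 0 then 0 else 1
  have hφ : ∀ b ∈ S, ∀ b' ∈ S, φ b = φ b' := by
    intro b hb b' hb'
    refine preconn_const hS ?_ hb hb'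
    intro b0 hb0
    by_cases h0 : (G b0).eval (ξ b0) = 0
    · obtain ⟨δ, hδ, hsep⟩ := roots_sep hm hdeg hc hcard hb0
      have hz : ((ξ b0 : ℝ) : ℂ) ∈ cr (G b0) := (rr_cr (hmG b0 hb0)).mpr ((mem_rr (hmG b0 hb0)).mpr h0)
      have h1 := root_near hmG hdegG hb0 (fun i => hcG i b0 hb0) hz hδ
      have h2 := Metric.tendsto_nhds.mp (hξ b0 hb0) δ hδ
      filter_upwards [hsep, h1, h2, self_mem_nhdsWithin] with b hb1 hb2 hb3 hbS
      obtain ⟨w, hw, hwd⟩ := hb2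
      have hwP : w ∈ cr (P b) := by
        rw [mem_cr (hm b hbS)]
        obtain ⟨q, hq⟩ := hdvd b hbS
        rw [hq, map_mul, (mem_cr (hmG b hbS)).mp hw, zero_mul]
      have hy : ((ξ b : ℝ) : ℂ) ∈ cr (P b) := (rr_cr (hm b hbS)).mpr ((mem_rr (hm b hbS)).mpr (hroot b hbS))
      have hy0 : ((ξ b0 : ℝ) : ℂ) ∈ cr (P b0) := (rr_cr (hm b0 hb0)).mpr ((mem_rr (hm b0 hb0)).mpr (hroot b0 hb0))
      have := hb1 _ hy0 w hwP _ hy hwd (by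
        rw [← Complex.ofReal_sub, Complex.norm_real]; exact hb3)
      rw [this] at hw
      have h3 : (G b).eval (ξ b) = 0 := (mem_rr (hmG b hbS)).mp ((rr_cr (hmG b hbS)).mp hw)
      simp only [φ, h0, h3]
    · have h1 : ContinuousWithinAt (fun b => (G b).eval (ξ b)) S b0 := 
        ((cont_eval hdegG hcG).comp (continuousOn_id.prodMk hξ) (fun b hb => ⟨hb, mem_univ _⟩)) b0 hb0
      filter_upwards [h1.eventually_ne h0] with b hb
      simp only [φ, h0, if_neg hb, if_false]
  by_cases h : ∃ b ∈ S, (G b).eval (ξ b) = 0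
  · left
    obtain ⟨b, hb, h0⟩ := h
    intro b' hb'
    by_contra h1
    have := hφ b hb b' hb'
    simp only [φ, if_pos h0, if_neg h1] at this
    omega
  · right; push Not at h; exact h

theorem sections_exist [T2Space E] (C : RC E) (P : C.ι → E → ℝ[X]) (n m : C.ι → ℕ) (R : ℝ)
    (hm : ∀ c, ∀ b ∈ C.cl c, (P c b).Monic)
    (hdeg : ∀ c, ∀ b ∈ C.cl c, (P c b).natDegree = n c)
    (hc : ∀ c i, ContinuousOn (fun b => (P c b).coeff i) (C.cl c))
    (hcard : ∀ c, ∀ b ∈ C.op c, (cr (P c b)).card = m c)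
    (hface : ∀ c c' b, b ∈ C.op c' → b ∈ C.cl c → ∀ y, (P c b).eval y = 0 → (P c' b).eval y = 0)
    (hRb : ∀ c, ∀ b ∈ C.cl c, ∀ y, (P c b).eval y = 0 → |y| ≤ R)
    (hne : ∀ c, ∀ b ∈ C.op c, (P c b).eval R = 0) :
    ∃ S : C.Sections, ∀ c, ∀ b ∈ C.op c, ∀ y, (P c b).eval y = 0 ↔ ∃ j ≤ S.k c, S.ξ c j b = y := by
  classical
  have hmo : ∀ c, ∀ b ∈ C.op c, (P c b).Monic := fun c b hb => hm c b (C.op_sub c hb)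
  have hep : ∀ c, (∀ b0 ∈ C.op c, ∀ᶠ b in 𝓝[C.op c] b0, (rr (P c b)).card = (rr (P c b0)).card) ∧
    ∀ j, (∀ b ∈ C.op c, j < (rr (P c b)).card) → ContinuousOn (fun b => enum (rr (P c b)) j) (C.op c) := by
    intro c
    refine enum_props ?_
    intro b0 hb0 ε hε
    exact roots_bij (hmo c) (fun b hb => hdeg c b (C.op_sub c hb)) (fun i => (hc c i).mono (C.op_sub c)) (hcard c) hb0 hε
  have hk : ∀ c, ∃ k : ℕ, ∀ b ∈ C.op c, (rr (P c b)).card = k + 1 := by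
    intro c
    rcases (C.op c).eq_empty_or_nonempty with h | ⟨b1, hb1⟩
    · exact ⟨0, by simp [h]⟩
    · refine ⟨(rr (P c b1)).card - 1, fun b hb => ?_⟩
      have h1 : (rr (P c b)).card = (rr (P c b1)).card := preconn_const (C.conn c) (hep c).1 hb hb1
      have h2 : 0 < (rr (P c b1)).card := Finset.card_pos.mpr ⟨R, (mem_rr (hmo c b1 hb1)).mpr (hne c b1 hb1)⟩
      omega
  choose k hk using hk
  let e : C.ι → ℕ → E → ℝ := fun c j b => enum (rr (P c b)) j
  have hecont : ∀ c, ∀ j ≤ k c, ContinuousOn (e c j) (C.op c) := by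
    intro c j hj
    exact (hep c).2 j (fun b hb => by rw [hk c b hb]; omega)
  have heroot : ∀ c, ∀ j ≤ k c, ∀ b ∈ C.op c, (P c b).eval (e c j b) = 0 := by
    intro c j hj b hb
    exact (mem_rr (hmo c b hb)).mp (enum_mem (by rw [hk c b hb]; omega))
  have hlim : ∀ c, ∀ j ≤ k c, ∀ x ∈ C.cl c, ∃ z ∈ rr (P c x), Tendsto (e c j) (𝓝[C.op c] x) (𝓝 z) := by
    intro c j hj x hx
    refine lim_exists (C.lconn c x hx) (hecont c j hj) _ ?_
    intro ε hε
    have h := roots_accum (R := R) hx (hm c) (hdeg c) (hc c) hε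
    filter_upwards [nhdsWithin_mono x (C.op_sub c) h, self_mem_nhdsWithin] with b hb hbo
    exact hb _ (hRb c b (C.op_sub c hbo) _ (heroot c j hj b hbo)) (heroot c j hj b hbo)
  let ξ : C.ι → ℕ → E → ℝ := fun c j => extendFrom (C.op c) (e c j)
  have hξop : ∀ c, ∀ j ≤ k c, ∀ b ∈ C.op c, ξ c j b = e c j b := by
    intro c j hj b hb
    exact extendFrom_eq (subset_closure hb) (hecont c j hj b hb)
  have hξcont : ∀ c, ∀ j ≤ k c, ContinuousOn (ξ c j) (C.cl c) := by
    intro c j hj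
    refine continuousOn_extendFrom (C.cl_sub_closure c) ?_
    intro x hx
    obtain ⟨z, _, h⟩ := hlim c j hj x hx
    exact ⟨z, h⟩
  have hξroot : ∀ c, ∀ j ≤ k c, ∀ x ∈ C.cl c, (P c x).eval (ξ c j x) = 0 := by
    intro c j hj x hx
    obtain ⟨z, hz, h⟩ := hlim c j hj x hx
    have : ξ c j x = z := extendFrom_eq (C.cl_sub_closure c hx) h
    rw [this]; exact (mem_rr (hm c x hx)).mp hz
  have hmono : ∀ c i j, i < j → j ≤ k c → ∀ b ∈ C.op c, ξ c i b < ξ c j b := by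
    intro c i j hij hj b hb
    rw [hξop c j hj b hb, hξop c i (by omega) b hb]
    exact enum_lt hij (by rw [hk c b hb]; omega)
  have hiff : ∀ c, ∀ b ∈ C.op c, ∀ y, (P c b).eval y = 0 ↔ ∃ j ≤ k c, ξ c j b = y := by
    intro c b hb y
    constructor
    · intro h
      obtain ⟨j, hj, h2⟩ := enum_surj ((mem_rr (hmo c b hb)).mpr h)
      rw [hk c b hb] at hj
      exact ⟨j, by omega, by rw [hξop c j (by omega) b hb]; exact h2⟩
    · rintro ⟨j, hj, rfl⟩
      exact hξroot c j hj b (C.op_sub c hb)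
  refine ⟨⟨k, ξ, hξcont, fun c i j hij hj b hb => hmono c i j hij hj b hb, ?_⟩, hiff⟩
  intro c c' hne' hsub j hj
  refine select_section (C.conn c') hne' ((hξcont c j hj).mono hsub)
    (fun j hj => (hξcont c' j hj).mono (C.op_sub c')) (hmono c') ?_
  intro b hb
  have h1 := hface c c' b hb (hsub hb) _ (hξroot c j hj b (hsub hb))
  obtain ⟨j', hj', h⟩ := (hiff c' b hb _).mp h1
  exact ⟨j', hj', h.symm⟩

/-- sign condition on lifted cells -/
theorem lift_const (C : RC E) (S : C.Sections) (P : C.ι → E → ℝ[X]) (n m : C.ι → ℕ)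
    (hm : ∀ c, ∀ b ∈ C.cl c, (P c b).Monic)
    (hdeg : ∀ c, ∀ b ∈ C.cl c, (P c b).natDegree = n c)
    (hc : ∀ c i, ContinuousOn (fun b => (P c b).coeff i) (C.cl c))
    (hcard : ∀ c, ∀ b ∈ C.op c, (cr (P c b)).card = m c)
    (hS : ∀ c, ∀ b ∈ C.op c, ∀ y, (P c b).eval y = 0 ↔ ∃ j ≤ S.k c, S.ξ c j b = y)
    (p : S.ix) {G : E → ℝ[X]} {d : ℕ}
    (hmG : ∀ b ∈ C.op p.1.1, (G b).Monic)
    (hdegG : ∀ b ∈ C.op p.1.1, (G b).natDegree = d)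
    (hcG : ∀ i, ContinuousOn (fun b => (G b).coeff i) (C.op p.1.1))
    (hdvd : ∀ b ∈ C.op p.1.1, G b ∣ P p.1.1 b) :
    (∀ x ∈ S.op p, (G x.1).eval x.2 = 0) ∨ (∀ x ∈ S.op p, (G x.1).eval x.2 ≠ 0) := by
  obtain ⟨⟨c, j, e⟩, he, hj⟩ := p
  simp only at he hj hmG hdegG hcG hdvd
  by_cases h0 : e = 0
  · subst h0
    have hs : ∀ x ∈ S.op ⟨(c, j, 0), he, hj⟩, x.1 ∈ C.op c ∧ x.2 = S.ξ c j x.1 := by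
      intro x hx
      simpa [RC.Sections.op, RC.Sections.lo] using hx
    have hsub := C.op_sub c
    have hjk : j ≤ S.k c := by simpa using hj
    rcases factor_const (C.conn c) (fun b hb => hm c b (hsub hb)) (fun b hb => hdeg c b (hsub hb))
      (fun i => (hc c i).mono hsub) (hcard c) hmG hdegG hcG hdvd ((S.cont c j hjk).mono hsub)
      (fun b hb => (hS c b hb _).mpr ⟨j, hjk, rfl⟩) with h | h
    · left; intro x hx; rw [(hs x hx).2]; exact h _ (hs x hx).1
    · right; intro x hx; rw [(hs x hx).2]; exact h _ (hs x hx).1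
  · right
    have he1 : e = 1 := by have : e ≤ 1 := he; omega
    subst he1
    intro x hx h
    have hx' : x.1 ∈ C.op c ∧ S.ξ c j x.1 < x.2 ∧ x.2 < S.ξ c (j+1) x.1 := by
      simpa [RC.Sections.op, RC.Sections.lo, RC.Sections.hi] using hx
    obtain ⟨q, hq⟩ := hdvd x.1 hx'.1
    have h1 : (P c x.1).eval x.2 = 0 := by rw [hq, eval_mul, h, zero_mul]
    obtain ⟨i, hi, h2⟩ := (hS c x.1 hx'.1 _).mp h1
    rw [← h2] at hx'
    have hj' : j + 1 ≤ S.k c := hj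
    have h3 : j < i := by
      by_contra hcon
      rcases (not_lt.mp hcon).eq_or_lt with h | h
      · subst h; exact lt_irrefl _ hx'.2.1
      · exact absurd (S.mono c i j h (by omega) _ hx'.1) (not_lt.mpr hx'.2.1.le)
    have h4 : i < j + 1 := by
      by_contra hcon
      rcases (not_lt.mp hcon).eq_or_lt with h | h
      · subst h; exact lt_irrefl _ hx'.2.2
      · exact absurd (S.mono c (j+1) i h hi _ hx'.1) (not_lt.mpr hx'.2.2.le)
    omega

end
end Piece5

section Piece6
open unitInterval Topology Set Filter Polynomial

noncomputable def subdisc (n k : ℕ) : MvPolynomial (Fin n) ℝ :=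
  ∑ T ∈ Finset.powersetCard k (Finset.univ : Finset (Fin n)), ∏ i ∈ T, ∏ j ∈ T.erase i,
    (MvPolynomial.X i - MvPolynomial.X j)

theorem subdisc_symm (n k : ℕ) : (subdisc n k).IsSymmetric := by
  classical
  intro e
  simp only [subdisc, map_sum, map_prod, map_sub, MvPolynomial.rename_X]
  refine Finset.sum_bij (fun T _ => T.map e.toEmbedding) ?_ ?_ ?_ ?_
  · intro T hI
    simp only [Finset.mem_powersetCard_univ, Finset.card_map] at hI ⊢
    exact hI
  · intro T _ J _ h
    exact Finset.map_injective _ h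
  · intro J hJ
    refine ⟨J.map e.symm.toEmbedding, ?_, ?_⟩
    · simp only [Finset.mem_powersetCard_univ, Finset.card_map] at hJ ⊢
      exact hJ
    · simp only [Finset.map_map]
      ext x; simp
  · intro T _
    rw [Finset.prod_map]
    refine Finset.prod_congr rfl (fun i hi => ?_)
    have : (T.map e.toEmbedding).erase (e.toEmbedding i) = (T.erase i).map e.toEmbedding := by
      rw [Finset.map_erase]
    rw [this, Finset.prod_map]
    rfl

theorem subdisc_aeval (n k : ℕ) (x : Fin n → ℂ) : MvPolynomial.aeval x (subdisc n k) =
    ∑ T ∈ Finset.powersetCard k (Finset.univ : Finset (Fin n)), ∏ i ∈ T, ∏ j ∈ T.erase i, (x i - x j) := by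
  simp [subdisc]

theorem subdisc_zero (n k : ℕ) (x : Fin n → ℂ) (h : (Finset.univ.image x).card < k) :
    MvPolynomial.aeval x (subdisc n k) = 0 := by
  rw [subdisc_aeval]
  refine Finset.sum_eq_zero (fun T hI => ?_)
  rw [Finset.mem_powersetCard_univ] at hI
  obtain ⟨i, hi, j, hj, hij, hx⟩ := Finset.exists_ne_map_eq_of_card_lt_of_maps_to (s := T) (t := Finset.univ.image x) (f := x)
    (by rw [hI]; exact h) (fun i _ => Finset.mem_image_of_mem _ (Finset.mem_univ i))
  refine Finset.prod_eq_zero hi (Finset.prod_eq_zero (Finset.mem_erase.mpr ⟨hij.symm, hj⟩) ?_)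
  rw [hx, sub_self]

theorem subdisc_ne_zero (n k : ℕ) (x : Fin n → ℂ) (h : (Finset.univ.image x).card = k) :
    MvPolynomial.aeval x (subdisc n k) ≠ 0 := by
  classical
  rw [subdisc_aeval]
  set Im := Finset.univ.image x with hIm
  set D : ℂ := ∏ a ∈ Im, ∏ b ∈ Im.erase a, (a - b) with hD
  have hD0 : D ≠ 0 := by
    rw [hD, Finset.prod_ne_zero_iff]
    intro a _
    rw [Finset.prod_ne_zero_iff]
    intro b hb
    exact sub_ne_zero.mpr (Finset.ne_of_mem_erase hb).symm
  have hterm : ∀ T ∈ Finset.powersetCard k (Finset.univ : Finset (Fin n)),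
      ∏ i ∈ T, ∏ j ∈ T.erase i, (x i - x j) = if InjOn x T then D else 0 := by
    intro T hI
    rw [Finset.mem_powersetCard_univ] at hI
    split_ifs with hinj
    · have hI2 : T.image x = Im := by
        apply Finset.eq_of_subset_of_card_le (Finset.image_subset_image (Finset.subset_univ _))
        rw [Finset.card_image_of_injOn hinj, hI, h]
      rw [hD, ← hI2, Finset.prod_image hinj]
      refine Finset.prod_congr rfl (fun i hi => ?_)
      have : (T.image x).erase (x i) = (T.erase i).image x := by
        ext y
        simp only [Finset.mem_erase, Finset.mem_image]
        constructor
        · rintro ⟨h1, j, hj, rfl⟩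
          exact ⟨j, ⟨fun e => h1 (by rw [e]), hj⟩, rfl⟩
        · rintro ⟨j, ⟨h1, hj⟩, rfl⟩
          exact ⟨fun e => h1 (hinj hj hi e), j, hj, rfl⟩
      rw [this, Finset.prod_image (hinj.mono (by simp))]
    · unfold InjOn at hinj
      push Not at hinj
      obtain ⟨i, hi, j, hj, hx, hij⟩ := hinj
      refine Finset.prod_eq_zero hi (Finset.prod_eq_zero (Finset.mem_erase.mpr ⟨Ne.symm hij, hj⟩) ?_)
      rw [hx, sub_self]
  rw [Finset.sum_congr rfl hterm, ← Finset.sum_filter, Finset.sum_const, nsmul_eq_mul]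
  refine mul_ne_zero ?_ hD0
  rw [Nat.cast_ne_zero, ← Nat.pos_iff_ne_zero, Finset.card_pos]
  have hs : SurjOn x (Finset.univ : Finset (Fin n)) Im := by
    intro y hy
    simpa [hIm] using hy
  obtain ⟨u, hu, hux, huc⟩ := Finset.exists_subset_injOn_image_eq_of_surjOn ((Finset.univ : Finset (Fin n)) : Set (Fin n)) Im hs
  refine ⟨u, ?_⟩
  rw [Finset.mem_filter, Finset.mem_powersetCard_univ]
  refine ⟨?_, hux⟩
  rw [← h, ← huc, Finset.card_image_of_injOn hux]

noncomputable def subdiscQ (n k : ℕ) : MvPolynomial (Fin n) ℝ :=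
  (MvPolynomial.esymmAlgEquiv (Fin n) ℝ (by simp)).symm ⟨subdisc n k, subdisc_symm n k⟩

theorem subdiscQ_spec (n k : ℕ) : MvPolynomial.aeval (fun i : Fin n => MvPolynomial.esymm (Fin n) ℝ (i+1)) (subdiscQ n k) = subdisc n k := by
  rw [← MvPolynomial.esymmAlgHom_apply]
  have : MvPolynomial.esymmAlgHom (Fin n) ℝ n (subdiscQ n k) = MvPolynomial.esymmAlgEquiv (Fin n) ℝ (by simp) (subdiscQ n k) := rfl
  rw [this, subdiscQ, AlgEquiv.apply_symm_apply]

/-- the subdiscriminant of a monic polynomial of degree `n` -/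
noncomputable def DQ (n k : ℕ) (p : ℝ[X]) : ℝ :=
  MvPolynomial.aeval (fun i : Fin n => (-1) ^ (i.val + 1) * p.coeff (n - (i.val + 1))) (subdiscQ n k)

theorem DQ_spec {n : ℕ} (k : ℕ) {p : ℝ[X]} (hp : p.Monic) (hn : p.natDegree = n) : ∃ x : Fin n → ℂ,
    Finset.univ.image x = cr p ∧ ((DQ n k p : ℝ) : ℂ) = MvPolynomial.aeval x (subdisc n k) := by
  have hs : (p.map (algebraMap ℝ ℂ)).Splits := IsAlgClosed.splits _
  have hdeg : (p.map (algebraMap ℝ ℂ)).natDegree = n := by rw [natDegree_map, hn]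
  have hcard : (p.map (algebraMap ℝ ℂ)).roots.card = n := by
    rw [← hs.natDegree_eq_card_roots, hdeg]
  obtain ⟨x, hx⟩ : ∃ x : Fin n → ℂ, Finset.univ.val.map x = (p.map (algebraMap ℝ ℂ)).roots := by
    subst hcard
    generalize (p.map (algebraMap ℝ ℂ)).roots = s
    induction s using Quotient.inductionOn with
    | h l =>
      refine ⟨fun i => l.get i, ?_⟩
      exact Fin.univ_val_map l.get |>.trans (by simp)
  refine ⟨x, ?_, ?_⟩
  · rw [cr, ← hx]; rfl
  · rw [← subdiscQ_spec, DQ]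
    have h1 := MvPolynomial.aeval_algebraMap_apply (B := ℂ) (fun i : Fin n => (-1) ^ (i.val + 1) * p.coeff (n - (i.val + 1))) (subdiscQ n k)
    have h2 : ((MvPolynomial.aeval (fun i : Fin n => (-1) ^ (i.val + 1) * p.coeff (n - (i.val + 1))) (subdiscQ n k) : ℝ) : ℂ)
      = algebraMap ℝ ℂ (MvPolynomial.aeval (fun i : Fin n => (-1) ^ (i.val + 1) * p.coeff (n - (i.val + 1))) (subdiscQ n k)) := rfl
    rw [h2, ← h1, MvPolynomial.comp_aeval_apply]
    congr 2
    funext i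
    rw [MvPolynomial.aeval_esymm_eq_multiset_esymm, hx]
    have h3 := Polynomial.coeff_eq_esymm_roots_of_splits hs (k := n - (i.val+1)) (by omega)
    rw [(hp.map (algebraMap ℝ ℂ)).leadingCoeff, hdeg, coeff_map, one_mul, show n - (n - (i.val+1)) = i.val+1 by omega] at h3
    rw [Function.comp_apply, map_mul, h3]
    rw [← mul_assoc]
    simp [← mul_pow]

theorem DQ_zero {n k : ℕ} {p : ℝ[X]} (hp : p.Monic) (hn : p.natDegree = n) (h : DQ n k p ≠ 0) : k ≤ (cr p).card := by
  obtain ⟨x, h1, h2⟩ := DQ_spec k hp hn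
  by_contra hcon
  rw [subdisc_zero n k x (by rw [h1]; omega)] at h2
  exact h (by exact_mod_cast h2)

theorem DQ_ne {n k : ℕ} {p : ℝ[X]} (hp : p.Monic) (hn : p.natDegree = n) (h : (cr p).card = k) : DQ n k p ≠ 0 := by
  obtain ⟨x, h1, h2⟩ := DQ_spec k hp hn
  intro h0
  rw [h0] at h2
  exact subdisc_ne_zero n k x (by rw [h1, h]) h2.symm

theorem DQ_analytic {E : Type} [NormedAddCommGroup E] [NormedSpace ℝ E] {N : Set E} {P : E → ℝ[X]}
    (h : ∀ i, AnalyticOnNhd ℝ (fun b => (P b).coeff i) N) (n k : ℕ) : AnalyticOnNhd ℝ (fun b => DQ n k (P b)) N := by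
  unfold DQ
  refine AnalyticOnNhd.aeval_mvPolynomial ?_ _
  intro i
  exact analyticOnNhd_const.mul (h _)

theorem card_const {E : Type} {S : Set E} {P : E → ℝ[X]} {n : ℕ} (hm : ∀ b ∈ S, (P b).Monic)
    (hdeg : ∀ b ∈ S, (P b).natDegree = n)
    (h : ∀ k ≤ n, (∀ b ∈ S, DQ n k (P b) = 0) ∨ (∀ b ∈ S, DQ n k (P b) ≠ 0)) :
    ∃ m, ∀ b ∈ S, (cr (P b)).card = m := by
  have hle : ∀ b ∈ S, (cr (P b)).card ≤ n := by
    intro b hb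
    have h1 : (cr (P b)).card ≤ ((P b).map (algebraMap ℝ ℂ)).roots.card := Multiset.toFinset_card_le _
    have h2 := Polynomial.card_roots' ((P b).map (algebraMap ℝ ℂ))
    rw [natDegree_map, hdeg b hb] at h2
    omega
  have key : ∀ b ∈ S, ∀ b' ∈ S, (cr (P b)).card ≤ (cr (P b')).card := by
    intro b hb b' hb'
    rcases h _ (hle b hb) with h1 | h1
    · exact absurd (h1 b hb) (DQ_ne (hm b hb) (hdeg b hb) rfl)
    · exact DQ_zero (hm b' hb') (hdeg b' hb') (h1 b' hb')
  rcases S.eq_empty_or_nonempty with h | ⟨b, hb⟩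
  · exact ⟨0, by simp [h]⟩
  · exact ⟨_, fun b' hb' => le_antisymm (key b' hb' b hb) (key b hb b' hb')⟩
end Piece6

section Piece7
open unitInterval Topology Set Filter Polynomial
open scoped NNReal ENNReal BoundedContinuousFunction

section
variable {E : Type} [NormedAddCommGroup E] [NormedSpace ℝ E]

noncomputable def bcfSeries (P : ℕ → FormalMultilinearSeries ℝ E ℝ) (D : ℕ → ℝ) 
    (hb : ∀ n m, ‖P n m‖ ≤ D m) : FormalMultilinearSeries ℝ E (ℕ →ᵇ ℝ) := fun m =>
  MultilinearMap.mkContinuous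
    { toFun := fun v => BoundedContinuousFunction.ofNormedAddCommGroupDiscrete (fun n => P n m v) (D m * ∏ i, ‖v i‖)
        (fun n => ((P n m).le_opNorm v).trans (mul_le_mul_of_nonneg_right (hb n m) (by positivity)))
      map_update_add' := by
        intro _ v i x y
        ext n
        simp
      map_update_smul' := by
        intro _ v i x y
        ext n
        simp }
    (D m) (by
      intro v
      have h0 : 0 ≤ D m := (norm_nonneg _).trans (hb 0 m)
      refine (BoundedContinuousFunction.norm_le (by positivity)).mpr ?_
      intro n
      exact ((P n m).le_opNorm v).trans (mul_le_mul_of_nonneg_right (hb n m) (by positivity)))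

theorem bcfSeries_apply (P : ℕ → FormalMultilinearSeries ℝ E ℝ) (D : ℕ → ℝ) 
    (hb : ∀ n m, ‖P n m‖ ≤ D m) (m : ℕ) (v : Fin m → E) (n : ℕ) : bcfSeries P D hb m v n = P n m v := rfl

theorem bcfSeries_norm (P : ℕ → FormalMultilinearSeries ℝ E ℝ) (D : ℕ → ℝ) 
    (hb : ∀ n m, ‖P n m‖ ≤ D m) (m : ℕ) : ‖bcfSeries P D hb m‖ ≤ D m :=
  MultilinearMap.mkContinuous_norm_le _ ((norm_nonneg _).trans (hb 0 m)) _

theorem analytic_bcf {f : ℕ → E → ℝ} {P : ℕ → FormalMultilinearSeries ℝ E ℝ} {r : ℝ≥0} (hr : 0 < r) (C : ℝ)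
    (hP : ∀ n, HasFPowerSeriesOnBall (f n) (P n) 0 r) (hb : ∀ n m, ‖P n m‖ * r ^ m ≤ C) :
    ∃ Φ : E → (ℕ →ᵇ ℝ), AnalyticAt ℝ Φ 0 ∧ ∀ x, ‖x‖ < r → ∀ n, Φ x n = f n x := by
  have hr' : (0:ℝ) < r := hr
  have hb' : ∀ n m, ‖P n m‖ ≤ C / r ^ m := fun n m => by
    rw [le_div_iff₀ (by positivity)]; exact hb n m
  let Q := bcfSeries P _ hb'
  have hrad : (r : ℝ≥0∞) ≤ Q.radius := by
    refine Q.le_radius_of_bound C (fun m => ?_)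
    have := bcfSeries_norm P _ hb' m
    rwa [le_div_iff₀ (by positivity)] at this
  have hQ := Q.hasFPowerSeriesOnBall (lt_of_lt_of_le (by exact_mod_cast hr) hrad)
  refine ⟨Q.sum, hQ.analyticAt, ?_⟩
  intro x hx n
  have hx' : x ∈ Metric.eball (0:E) r := by
    rw [Metric.mem_eball, edist_zero_right]
    rw [← ofReal_norm_eq_enorm, ENNReal.ofReal_lt_coe_iff (norm_nonneg _)]
    exact hx
  have h1 := hQ.hasSum (Metric.eball_subset_eball hrad hx')
  have h2 := (hP n).hasSum hx'
  rw [zero_add] at h1 h2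
  have h3 : HasSum (fun m => (Q m fun _ => x) n) (Q.sum x n) := 
    h1.mapL (BoundedContinuousFunction.evalCLM ℝ n)
  exact h3.unique h2

theorem strip_series {F : E × ℝ → ℝ} {b0 : E} {y0 : ℝ} (hF : AnalyticAt ℝ F (b0, y0)) {ρ0 : ℝ} (hρ0 : 0 < ρ0) :
    ∃ ρ > 0, ρ < ρ0 ∧ ∃ Φ : E → (ℕ →ᵇ ℝ), AnalyticAt ℝ Φ b0 ∧ ∀ᶠ b in 𝓝 b0, ∀ y : ℝ, |y| < 1 →
      HasSum (fun n => Φ b n * y ^ n) (F (b, y0 + ρ * y)) := by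
  obtain ⟨p, R, hp⟩ := hF
  obtain ⟨r1, hr1, hr1R⟩ := ENNReal.lt_iff_exists_nnreal_btwn.mp hp.r_pos
  obtain ⟨r0, hr0, hr0R, hr0ρ⟩ : ∃ r0 : ℝ≥0, 0 < r0 ∧ (r0 : ℝ≥0∞) < R ∧ (r0:ℝ) < ρ0 := by
    refine ⟨min r1 (⟨ρ0, hρ0.le⟩ / 2), ?_, ?_, ?_⟩
    · exact lt_min (by exact_mod_cast hr1) (half_pos (by exact_mod_cast hρ0))
    · exact lt_of_le_of_lt (by exact_mod_cast min_le_left _ _) hr1R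
    · refine lt_of_le_of_lt (NNReal.coe_le_coe.mpr (min_le_right _ _)) ?_
      show ρ0 / 2 < ρ0
      linarith
  have hr0' : (0:ℝ) < r0 := hr0
  obtain ⟨C, hC, hCp⟩ := p.norm_mul_pow_le_of_lt_radius (hr0R.trans_le hp.r_le)
  let ρ : ℝ := r0 / 4
  have hρ : 0 < ρ := by positivity
  let e : E × ℝ := (0, 1)
  have he : ‖e‖ ≤ 1 := by simp [e, Prod.norm_def]
  -- the pieces
  let g : ℕ → E → ℝ := fun n h => ρ ^ n * p.changeOrigin (h, 0) n (fun _ => e)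
  let ev : ∀ n, ((E × ℝ) [×n]→L[ℝ] ℝ) →L[ℝ] ℝ := fun n => (ρ ^ n) • ContinuousMultilinearMap.apply ℝ (fun _ : Fin n => E × ℝ) ℝ (fun _ => e)
  let P : ℕ → FormalMultilinearSeries ℝ E ℝ := fun n =>
    (ev n).compFormalMultilinearSeries ((p.changeOriginSeries n).compContinuousLinearMap (ContinuousLinearMap.inl ℝ E ℝ))
  have hP : ∀ n, HasFPowerSeriesOnBall (g n) (P n) 0 (r0 / 4 : ℝ≥0) := by
    intro n
    have h1 := p.hasFPowerSeriesOnBall_changeOrigin n (hp.r_pos.trans_le hp.r_le)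
    have h1' : HasFPowerSeriesOnBall (fun x => p.changeOrigin x n) (p.changeOriginSeries n) (ContinuousLinearMap.inl ℝ E ℝ 0) p.radius := by
      rw [map_zero]; exact h1
    have h2 := h1'.compContinuousLinearMap
    have h3 := (ev n).comp_hasFPowerSeriesOnBall h2
    refine h3.mono (by exact_mod_cast (by positivity : 0 < r0 / 4)) ?_
    have hn : ‖ContinuousLinearMap.inl ℝ E ℝ‖ₑ ≤ 1 := by
      rw [← ofReal_norm_eq_enorm]
      rw [← ENNReal.ofReal_one]
      refine ENNReal.ofReal_le_ofReal (ContinuousLinearMap.opNorm_le_bound _ zero_le_one (fun x => ?_))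
      simp [Prod.norm_def]
    have h4 : ((r0 / 4 : ℝ≥0) : ℝ≥0∞) ≤ r0 := by
      have : r0 / 4 ≤ r0 := div_le_self zero_le' (by norm_num)
      exact_mod_cast this
    calc ((r0 / 4 : ℝ≥0) : ℝ≥0∞) ≤ p.radius := h4.trans (hr0R.le.trans hp.r_le)
      _ = p.radius / 1 := by simp
      _ ≤ _ := ENNReal.div_le_div_left hn _
  have hb : ∀ n m, ‖P n m‖ * ((r0 / 4 : ℝ≥0) : ℝ) ^ m ≤ C := by
    intro n m
    have h1 : ‖p.changeOriginSeries n m‖ ≤ 2 ^ (n + m) * ‖p (n + m)‖ := by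
      have h := p.nnnorm_changeOriginSeries_le_tsum n m
      rw [tsum_fintype, Finset.sum_const, Finset.card_univ] at h
      have h' : ‖p.changeOriginSeries n m‖ ≤ (Fintype.card {s : Finset (Fin (n + m)) // s.card = m}) * ‖p (n+m)‖ := by
        rw [nsmul_eq_mul] at h
        exact_mod_cast h
      refine h'.trans (mul_le_mul_of_nonneg_right ?_ (norm_nonneg _))
      have : Fintype.card {s : Finset (Fin (n + m)) // s.card = m} ≤ 2 ^ (n+m) := by
        refine (Fintype.card_subtype_le _).trans ?_
        simp
      exact_mod_cast this
    have h2 : ‖P n m‖ ≤ ρ ^ n * ‖p.changeOriginSeries n m‖ := by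
      refine ContinuousMultilinearMap.opNorm_le_bound (by positivity) (fun v => ?_)
      have h3 : P n m v = ρ ^ n * (p.changeOriginSeries n m (fun i => (v i, 0))) (fun _ => e) := by
        simp [P, ev, FormalMultilinearSeries.compContinuousLinearMap, Function.comp_def]
      rw [h3, norm_mul, Real.norm_of_nonneg (by positivity : (0:ℝ) ≤ ρ ^ n), mul_assoc]
      refine mul_le_mul_of_nonneg_left ?_ (by positivity)
      calc ‖(p.changeOriginSeries n m (fun i => (v i, 0))) (fun _ => e)‖ ≤ ‖p.changeOriginSeries n m (fun i => (v i, (0:ℝ)))‖ * ∏ _i : Fin n, ‖e‖ :=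
            ContinuousMultilinearMap.le_opNorm _ _
        _ ≤ ‖p.changeOriginSeries n m (fun i => (v i, (0:ℝ)))‖ * 1 := by
            refine mul_le_mul_of_nonneg_left ?_ (norm_nonneg _)
            rw [Finset.prod_const]; exact pow_le_one₀ (norm_nonneg _) he
        _ = ‖p.changeOriginSeries n m (fun i => (v i, (0:ℝ)))‖ := mul_one _
        _ ≤ ‖p.changeOriginSeries n m‖ * ∏ i, ‖(v i, (0:ℝ))‖ := ContinuousMultilinearMap.le_opNorm _ _
        _ = _ := by simp [Prod.norm_def]
    have h5 := hCp (n + m)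
    calc ‖P n m‖ * ((r0 / 4 : ℝ≥0) : ℝ) ^ m ≤ (ρ ^ n * (2 ^ (n + m) * ‖p (n + m)‖)) * ρ ^ m := by
          have : ((r0 / 4 : ℝ≥0) : ℝ) = ρ := by simp [ρ]
          rw [this]
          refine mul_le_mul_of_nonneg_right (h2.trans ?_) (by positivity)
          exact mul_le_mul_of_nonneg_left h1 (by positivity)
      _ = (1/2) ^ (n+m) * (‖p (n+m)‖ * r0 ^ (n+m)) := by
          have : (ρ : ℝ) = (1/2) * (r0 * (1/2)) := by simp only [ρ]; ring
          rw [this]; simp only [mul_pow, pow_add]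
          have h22 : (2:ℝ)^n * (1/2)^n = 1 := by rw [← mul_pow]; norm_num
          have h23 : (2:ℝ)^m * (1/2)^m = 1 := by rw [← mul_pow]; norm_num
          linear_combination ((1/2)^n * r0^n * ‖p (n+m)‖ * (1/2)^m * r0^m) * (2^m * (1/2)^m * h22 + h23)
      _ ≤ 1 * C := mul_le_mul (pow_le_one₀ (by norm_num) (by norm_num)) h5 (by positivity) zero_le_one
      _ = C := one_mul C
  obtain ⟨Φ, hΦ, hΦ2⟩ := analytic_bcf (by positivity) C hP hb
  refine ⟨ρ, hρ, by simp only [ρ]; linarith, fun b => Φ (b - b0), ?_, ?_⟩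
  · refine AnalyticAt.comp' (g := Φ) (f := fun b => b - b0) (by simpa using hΦ) (by fun_prop)
  · have : ∀ᶠ b in 𝓝 b0, ‖b - b0‖ < ρ := by
      have := Metric.ball_mem_nhds b0 hρ
      filter_upwards [this] with b hb
      rwa [mem_ball_iff_norm] at hb
    filter_upwards [this] with b hb y hy
    have hb2 : ‖b - b0‖ < ((r0 / 4 : ℝ≥0) : ℝ) := by simpa [ρ] using hb
    have hn1 : ‖((b - b0, (0:ℝ)) : E × ℝ)‖ < r0 / 4 := by simpa [Prod.norm_def] using hb2
    have h6 : ((‖((b - b0, (0:ℝ)) : E × ℝ)‖₊ : ℝ≥0) : ℝ≥0∞) < R := by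
      refine lt_trans ?_ hr0R
      have : ‖((b - b0, (0:ℝ)) : E × ℝ)‖₊ < r0 := by
        rw [← NNReal.coe_lt_coe, coe_nnnorm]; linarith
      exact_mod_cast this
    have h7 := hp.changeOrigin h6
    have h8 : ((0, ρ * y) : E × ℝ) ∈ Metric.eball (0 : E × ℝ) (R - ‖((b - b0, (0:ℝ)) : E × ℝ)‖₊) := by
      rw [Metric.mem_eball, edist_zero_right, lt_tsub_iff_right]
      refine lt_trans ?_ hr0R
      have h9 : ‖((0, ρ * y) : E × ℝ)‖₊ + ‖((b - b0, (0:ℝ)) : E × ℝ)‖₊ < r0 := by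
        rw [← NNReal.coe_lt_coe, NNReal.coe_add, coe_nnnorm, coe_nnnorm]
        have : ‖((0, ρ * y) : E × ℝ)‖ ≤ ρ := by
          simp only [Prod.norm_def, norm_zero, norm_mul, Real.norm_eq_abs]
          rw [abs_of_pos hρ]
          refine max_le hρ.le ?_
          nlinarith
        simp only [ρ] at this
        linarith
      have : (‖((0, ρ * y) : E × ℝ)‖ₑ : ℝ≥0∞) = (‖((0, ρ * y) : E × ℝ)‖₊ : ℝ≥0∞) := rfl
      rw [this]
      exact_mod_cast h9
    have h10 := h7.hasSum h8
    have e1 : (fun n => Φ (b - b0) n * y ^ n) = fun n => p.changeOrigin (b - b0, 0) n (fun _ => (0, ρ * y)) := by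
      funext n
      rw [hΦ2 _ hb2 n]
      have : (fun _ : Fin n => ((0, ρ * y) : E × ℝ)) = fun _ : Fin n => (ρ * y) • e := by
        funext _; simp [e]
      rw [this, ContinuousMultilinearMap.map_smul_univ]
      simp only [g, Finset.prod_const, Finset.card_univ, Fintype.card_fin, smul_eq_mul]
      ring
    have e2 : F (b, y0 + ρ * y) = F ((b0, y0) + (b - b0, 0) + (0, ρ * y)) := by
      congr 1; ext <;> simp
    show HasSum (fun n => Φ (b - b0) n * y ^ n) _
    rw [e1, e2]; exact h10
end
end Piece7

section Piece8
open unitInterval Topology Set Filter Polynomial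
open scoped NNReal ENNReal BoundedContinuousFunction

theorem analytic_inverse {E F : Type*} [NormedAddCommGroup E] [NormedSpace ℝ E] [CompleteSpace E]
    [NormedAddCommGroup F] [NormedSpace ℝ F] {f : E → F} {a : E} (hf : AnalyticAt ℝ f a)
    {f' : E ≃L[ℝ] F} (hf' : HasStrictFDerivAt f (f' : E →L[ℝ] F) a) :
    ∃ g : F → E, AnalyticAt ℝ g (f a) ∧ g (f a) = a ∧ (∀ᶠ y in 𝓝 (f a), f (g y) = y) ∧
      ∀ᶠ x in 𝓝 a, g (f x) = x := by
  refine ⟨hf'.localInverse f f' a, ?_, hf'.localInverse_apply_image, hf'.eventually_right_inverse,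
    hf'.eventually_left_inverse⟩
  have h := (hf'.toOpenPartialHomeomorph f).analyticAt_symm' (a := a) (i := f')
    hf'.mem_toOpenPartialHomeomorph_source (by simpa using hf) (by simpa using hf'.hasFDerivAt.fderiv)
  simpa [HasStrictFDerivAt.localInverse] using h

noncomputable def shB (j : ℕ) : (ℕ →ᵇ ℝ) →L[ℝ] (ℕ →ᵇ ℝ) :=
  LinearMap.mkContinuous
    { toFun := fun a => BoundedContinuousFunction.ofNormedAddCommGroupDiscrete
        (fun n => if n < j then 0 else a (n - j)) ‖a‖ (fun n => by
          split_ifs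
          · simp
          · exact a.norm_coe_le_norm _)
      map_add' := by
        intro a b; ext n
        simp only [BoundedContinuousFunction.coe_ofNormedAddCommGroupDiscrete, BoundedContinuousFunction.coe_add, Pi.add_apply]
        split_ifs <;> simp
      map_smul' := by
        intro a b; ext n
        simp only [BoundedContinuousFunction.coe_ofNormedAddCommGroupDiscrete, BoundedContinuousFunction.coe_smul, RingHom.id_apply]
        split_ifs <;> simp } 1 (by
      intro a
      rw [one_mul]
      refine (BoundedContinuousFunction.norm_le (norm_nonneg _)).mpr ?_
      intro n
      simp only [LinearMap.coe_mk, AddHom.coe_mk, BoundedContinuousFunction.coe_ofNormedAddCommGroupDiscrete]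
      split_ifs
      · simp
      · exact a.norm_coe_le_norm _)

theorem shB_apply (j : ℕ) (a : ℕ →ᵇ ℝ) (n : ℕ) : shB j a n = if n < j then 0 else a (n - j) := rfl

theorem exists_back (d : ℕ) (a : ℕ →ᵇ ℝ) : ∃ q : ℕ →ᵇ ℝ, ∀ n, q n = a (n + d) :=
  ⟨BoundedContinuousFunction.ofNormedAddCommGroupDiscrete (fun n => a (n + d)) ‖a‖
    (fun n => a.norm_coe_le_norm _), fun _ => rfl⟩

theorem weier_div {d : ℕ} {φ : ℕ →ᵇ ℝ} (h0 : ∀ n < d, φ n = 0) (hd : φ d ≠ 0) :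
    ∃ (Q : (ℕ →ᵇ ℝ) → (ℕ →ᵇ ℝ)) (a : (ℕ →ᵇ ℝ) → Fin d → ℝ), AnalyticAt ℝ Q φ ∧ AnalyticAt ℝ a φ ∧
      Q φ 0 ≠ 0 ∧ a φ = 0 ∧ ∀ᶠ ψ in 𝓝 φ, ψ = shB d (Q ψ) + ∑ j : Fin d, a ψ j • shB j (Q ψ) := by
  obtain ⟨Q0, hQ0⟩ := exists_back d φ
  have hQ00 : Q0 0 ≠ 0 := by rw [hQ0, zero_add]; exact hd
  let Θ : (ℕ →ᵇ ℝ) × (Fin d → ℝ) → (ℕ →ᵇ ℝ) := fun q => shB d q.1 + ∑ j : Fin d, q.2 j • shB j q.1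
  let L : ((ℕ →ᵇ ℝ) × (Fin d → ℝ)) →L[ℝ] (ℕ →ᵇ ℝ) :=
    (shB d).comp (ContinuousLinearMap.fst ℝ _ _) + ∑ j : Fin d,
      ((ContinuousLinearMap.proj (R := ℝ) (φ := fun _ : Fin d => ℝ) j).comp (ContinuousLinearMap.snd ℝ (ℕ →ᵇ ℝ) (Fin d → ℝ))).smulRight (shB j Q0)
  have hL : ∀ q a, L (q, a) = shB d q + ∑ j : Fin d, a j • shB j Q0 := by
    intro q a
    simp [L]
  have hΘ : ∀ x, AnalyticAt ℝ Θ x := by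
    intro x
    have h1 : AnalyticAt ℝ (fun q : (ℕ →ᵇ ℝ) × (Fin d → ℝ) => shB d q.1) x :=
      ((shB d).comp (ContinuousLinearMap.fst ℝ _ _)).analyticAt x
    refine h1.add (Finset.analyticAt_fun_sum _ (fun j _ => ?_))
    have h2 : AnalyticAt ℝ (fun q : (ℕ →ᵇ ℝ) × (Fin d → ℝ) => shB j q.1) x :=
      ((shB j).comp (ContinuousLinearMap.fst ℝ _ _)).analyticAt x
    have h3 : AnalyticAt ℝ (fun q : (ℕ →ᵇ ℝ) × (Fin d → ℝ) => q.2 j) x :=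
      ((ContinuousLinearMap.proj (R := ℝ) (φ := fun _ : Fin d => ℝ) j).comp (ContinuousLinearMap.snd ℝ (ℕ →ᵇ ℝ) (Fin d → ℝ))).analyticAt x
    exact h3.smul h2
  have hder : HasStrictFDerivAt Θ L (Q0, 0) := by
    have h1 : HasStrictFDerivAt (fun q : (ℕ →ᵇ ℝ) × (Fin d → ℝ) => shB d q.1) ((shB d).comp (ContinuousLinearMap.fst ℝ _ _)) (Q0, 0) :=
      ((shB d).comp (ContinuousLinearMap.fst ℝ (ℕ →ᵇ ℝ) (Fin d → ℝ))).hasStrictFDerivAt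
    refine h1.add (HasStrictFDerivAt.fun_sum (fun j _ => ?_))
    have h2 : HasStrictFDerivAt (fun q : (ℕ →ᵇ ℝ) × (Fin d → ℝ) => shB j q.1) ((shB j).comp (ContinuousLinearMap.fst ℝ _ _)) (Q0, 0) :=
      ((shB j).comp (ContinuousLinearMap.fst ℝ (ℕ →ᵇ ℝ) (Fin d → ℝ))).hasStrictFDerivAt
    have h3 := ((ContinuousLinearMap.proj (R := ℝ) (φ := fun _ : Fin d => ℝ) j).comp (ContinuousLinearMap.snd ℝ (ℕ →ᵇ ℝ) (Fin d → ℝ))).hasStrictFDerivAt (x := (Q0, 0))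
    have h4 := h3.smul h2
    simp only [ContinuousLinearMap.comp_apply, ContinuousLinearMap.coe_snd', ContinuousLinearMap.proj_apply, Pi.zero_apply, zero_smul, zero_add] at h4
    exact h4
  have hLs : ∀ q a n, L (q, a) n = (if n < d then 0 else q (n - d)) + ∑ j : Fin d, a j * (if n < (j:ℕ) then 0 else Q0 (n - j)) := by
    intro q a n
    rw [hL]
    simp [shB_apply, BoundedContinuousFunction.coe_sum]
  have hinj0 : ∀ a : Fin d → ℝ, (∀ n < d, ∑ j : Fin d, a j * (if n < (j:ℕ) then 0 else Q0 (n - j)) = 0) → a = 0 := by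
    intro a ha
    have key : ∀ n, ∀ hn : n < d, a ⟨n, hn⟩ = 0 := by
      intro n
      induction n using Nat.strong_induction_on with
      | _ n ih =>
        intro hn
        have h1 := ha n hn
        rw [Finset.sum_eq_single ⟨n, hn⟩] at h1
        · simpa [hQ00] using h1
        · intro j _ hj
          by_cases hjn : n < (j:ℕ)
          · simp [hjn]
          · have : (j:ℕ) < n := by
              refine lt_of_le_of_ne (not_lt.mp hjn) (fun h => hj (Fin.ext h))
            rw [ih j this j.2, zero_mul]
        · simp
    ext j; exact key j j.2
  have hker : (L : ((ℕ →ᵇ ℝ) × (Fin d → ℝ)) →ₗ[ℝ] (ℕ →ᵇ ℝ)).ker = ⊥ := by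
    rw [LinearMap.ker_eq_bot']
    rintro ⟨q, a⟩ h
    have h' : ∀ n, L (q, a) n = 0 := fun n => by
      have : L (q, a) = 0 := h
      rw [this]; rfl
    have ha : a = 0 := hinj0 a (fun n hn => by
      have := h' n
      rw [hLs] at this
      simpa [hn] using this)
    subst ha
    have hq : q = 0 := by
      ext n
      have := h' (n + d)
      rw [hLs] at this
      simpa using this
    rw [hq]; rfl
  have hrange : (L : ((ℕ →ᵇ ℝ) × (Fin d → ℝ)) →ₗ[ℝ] (ℕ →ᵇ ℝ)).range = ⊤ := by
    rw [LinearMap.range_eq_top]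
    intro ψ
    let M : (Fin d → ℝ) →ₗ[ℝ] (Fin d → ℝ) :=
      { toFun := fun a n => ∑ j : Fin d, a j * (if (n:ℕ) < (j:ℕ) then 0 else Q0 (n - j))
        map_add' := by intro a b; ext n; simp only [Pi.add_apply, add_mul, Finset.sum_add_distrib]
        map_smul' := by intro a b; ext n; simp [Finset.mul_sum, mul_assoc] }
    have hM : Function.Injective M := by
      rw [← LinearMap.ker_eq_bot, LinearMap.ker_eq_bot']
      intro a ha
      exact hinj0 a (fun n hn => congrFun ha ⟨n, hn⟩)
    obtain ⟨a, ha⟩ := (LinearMap.injective_iff_surjective.mp hM) (fun n => ψ n)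
    obtain ⟨q, hq⟩ := exists_back d (ψ - ∑ j : Fin d, a j • shB j Q0)
    refine ⟨(q, a), ?_⟩
    ext n
    show L (q, a) n = ψ n
    by_cases hn : n < d
    · have h1 := congrFun ha ⟨n, hn⟩
      rw [hLs]
      simp only [hn, if_true, zero_add]
      exact h1
    · rw [hL]
      have : n - d + d = n := Nat.sub_add_cancel (not_lt.mp hn)
      simp only [BoundedContinuousFunction.coe_add, Pi.add_apply, shB_apply d, hn, if_false, hq, this, BoundedContinuousFunction.coe_sub, Pi.sub_apply]
      ring
  let Le := ContinuousLinearEquiv.ofBijective L hker hrange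
  have hLe : (Le : ((ℕ →ᵇ ℝ) × (Fin d → ℝ)) →L[ℝ] (ℕ →ᵇ ℝ)) = L := by
    refine ContinuousLinearMap.ext (fun x => rfl)
  rw [← hLe] at hder
  obtain ⟨g, hg, hga, hgr, -⟩ := analytic_inverse (hΘ _) hder
  have hΘ0 : Θ (Q0, 0) = φ := by
    ext n
    simp only [Θ, Pi.zero_apply, zero_smul, Finset.sum_const_zero, add_zero, shB_apply]
    split_ifs with h
    · exact (h0 n h).symm
    · rw [hQ0, Nat.sub_add_cancel (not_lt.mp h)]
  rw [hΘ0] at hg hga hgr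
  refine ⟨fun ψ => (g ψ).1, fun ψ => (g ψ).2, analyticAt_fst.comp hg, analyticAt_snd.comp hg, ?_, ?_, ?_⟩
  · simp only [hga]; exact hQ00
  · simp only [hga]
  · filter_upwards [hgr] with ψ hψ using hψ.symm

theorem hasSum_shB {a : ℕ →ᵇ ℝ} {y s : ℝ} (h : HasSum (fun n => a n * y ^ n) s) (j : ℕ) :
    HasSum (fun n => shB j a n * y ^ n) (y ^ j * s) := by
  have h1 := h.mul_left (y ^ j)
  refine (Function.Injective.hasSum_iff (g := fun n => n + j) (add_left_injective j) ?_).mp ?_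
  · intro n hn
    have : n < j := by
      by_contra hc
      exact hn ⟨n - j, Nat.sub_add_cancel (not_lt.mp hc)⟩
    simp [shB_apply, this]
  · have e : ((fun n => shB j a n * y ^ n) ∘ fun n => n + j) = fun n => y ^ j * (a n * y ^ n) := by
      funext n
      simp [shB_apply, pow_add]; ring
    rw [e]; exact h1

theorem bcf_sum_ne {a : ℕ →ᵇ ℝ} {y : ℝ} {K η : ℝ} (hη : η ≤ 1/2) (hy : |y| ≤ η) (hK : ‖a‖ ≤ K)
    (hlt : K * (2 * η) < |a 0|) : ∃ s, s ≠ 0 ∧ HasSum (fun n => a n * y ^ n) s := by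
  have hy1 : |y| < 1 := by linarith
  have hg := hasSum_geometric_of_lt_one (abs_nonneg y) hy1
  have hb : ∀ n, ‖a n * y ^ n‖ ≤ ‖a‖ * |y| ^ n := fun n => by
    rw [norm_mul, norm_pow, Real.norm_eq_abs y]
    exact mul_le_mul_of_nonneg_right (a.norm_coe_le_norm n) (by positivity)
  have hs : Summable (fun n => a n * y ^ n) := Summable.of_norm_bounded (hg.summable.mul_left ‖a‖) hb
  refine ⟨_, ?_, hs.hasSum⟩
  rw [hs.tsum_eq_zero_add]
  have h2 : |∑' n, a (n+1) * y ^ (n+1)| ≤ K * (2 * η) := by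
    have hg' : HasSum (fun n => ‖a‖ * |y| ^ (n+1)) (‖a‖ * (|y| * (1 - |y|)⁻¹)) := by
      have := (hg.mul_left |y|).mul_left ‖a‖
      have e : (fun n => ‖a‖ * |y| ^ (n+1)) = fun n => ‖a‖ * (|y| * |y| ^ n) := by
        funext n
        rw [pow_succ]; ring
      rw [e]; exact this
    have h3 := tsum_of_norm_bounded hg' (fun n => hb (n+1))
    rw [Real.norm_eq_abs] at h3
    refine h3.trans ?_
    have h4 : (1 - |y|)⁻¹ ≤ 2 := by
      rw [inv_le_comm₀ (by linarith) (by norm_num)]; linarith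
    have h5 : 0 ≤ (1 - |y|)⁻¹ := inv_nonneg.mpr (by linarith)
    have h6 : |y| * (1 - |y|)⁻¹ ≤ η * 2 := mul_le_mul hy h4 h5 ((abs_nonneg y).trans hy)
    calc ‖a‖ * (|y| * (1 - |y|)⁻¹) ≤ K * (η * 2) := mul_le_mul hK h6 (by positivity) ((norm_nonneg _).trans hK)
      _ = _ := by ring
  intro h
  simp only [pow_zero, mul_one] at h
  have h7 : a 0 = -∑' n, a (n+1) * y ^ (n+1) := by linarith
  rw [h7, abs_neg] at hlt
  linarith

theorem weier {E : Type} [NormedAddCommGroup E] [NormedSpace ℝ E] {F : E × ℝ → ℝ} {b0 : E} {y0 : ℝ}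
    (hF : AnalyticAt ℝ F (b0, y0)) (hne : ¬ ∀ᶠ y in 𝓝 y0, F (b0, y) = 0) {δ0 : ℝ} (hδ0 : 0 < δ0) :
    ∃ δ > 0, δ < δ0 ∧ ∃ (P : E → ℝ[X]) (d : ℕ), (∀ b, (P b).Monic) ∧ (∀ b, (P b).natDegree = d) ∧
      (∀ i, AnalyticAt ℝ (fun b => (P b).coeff i) b0) ∧
      ∀ᶠ b in 𝓝 b0, ∀ y, (|y - y0| < δ → F (b, y) = 0 → (P b).eval y = 0) ∧
        ((P b).eval y = 0 → |y - y0| < δ ∧ F (b, y) = 0) := by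
  obtain ⟨ρ, hρ, hρ0, Φ, hΦ, hΦs⟩ := strip_series hF hδ0
  have hex : ∃ n, Φ b0 n ≠ 0 := by
    by_contra hc
    push Not at hc
    apply hne
    have h1 := hΦs.self_of_nhds
    filter_upwards [Metric.ball_mem_nhds y0 hρ] with y hy
    rw [Metric.mem_ball, Real.dist_eq] at hy
    have h2 := h1 ((y - y0) / ρ) (by rw [abs_div, abs_of_pos hρ, div_lt_one hρ]; exact hy)
    have e : y0 + ρ * ((y - y0) / ρ) = y := by field_simp; ring
    rw [e] at h2
    simp only [hc, zero_mul] at h2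
    exact h2.unique hasSum_zero
  classical
  let d := Nat.find hex
  have hd : Φ b0 d ≠ 0 := Nat.find_spec hex
  have hd0 : ∀ n < d, Φ b0 n = 0 := fun n hn => not_not.mp (Nat.find_min hex hn)
  obtain ⟨Q, a, hQ, ha, hQ0, ha0, hQa⟩ := weier_div hd0 hd
  let K := ‖Q (Φ b0)‖ + 1
  have hK : 0 < K := by positivity
  have hq0 : 0 < |Q (Φ b0) 0| := abs_pos.mpr hQ0
  obtain ⟨η, hη, hη2, hηK⟩ : ∃ η > 0, η ≤ 1/2 ∧ K * (2 * η) < |Q (Φ b0) 0| := by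
    refine ⟨min (1/2) (|Q (Φ b0) 0| / (4 * K)), lt_min (by norm_num) (by positivity), min_le_left _ _, ?_⟩
    calc K * (2 * min (1/2) (|Q (Φ b0) 0| / (4 * K))) ≤ K * (2 * (|Q (Φ b0) 0| / (4 * K))) := by
          gcongr; exact min_le_right _ _
      _ = |Q (Φ b0) 0| / 2 := by field_simp; ring
      _ < _ := by linarith
  have hQc : ContinuousAt (fun b => Q (Φ b)) b0 := hQ.continuousAt.comp hΦ.continuousAt
  have hac : AnalyticAt ℝ (fun b => a (Φ b)) b0 := ha.comp hΦ
  have hQa' : ∀ᶠ b in 𝓝 b0, Φ b = shB d (Q (Φ b)) + ∑ j : Fin d, a (Φ b) j • shB j (Q (Φ b)) :=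
    hΦ.continuousAt.eventually hQa
  have hn1 : ∀ᶠ b in 𝓝 b0, ‖Q (Φ b)‖ < K := hQc.norm.eventually_lt_const (by simp [K])
  have hn2 : ∀ᶠ b in 𝓝 b0, K * (2 * η) < |Q (Φ b) 0| := by
    have : ContinuousAt (fun b => |Q (Φ b) 0|) b0 :=
      ((BoundedContinuousFunction.evalCLM ℝ 0).continuous.continuousAt.comp hQc).abs
    exact this.eventually_const_lt hηK
  have hn3 : ∀ᶠ b in 𝓝 b0, ∀ j, |a (Φ b) j| < η ^ d / (d + 1) := by
    rw [eventually_all]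
    intro j
    have h1 : ContinuousAt (fun b => |a (Φ b) j|) b0 :=
      ((continuous_apply j).continuousAt.comp hac.continuousAt).abs
    refine h1.eventually_lt_const ?_
    simp only [ha0, Pi.zero_apply, abs_zero]; positivity
  -- the polynomial
  let S : E → ℝ[X] := fun b => ∑ j : Fin d, C (a (Φ b) j * ρ ^ (d - j)) * (X - C y0) ^ (j:ℕ)
  let P : E → ℝ[X] := fun b => (X - C y0) ^ d + S b
  have hSdeg : ∀ b, (S b).degree < d := by
    intro b
    rw [← mem_degreeLT]
    refine Submodule.sum_mem _ (fun j _ => ?_)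
    rw [mem_degreeLT]
    have e1 : (C (a (Φ b) j * ρ ^ (d - j))).degree ≤ 0 := degree_C_le
    have e2 : ((X - C y0 : ℝ[X]) ^ (j:ℕ)).degree = (j:ℕ) := by rw [degree_pow, degree_X_sub_C]; simp
    refine (degree_mul_le _ _).trans_lt ?_
    rw [e2]
    refine (add_le_add_left e1 _).trans_lt ?_
    rw [zero_add]
    exact_mod_cast j.2
  have hXd : ((X - C y0 : ℝ[X]) ^ d).degree = d := by rw [degree_pow, degree_X_sub_C]; simp
  have hXm : ((X - C y0 : ℝ[X]) ^ d).Monic := (monic_X_sub_C y0).pow d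
  have hPm : ∀ b, (P b).Monic := fun b => hXm.add_of_left (by rw [hXd]; exact hSdeg b)
  have hPd : ∀ b, (P b).natDegree = d := fun b => by
    refine natDegree_eq_of_degree_eq_some ?_
    rw [← hXd]
    exact degree_add_eq_left_of_degree_lt (by rw [hXd]; exact hSdeg b)
  have hPe : ∀ b z, (P b).eval (y0 + ρ * z) = ρ ^ d * (z ^ d + ∑ j : Fin d, a (Φ b) j * z ^ (j:ℕ)) := by
    intro b z
    simp only [P, S, eval_add, eval_pow, eval_sub, eval_X, eval_C, eval_finset_sum, eval_mul, add_sub_cancel_left, mul_pow, mul_add, Finset.mul_sum]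
    congr 1
    refine Finset.sum_congr rfl (fun j _ => ?_)
    have : ρ ^ d = ρ ^ (d - j) * ρ ^ (j:ℕ) := by rw [← pow_add, Nat.sub_add_cancel j.2.le]
    rw [this]; ring
  have hη1 : η < 1 := by linarith
  refine ⟨ρ * η, by positivity, ?_, P, d, hPm, hPd, ?_, ?_⟩
  · nlinarith
  · intro i
    have : (fun b => (P b).coeff i) = fun b => ((X - C y0 : ℝ[X]) ^ d).coeff i + ∑ j : Fin d, a (Φ b) j * (ρ ^ (d - j) * ((X - C y0 : ℝ[X]) ^ (j:ℕ)).coeff i) := by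
      funext b
      simp only [P, S, coeff_add, finset_sum_coeff, coeff_C_mul, mul_assoc]
    rw [this]
    refine analyticAt_const.add (Finset.analyticAt_fun_sum _ (fun j _ => ?_))
    exact (((ContinuousLinearMap.proj (R := ℝ) (φ := fun _ : Fin d => ℝ) j).analyticAt _).comp hac).mul analyticAt_const
  · filter_upwards [hΦs, hQa', hn1, hn2, hn3] with b h1 h2 h3 h4 h5 y
    let z := (y - y0) / ρ
    have hyz : y = y0 + ρ * z := by simp only [z]; field_simp; ring
    have hz : |y - y0| = ρ * |z| := by
      rw [hyz]; simp [abs_mul, abs_of_pos hρ]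
    -- evaluation identity
    have key : |z| ≤ η → ∃ s, s ≠ 0 ∧ ρ ^ d * F (b, y) = (P b).eval y * s := by
      intro hzη
      obtain ⟨s, hs, hsum⟩ := bcf_sum_ne hη2 hzη h3.le h4
      refine ⟨s, hs, ?_⟩
      have e1 := h1 z (by linarith)
      rw [← hyz] at e1
      have e2 : HasSum (fun n => Φ b n * z ^ n) (z ^ d * s + ∑ j : Fin d, a (Φ b) j * (z ^ (j:ℕ) * s)) := by
        have e3 := (hasSum_shB hsum d).add (hasSum_sum (s := Finset.univ) (fun (j : Fin d) _ => (hasSum_shB hsum j).mul_left (a (Φ b) j)))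
        have e4 : (fun n => Φ b n * z ^ n) = fun n => shB d (Q (Φ b)) n * z ^ n + ∑ j : Fin d, a (Φ b) j * (shB j (Q (Φ b)) n * z ^ n) := by
          funext n
          conv_lhs => rw [h2]
          simp [BoundedContinuousFunction.coe_sum, add_mul, Finset.sum_mul, mul_assoc]
        rw [e4]; exact e3
      rw [e1.unique e2]
      conv_rhs => rw [hyz, hPe]
      rw [mul_assoc, add_mul, Finset.sum_mul]
      simp only [mul_assoc]
    have hroot : (P b).eval y = 0 → |z| < η := by
      intro h0
      rw [hyz, hPe] at h0
      have h0' : z ^ d = -∑ j : Fin d, a (Φ b) j * z ^ (j:ℕ) := by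
        have := (mul_eq_zero.mp h0).resolve_left (by positivity)
        linarith
      by_contra hc
      push Not at hc
      have hzpos : 0 < |z| := hη.trans_le hc
      have hb1 : |z| ^ d ≤ ∑ j : Fin d, |a (Φ b) j| * |z| ^ (j:ℕ) := by
        rw [← abs_pow, h0', abs_neg]
        refine (Finset.abs_sum_le_sum_abs _ _).trans (le_of_eq ?_)
        simp [abs_mul, abs_pow]
      have hb2 : ∀ j : Fin d, |a (Φ b) j| * |z| ^ (j:ℕ) ≤ |z| ^ d / (d + 1) := by
        intro j
        have e5 : η ^ d ≤ η ^ (d - j) := pow_le_pow_of_le_one hη.le hη1.le (Nat.sub_le _ _)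
        have e6 : η ^ (d - j) ≤ |z| ^ (d - (j:ℕ)) := pow_le_pow_left₀ hη.le hc _
        calc |a (Φ b) j| * |z| ^ (j:ℕ) ≤ (|z| ^ (d - (j:ℕ)) / (d + 1)) * |z| ^ (j:ℕ) := by
              refine mul_le_mul_of_nonneg_right ((h5 j).le.trans ?_) (by positivity)
              gcongr; exact e5.trans e6
          _ = |z| ^ (d - (j:ℕ)) * |z| ^ (j:ℕ) / (d + 1) := by ring
          _ = |z| ^ d / (d + 1) := by rw [← pow_add, Nat.sub_add_cancel j.2.le]
      have hb3 := hb1.trans (Finset.sum_le_sum (fun j _ => hb2 j))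
      rw [Finset.sum_const, Finset.card_univ, Fintype.card_fin, nsmul_eq_mul] at hb3
      have hb4 : (d:ℝ) * (|z| ^ d / (d + 1)) < |z| ^ d := by
        rw [mul_div_assoc', div_lt_iff₀ (by positivity)]
        have : 0 < |z| ^ d := by positivity
        nlinarith
      linarith
    constructor
    · intro hyδ hFy
      rw [hz] at hyδ
      have hzη : |z| < η := lt_of_mul_lt_mul_left hyδ hρ.le
      obtain ⟨s, hs, hs2⟩ := key hzη.le
      rw [hFy, mul_zero] at hs2
      exact (mul_eq_zero.mp hs2.symm).resolve_right hs
    · intro h0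
      have hzη := hroot h0
      obtain ⟨s, hs, hs2⟩ := key hzη.le
      rw [h0, zero_mul] at hs2
      refine ⟨?_, (mul_eq_zero.mp hs2).resolve_left (by positivity)⟩
      rw [hz]
      exact mul_lt_mul_of_pos_left hzη hρ
end Piece8

section Piece9
open unitInterval Topology Set Filter Polynomial

section
variable {E : Type} [NormedAddCommGroup E] [NormedSpace ℝ E]

theorem analytic_slice {F : E × ℝ → ℝ} {N : Set (E × ℝ)} (hF : AnalyticOnNhd ℝ F N) (b : E) {S : Set ℝ}
    (hS : ∀ y ∈ S, (b, y) ∈ N) : AnalyticOnNhd ℝ (fun y => F (b, y)) S := by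
  intro y hy
  refine AnalyticAt.comp' (g := F) (f := fun y => (b, y)) (hF _ (hS y hy)) ?_
  exact analyticAt_const.prod analyticAt_id

theorem good_open {F : E × ℝ → ℝ} {N : Set (E × ℝ)} (hN : IsOpen N) (hF : AnalyticOnNhd ℝ F N) :
    IsOpen {x | x ∈ N ∧ ¬ ∀ᶠ y in 𝓝 x.2, F (x.1, y) = 0} := by
  rw [isOpen_iff_mem_nhds]
  rintro ⟨b, y⟩ ⟨hx, hg⟩
  obtain ⟨r, hr, hrN⟩ := Metric.isOpen_iff.mp hN _ hx
  rw [← ball_prod_same] at hrN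
  obtain ⟨y', hy', hy'0⟩ : ∃ y' ∈ Metric.ball y r, F (b, y') ≠ 0 := by
    by_contra hc
    push Not at hc
    exact hg (by filter_upwards [Metric.ball_mem_nhds y hr] with z hz using hc z hz)
  have hc : ContinuousAt (fun b' => F (b', y')) b := by
    have h1 : ContinuousAt F (b, y') := (hF _ (hrN ⟨Metric.mem_ball_self hr, hy'⟩)).continuousAt
    exact ContinuousAt.comp (f := fun b' : E => (b', y')) (g := F) h1 (by fun_prop)
  have h2 : ∀ᶠ b' in 𝓝 b, F (b', y') ≠ 0 ∧ b' ∈ Metric.ball b r :=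
    (hc.eventually_ne hy'0).and (Metric.ball_mem_nhds b hr)
  have h3 : {b' | F (b', y') ≠ 0 ∧ b' ∈ Metric.ball b r} ×ˢ Metric.ball y r ∈ 𝓝 (b, y) :=
    prod_mem_nhds h2 (Metric.ball_mem_nhds y hr)
  filter_upwards [h3]
  rintro ⟨b1, y1⟩ ⟨⟨h4, h5⟩, h6⟩
  refine ⟨hrN ⟨h5, h6⟩, ?_⟩
  intro h7
  have h8 := analytic_slice hF b1 (S := Metric.ball y r) (fun z hz => hrN ⟨h5, hz⟩)
  have h9 := h8.eqOn_zero_of_preconnected_of_eventuallyEq_zero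
    (convex_ball y r).isPreconnected h6 h7
  exact h4 (h9 hy')

theorem strip {F : E × ℝ → ℝ} {Ω K : Set (E × ℝ)} (hΩ : IsOpen Ω) (hF : AnalyticOnNhd ℝ F Ω)
    (hK : IsCompact K) (b0 : E) (hKΩ : ∀ y, (b0, y) ∈ K → (b0, y) ∈ Ω)
    (hg : ∀ y, (b0, y) ∈ K → ¬ ∀ᶠ y' in 𝓝 y, F (b0, y') = 0) :
    ∃ (P : E → ℝ[X]) (d : ℕ), (∀ b, (P b).Monic) ∧ (∀ b, (P b).natDegree = d) ∧
      (∀ i, AnalyticAt ℝ (fun b => (P b).coeff i) b0) ∧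
      ∀ᶠ b in 𝓝 b0, ∀ y, ((b, y) ∈ K → F (b, y) = 0 → (P b).eval y = 0) ∧
        ((P b).eval y = 0 → (b, y) ∈ Ω ∧ F (b, y) = 0) := by
  have hS : IsCompact {y | (b0, y) ∈ K} := by
    have : {y | (b0, y) ∈ K} = Prod.snd '' (K ∩ {x | x.1 = b0}) := by
      ext y; constructor
      · intro h; exact ⟨(b0, y), ⟨h, rfl⟩, rfl⟩
      · rintro ⟨⟨b, y'⟩, ⟨h1, h2⟩, rfl⟩
        have h2' : b = b0 := h2
        subst h2'; exact h1
    rw [this]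
    exact (hK.inter_right (isClosed_eq continuous_fst continuous_const)).image continuous_snd
  have key : ∃ (P : E → ℝ[X]) (d : ℕ) (V : Set ℝ), IsOpen V ∧ {y | (b0, y) ∈ K} ⊆ V ∧ (∀ b, (P b).Monic) ∧ (∀ b, (P b).natDegree = d) ∧
      (∀ i, AnalyticAt ℝ (fun b => (P b).coeff i) b0) ∧
      ∀ᶠ b in 𝓝 b0, ∀ y, (y ∈ V → F (b, y) = 0 → (P b).eval y = 0) ∧
        ((P b).eval y = 0 → (b, y) ∈ Ω ∧ F (b, y) = 0) := by
    refine hS.induction_on (p := fun S => ∃ (P : E → ℝ[X]) (d : ℕ) (V : Set ℝ), IsOpen V ∧ S ⊆ V ∧ (∀ b, (P b).Monic) ∧ (∀ b, (P b).natDegree = d) ∧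
      (∀ i, AnalyticAt ℝ (fun b => (P b).coeff i) b0) ∧
      ∀ᶠ b in 𝓝 b0, ∀ y, (y ∈ V → F (b, y) = 0 → (P b).eval y = 0) ∧
        ((P b).eval y = 0 → (b, y) ∈ Ω ∧ F (b, y) = 0)) ?_ ?_ ?_ ?_
    · refine ⟨fun _ => 1, 0, ∅, isOpen_empty, subset_rfl, fun _ => monic_one, fun _ => natDegree_one, fun i => analyticAt_const, ?_⟩
      simp
    · rintro s t hst ⟨P, d, V, h1, h2, h3⟩
      exact ⟨P, d, V, h1, hst.trans h2, h3⟩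
    · rintro s t ⟨P, d, V, h1, h2, h3, h4, h5, h6⟩ ⟨P', d', V', h1', h2', h3', h4', h5', h6'⟩
      refine ⟨fun b => P b * P' b, d + d', V ∪ V', h1.union h1', union_subset_union h2 h2', fun b => (h3 b).mul (h3' b), ?_, ?_, ?_⟩
      · intro b; rw [(h3 b).natDegree_mul (h3' b), h4, h4']
      · intro i
        simp only [coeff_mul]
        exact Finset.analyticAt_fun_sum _ (fun j _ => (h5 _).mul (h5' _))
      · filter_upwards [h6, h6'] with b hb hb' y
        rw [eval_mul, mul_eq_zero]
        refine ⟨?_, ?_⟩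
        · rintro (hy | hy) hFy
          · exact Or.inl ((hb y).1 hy hFy)
          · exact Or.inr ((hb' y).1 hy hFy)
        · rintro (hy | hy)
          · exact (hb y).2 hy
          · exact (hb' y).2 hy
    · intro y hy
      obtain ⟨r, hr, hrN⟩ := Metric.isOpen_iff.mp hΩ _ (hKΩ y hy)
      rw [← ball_prod_same] at hrN
      obtain ⟨δ, hδ, hδr, P, d, h1, h2, h3, h4⟩ := weier (hF _ (hKΩ y hy)) (hg y hy) hr
      refine ⟨Metric.ball y δ, mem_nhdsWithin_of_mem_nhds (Metric.ball_mem_nhds y hδ), P, d, Metric.ball y δ, Metric.isOpen_ball, subset_rfl, h1, h2, h3, ?_⟩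
      filter_upwards [h4, Metric.ball_mem_nhds b0 hr] with b hb hb2 z
      refine ⟨fun hz => (hb z).1 hz, fun hz => ?_⟩
      have := (hb z).2 hz
      refine ⟨hrN ⟨hb2, ?_⟩, this.2⟩
      rw [Metric.mem_ball, Real.dist_eq]; linarith [this.1]
  obtain ⟨P, d, V, hV, hSV, h3, h4, h5, h6⟩ := key
  refine ⟨P, d, h3, h4, h5, ?_⟩
  have hcl : IsClosed (Prod.fst '' (K ∩ {x | x.2 ∉ V})) :=
    ((hK.inter_right (hV.isClosed_compl.preimage continuous_snd)).image continuous_fst).isClosed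
  have hb0 : (Prod.fst '' (K ∩ {x | x.2 ∉ V}))ᶜ ∈ 𝓝 b0 := by
    refine hcl.isOpen_compl.mem_nhds ?_
    rintro ⟨⟨b, y⟩, ⟨h1, h2⟩, h7⟩
    have h7' : b = b0 := h7
    subst h7'
    exact h2 (hSV h1)
  filter_upwards [h6, hb0] with b hb hb' y
  refine ⟨fun hy hFy => (hb y).1 ?_ hFy, (hb y).2⟩
  by_contra hc
  exact hb' ⟨(b, y), ⟨hy, hc⟩, rfl⟩

theorem levels_exist (R0 h : ℝ) (hh : 0 < h) (hh1 : h ≤ 1) : ∃ T : Finset ℝ, (∀ t ∈ T, |t| < R0 + 2) ∧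
    ∀ y, |y| ≤ R0 → (∃ t ∈ T, y < t ∧ t < y + h) ∧ (∃ t ∈ T, t < y ∧ y - h < t) := by
  refine ⟨((Finset.range (⌈(2 * R0 + 2) / (h/2)⌉₊ + 1)).image (fun i : ℕ => -R0 - 1 + i * (h/2))).filter (fun t => |t| < R0 + 2), ?_, ?_⟩
  · intro t ht
    exact (Finset.mem_filter.mp ht).2
  · intro y hy
    rw [abs_le] at hy
    have aux : ∀ z, -R0 - 1 + h/2 ≤ z → z ≤ R0 + 1 → ∃ t ∈ ((Finset.range (⌈(2 * R0 + 2) / (h/2)⌉₊ + 1)).image (fun i : ℕ => -R0 - 1 + i * (h/2))).filter (fun t => |t| < R0 + 2), t ≤ z ∧ z < t + h / 2 := by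
      intro z hz1 hz2
      have hq : 0 ≤ (z + R0 + 1) / (h/2) := div_nonneg (by linarith) (by linarith)
      have h1 := Nat.floor_le hq
      have h2 := Nat.lt_floor_add_one ((z + R0 + 1) / (h/2))
      rw [le_div_iff₀ (by linarith)] at h1
      rw [div_lt_iff₀ (by linarith)] at h2
      refine ⟨-R0 - 1 + ⌊(z + R0 + 1) / (h/2)⌋₊ * (h/2), ?_, by linarith, by linarith⟩
      rw [Finset.mem_filter, Finset.mem_image]
      refine ⟨⟨_, ?_, rfl⟩, ?_⟩
      · rw [Finset.mem_range, Nat.lt_succ_iff]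
        refine (Nat.floor_mono ?_).trans (Nat.floor_le_ceil _)
        exact div_le_div_of_nonneg_right (by linarith) (by linarith)
      · rw [abs_lt]
        constructor <;> linarith
    constructor
    · obtain ⟨t, ht, h1, h2⟩ := aux (y + h * (3/4)) (by linarith) (by linarith)
      exact ⟨t, ht, by linarith, by linarith⟩
    · obtain ⟨t, ht, h1, h2⟩ := aux (y - h * (1/4)) (by linarith) (by linarith)
      exact ⟨t, ht, by linarith, by linarith⟩

theorem coeff_eventually {P : E → ℝ[X]} {d : ℕ} (hd : ∀ b, (P b).natDegree = d) {b0 : E}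
    (h : ∀ i, AnalyticAt ℝ (fun b => (P b).coeff i) b0) :
    ∀ᶠ b in 𝓝 b0, ∀ i, AnalyticAt ℝ (fun b => (P b).coeff i) b := by
  have h1 : ∀ᶠ b in 𝓝 b0, ∀ i ∈ Finset.range (d + 1), AnalyticAt ℝ (fun b => (P b).coeff i) b := by
    rw [Filter.eventually_all_finset]
    intro i _
    exact (h i).eventually_analyticAt
  filter_upwards [h1] with b hb i
  by_cases hi : i < d + 1
  · exact hb i (Finset.mem_range.mpr hi)
  · have : (fun b => (P b).coeff i) = fun _ => 0 := by
      funext b'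
      exact coeff_eq_zero_of_natDegree_lt (by rw [hd]; omega)
    rw [this]; exact analyticAt_const

structure LocGood {𝒜 : Type} (K : 𝒜 → Set (E × ℝ)) (F : 𝒜 → E × ℝ → ℝ) (δ : 𝒜 → ℝ) (R0 : ℝ) (b0 : E) (r : ℝ)
    (P : E → ℝ[X]) (n : ℕ) : Prop where
  monic : ∀ b, (P b).Monic
  deg : ∀ b, (P b).natDegree = n
  an : ∀ i, AnalyticOnNhd ℝ (fun b => (P b).coeff i) (Metric.ball b0 r)
  bd : ∀ b ∈ Metric.ball b0 r, ∀ y, (P b).eval y = 0 → |y| < R0 + 2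
  fam : ∀ a, (∀ x ∈ K a, x.1 ∉ Metric.ball b0 r) ∨ (r ≤ δ a / 4 ∧
    (∃ T : Finset ℝ, (∀ t ∈ T, ∀ b, (X - C t) ∣ P b) ∧ ∀ y, |y| ≤ R0 → (∃ t ∈ T, y < t ∧ t < y + δ a / 2) ∧ (∃ t ∈ T, t < y ∧ y - δ a / 2 < t)) ∧
    ∃ (G : E → ℝ[X]) (d : ℕ), (∀ b, (G b).Monic) ∧ (∀ b, (G b).natDegree = d) ∧
      (∀ i, AnalyticOnNhd ℝ (fun b => (G b).coeff i) (Metric.ball b0 r)) ∧ (∀ b, G b ∣ P b) ∧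
      ∀ b ∈ Metric.ball b0 r, ∀ y, ((b, y) ∈ Metric.cthickening (δ a) (K a) → F a (b, y) = 0 → (G b).eval y = 0) ∧
        ((G b).eval y = 0 → F a (b, y) = 0))

theorem local_data [FiniteDimensional ℝ E] {𝒜 : Type} {K Ω : 𝒜 → Set (E × ℝ)} {F : 𝒜 → E × ℝ → ℝ} {δ : 𝒜 → ℝ} {R0 : ℝ}
    (hK : ∀ a, IsCompact (K a)) (hΩ : ∀ a, IsOpen (Ω a)) (hF : ∀ a, AnalyticOnNhd ℝ (F a) (Ω a))
    (hlf : LocallyFinite K) (hR0 : ∀ a, ∀ x ∈ K a, |x.2| ≤ R0) (hδ : ∀ a, 0 < δ a)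
    (hKΩ : ∀ a, Metric.cthickening (δ a) (K a) ⊆ Ω a) (hΩR : ∀ a, ∀ x ∈ Ω a, |x.2| < R0 + 2)
    (hg : ∀ a, ∀ x ∈ Ω a, ¬ ∀ᶠ y in 𝓝 x.2, F a (x.1, y) = 0) (b0 : E) {r0 : ℝ} (hr0 : 0 < r0) :
    ∃ r > 0, r < r0 ∧ ∃ P n, LocGood K F δ R0 b0 r P n := by
  have : ProperSpace E := FiniteDimensional.proper ℝ E
  have hfin := hlf.finite_nonempty_inter_compact ((isCompact_closedBall b0 1).prod (isCompact_Icc (a := -R0) (b := R0)))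
  let A := hfin.toFinset
  have hA : ∀ a ∉ A, ∀ x ∈ K a, x.1 ∉ Metric.closedBall b0 1 := by
    intro a ha x hx hx1
    exact ha (hfin.mem_toFinset.mpr ⟨x, hx, hx1, abs_le.mp (hR0 a x hx)⟩)
  choose G d hGm hGd hGa hG using fun a => strip (hΩ a) (hF a) ((hK a).cthickening (r := δ a)) b0
    (fun y hy => hKΩ a hy) (fun y hy => hg a _ (hKΩ a hy))
  obtain ⟨h, hh0, hh1, hhA⟩ : ∃ h > 0, h ≤ 1 ∧ ∀ a ∈ A, h ≤ δ a / 4 := by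
    have h1 : ∀ᶠ h in 𝓝[>] (0:ℝ), h ≤ 1 := mem_nhdsWithin_of_mem_nhds (Iic_mem_nhds zero_lt_one)
    have h2 : ∀ᶠ h in 𝓝[>] (0:ℝ), ∀ a ∈ A, h ≤ δ a / 4 := by
      rw [Filter.eventually_all_finset]
      intro a _
      exact mem_nhdsWithin_of_mem_nhds (Iic_mem_nhds (by have := hδ a; linarith))
    have h3 : ∀ᶠ h in 𝓝[>] (0:ℝ), 0 < h := self_mem_nhdsWithin
    obtain ⟨h, ha, hb, hc⟩ := (h1.and (h2.and h3)).exists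
    exact ⟨h, hc, ha, hb⟩
  obtain ⟨T, hT1, hT2⟩ := levels_exist R0 h hh0 hh1
  have hev : ∀ᶠ b in 𝓝 b0, ∀ a ∈ A, (∀ i, AnalyticAt ℝ (fun b => (G a b).coeff i) b) ∧
      ∀ y, ((b, y) ∈ Metric.cthickening (δ a) (K a) → F a (b, y) = 0 → (G a b).eval y = 0) ∧
        ((G a b).eval y = 0 → (b, y) ∈ Ω a ∧ F a (b, y) = 0) := by
    rw [Filter.eventually_all_finset]
    intro a _
    exact (coeff_eventually (hGd a) (hGa a)).and (hG a)
  obtain ⟨ε, hε, hεb⟩ := Metric.eventually_nhds_iff_ball.mp hev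
  let r := min (min ε h) (r0 / 2)
  have hr : 0 < r := lt_min (lt_min hε hh0) (by linarith)
  have hrε : r ≤ ε := (min_le_left _ _).trans (min_le_left _ _)
  have hrh : r ≤ h := (min_le_left _ _).trans (min_le_right _ _)
  have hrr0 : r < r0 := lt_of_le_of_lt (min_le_right _ _) (by linarith)
  have hball : ∀ b ∈ Metric.ball b0 r, b ∈ Metric.ball b0 ε := fun b hb => Metric.ball_subset_ball hrε hb
  let P : E → ℝ[X] := fun b => (∏ t ∈ T, (X - C t)) * ∏ a ∈ A, G a b
  have hm1 : (∏ t ∈ T, (X - C t) : ℝ[X]).Monic := monic_prod_of_monic _ _ (fun t _ => monic_X_sub_C t)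
  have hm2 : ∀ b, (∏ a ∈ A, G a b).Monic := fun b => monic_prod_of_monic _ _ (fun a _ => hGm a b)
  have hprod : ∀ b ∈ Metric.ball b0 r, ∀ i, AnalyticAt ℝ (fun b => (∏ a ∈ A, G a b).coeff i) b := by
    intro b hb
    have : ∀ A' ⊆ A, ∀ i, AnalyticAt ℝ (fun b => (∏ a ∈ A', G a b).coeff i) b := by
      intro A'
      classical
      induction A' using Finset.induction_on with
      | empty => intro _ i; simpa using analyticAt_const
      | insert a s ha ih =>
        intro hs i
        simp only [Finset.prod_insert ha, coeff_mul]
        refine Finset.analyticAt_fun_sum _ (fun j _ => ?_)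
        exact ((hεb b (hball b hb) a (hs (Finset.mem_insert_self _ _))).1 _).mul (ih (fun x hx => hs (Finset.mem_insert_of_mem hx)) _)
    exact this A subset_rfl
  refine ⟨r, hr, hrr0, P, (∏ t ∈ T, (X - C t) : ℝ[X]).natDegree + ∑ a ∈ A, d a, ?_⟩
  constructor
  · exact fun b => hm1.mul (hm2 b)
  · intro b
    simp only [P]
    rw [hm1.natDegree_mul (hm2 b), natDegree_prod_of_monic _ _ (fun a _ => hGm a b)]
    simp only [hGd]
  · intro i b hb
    simp only [P, coeff_mul]
    exact Finset.analyticAt_fun_sum _ (fun j _ => analyticAt_const.mul (hprod b hb _))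
  · intro b hb y hy
    simp only [P, eval_mul, mul_eq_zero, eval_prod, Finset.prod_eq_zero_iff] at hy
    rcases hy with ⟨t, ht, hty⟩ | ⟨a, ha, hay⟩
    · have : y = t := by simpa [sub_eq_zero] using hty
      rw [this]; exact hT1 t ht
    · exact hΩR a _ (((hεb b (hball b hb) a ha).2 y).2 hay).1
  · intro a
    by_cases ha : a ∈ A
    · right
      refine ⟨hrh.trans (hhA a ha), ⟨T, ?_, ?_⟩, G a, d a, hGm a, hGd a, ?_, ?_, ?_⟩
      · intro t ht b
        exact Dvd.dvd.mul_right (Finset.dvd_prod_of_mem (fun t => (X - C t : ℝ[X])) ht) _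
      · intro y hy
        obtain ⟨⟨t, h1, h2, h3⟩, ⟨t', h1', h2', h3'⟩⟩ := hT2 y hy
        have := hhA a ha
        have := hδ a
        exact ⟨⟨t, h1, h2, by linarith⟩, ⟨t', h1', h2', by linarith⟩⟩
      · intro i b hb
        exact (hεb b (hball b hb) a ha).1 i
      · intro b
        exact Dvd.dvd.mul_left (Finset.dvd_prod_of_mem (fun a => G a b) ha) _
      · intro b hb y
        have := (hεb b (hball b hb) a ha).2 y
        exact ⟨this.1, fun h => (this.2 h).2⟩
    · left
      intro x hx hxb
      exact hA a ha x hx (Metric.ball_subset_closedBall (Metric.ball_subset_ball (hrh.trans hh1) hxb))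
end
end Piece9

section Piece10
open unitInterval Topology Set Filter Polynomial

def Claim (E L : Type) [NormedAddCommGroup E] [NormedSpace ℝ E] [NormedAddCommGroup L] [NormedSpace ℝ L]
    (ℓ : E →L[ℝ] L) : Prop :=
  ∀ (𝒜 : Type) [Countable 𝒜] (K N : 𝒜 → Set E) (F : 𝒜 → E → ℝ), (∀ a, IsCompact (K a)) →
    (∀ a, IsOpen (N a)) → (∀ a, K a ⊆ N a) → (∀ a, AnalyticOnNhd ℝ (F a) (N a)) → LocallyFinite K →
    Bornology.IsBounded (ℓ '' ⋃ a, K a) → (∀ a, ∀ x ∈ K a, ¬ ∀ᶠ z in 𝓝 x, F a z = 0) →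
    ∃ C : RC E, (∀ a, K a ⊆ ⋃ c, C.cl c) ∧ (∀ a c, (C.cl c ∩ K a).Nonempty → C.cl c ⊆ N a) ∧
      ∀ a c, (C.op c ∩ K a).Nonempty → (∀ x ∈ C.op c, F a x = 0) ∨ (∀ x ∈ C.op c, F a x ≠ 0)

section
variable {E : Type} [NormedAddCommGroup E] [NormedSpace ℝ E]

theorem prod_coeff_analyticAt {α : Type} {P : α → E → ℝ[X]} {b : E} (s : Finset α)
    (h : ∀ j ∈ s, ∀ i, AnalyticAt ℝ (fun b => (P j b).coeff i) b) :
    ∀ i, AnalyticAt ℝ (fun b => (∏ j ∈ s, P j b).coeff i) b := by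
  classical
  induction s using Finset.induction_on with
  | empty => intro i; simpa using analyticAt_const
  | insert a s ha ih =>
    intro i
    simp only [Finset.prod_insert ha, coeff_mul]
    refine Finset.analyticAt_fun_sum _ (fun j _ => ?_)
    exact (h a (Finset.mem_insert_self _ _) _).mul (ih (fun x hx => h x (Finset.mem_insert_of_mem hx)) _)

noncomputable def PiB {α : Type} (P : α → E → ℝ[X]) (R : ℝ) (β : Finset α) (b : E) : ℝ[X] :=
  (X ^ 2 - C (R ^ 2)) * ∏ i ∈ β, P i b

theorem PiB_monic {α : Type} {P : α → E → ℝ[X]} {R : ℝ} {β : Finset α} {b : E} (h : ∀ i ∈ β, (P i b).Monic) :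
    (PiB P R β b).Monic :=
  (monic_X_pow_sub_C _ (by norm_num)).mul (monic_prod_of_monic _ _ h)

theorem PiB_deg {α : Type} {P : α → E → ℝ[X]} {R : ℝ} {β : Finset α} {b : E} (h : ∀ i ∈ β, (P i b).Monic) {n : α → ℕ}
    (hn : ∀ i ∈ β, (P i b).natDegree = n i) :
    (PiB P R β b).natDegree = 2 + ∑ i ∈ β, n i := by
  unfold PiB
  rw [(monic_X_pow_sub_C _ (by norm_num)).natDegree_mul (monic_prod_of_monic _ _ h), natDegree_X_pow_sub_C,
    natDegree_prod_of_monic _ _ h, Finset.sum_congr rfl hn]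

theorem PiB_an {α : Type} {P : α → E → ℝ[X]} {R : ℝ} {β : Finset α} {b : E} 
    (h : ∀ j ∈ β, ∀ i, AnalyticAt ℝ (fun b => (P j b).coeff i) b) (i : ℕ) : 
    AnalyticAt ℝ (fun b => (PiB P R β b).coeff i) b := by
  simp only [PiB, coeff_mul]
  exact Finset.analyticAt_fun_sum _ (fun j _ => analyticAt_const.mul (prod_coeff_analyticAt β h _))

theorem PiB_root {α : Type} {P : α → E → ℝ[X]} {R : ℝ} {β : Finset α} {b : E} {y : ℝ} :
    (PiB P R β b).eval y = 0 ↔ (y = R ∨ y = -R) ∨ ∃ i ∈ β, (P i b).eval y = 0 := by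
  simp only [PiB, eval_mul, eval_sub, eval_pow, eval_X, eval_C, mul_eq_zero, eval_prod, Finset.prod_eq_zero_iff, sub_eq_zero, sq_eq_sq_iff_eq_or_eq_neg]

theorem base_complex [FiniteDimensional ℝ E] {L : Type} [NormedAddCommGroup L] [NormedSpace ℝ L] {ℓ : E →L[ℝ] L}
    (hE : Claim E L ℓ) {α : Type} [Countable α] {cen : α → E} {r : α → ℝ} {P : α → E → ℝ[X]} {n : α → ℕ} {R : ℝ}
    (hm : ∀ i b, (P i b).Monic) (hd : ∀ i b, (P i b).natDegree = n i)
    (han : ∀ i j, AnalyticOnNhd ℝ (fun b => (P i b).coeff j) (Metric.ball (cen i) (r i)))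
    (hbd : ∀ i, ∀ b ∈ Metric.ball (cen i) (r i), ∀ y, (P i b).eval y = 0 → |y| ≤ R) (hR : 0 ≤ R)
    (hlf : LocallyFinite (fun i => Metric.ball (cen i) (r i)))
    {v w : α → Set E} (hv : ∀ i, IsOpen (v i)) (hv2 : ∀ i, closure (v i) ⊆ Metric.ball (cen i) (r i))
    (hw2 : ∀ i, closure (w i) ⊆ v i) (hℓ : Bornology.IsBounded (ℓ '' ⋃ i, Metric.ball (cen i) (r i))) :
    ∃ (C : RC E) (B : C.ι → Finset α) (m : C.ι → ℕ) (S : C.Sections), (∀ i, closure (w i) ⊆ ⋃ c, C.cl c) ∧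
      (∀ c i x, x ∈ C.cl c → x ∈ closure (w i) → i ∈ B c) ∧ (∀ c, ∀ i ∈ B c, C.cl c ⊆ Metric.ball (cen i) (r i)) ∧
      (∀ c, ∀ b ∈ C.op c, (cr (PiB P R (B c) b)).card = m c) ∧
      ∀ c, ∀ b ∈ C.op c, ∀ y, (PiB P R (B c) b).eval y = 0 ↔ ∃ j ≤ S.k c, S.ξ c j b = y := by
  classical
  have : ProperSpace E := FiniteDimensional.proper ℝ E
  have hvc : ∀ i, IsCompact (closure (v i)) := fun i =>
    Metric.isCompact_of_isClosed_isBounded isClosed_closure (Metric.isBounded_ball.subset (hv2 i))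
  have hwv : ∀ i, closure (w i) ⊆ closure (v i) := fun i => (hw2 i).trans subset_closure
  have hwc : ∀ i, IsCompact (closure (w i)) := fun i => (hvc i).of_isClosed_subset isClosed_closure (hwv i)
  let NB : Finset α → Set E := fun β => ⋂ i ∈ β, Metric.ball (cen i) (r i)
  let deg : Finset α → ℕ := fun β => 2 + ∑ i ∈ β, n i
  have hNBo : ∀ β, IsOpen (NB β) := fun β => isOpen_biInter_finset (fun i _ => Metric.isOpen_ball)
  have hNBc : ∀ β, IsPreconnected (NB β) := fun β =>
    (convex_iInter₂ (fun i _ => convex_ball _ _)).isPreconnected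
  have hmem : ∀ β b, b ∈ NB β ↔ ∀ i ∈ β, b ∈ Metric.ball (cen i) (r i) := fun β b => by simp only [NB, mem_iInter]
  have hPan : ∀ β, ∀ i, AnalyticOnNhd ℝ (fun b => (PiB P R β b).coeff i) (NB β) := by
    intro β i b hb
    exact PiB_an (fun j hj i => han j i b ((hmem β b).mp hb j hj)) i
  have hDan : ∀ β k, AnalyticOnNhd ℝ (fun b => DQ (deg β) k (PiB P R β b)) (NB β) := fun β k => DQ_analytic (hPan β) _ _
  -- the family on the base
  let βT := Σ β : {β : Finset α // β.Nonempty}, Fin (deg β.1 + 1)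
  let Kf : α ⊕ βT → Set E := Sum.elim (fun i => closure (w i)) (fun q => ⋂ i ∈ q.1.1, closure (v i))
  let Nf : α ⊕ βT → Set E := Sum.elim v (fun q => NB q.1.1)
  let Ff : α ⊕ βT → E → ℝ := Sum.elim (fun _ _ => 1) (fun q b =>
    if ∀ b' ∈ NB q.1.1, DQ (deg q.1.1) q.2 (PiB P R q.1.1 b') = 0 then 1 else DQ (deg q.1.1) q.2 (PiB P R q.1.1 b))
  have hlfv : LocallyFinite (fun i => closure (v i)) := hlf.subset hv2
  have hfin : ∀ x : E, ∃ t ∈ 𝓝 x, {i | (closure (v i) ∩ t).Nonempty}.Finite := hlfv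
  obtain ⟨C, hC1, hC2, hC3⟩ : ∃ C : RC E, (∀ a, Kf a ⊆ ⋃ c, C.cl c) ∧ (∀ a c, (C.cl c ∩ Kf a).Nonempty → C.cl c ⊆ Nf a) ∧
      ∀ a c, (C.op c ∩ Kf a).Nonempty → (∀ x ∈ C.op c, Ff a x = 0) ∨ (∀ x ∈ C.op c, Ff a x ≠ 0) := by
    refine hE (α ⊕ βT) Kf Nf Ff ?_ ?_ ?_ ?_ ?_ ?_ ?_
    · rintro (i | q)
      · exact hwc i
      · obtain ⟨⟨β, i, hi⟩, k⟩ := q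
        refine (hvc i).of_isClosed_subset (isClosed_biInter (fun _ _ => isClosed_closure)) (biInter_subset_of_mem hi)
    · rintro (i | q)
      · exact hv i
      · exact hNBo _
    · rintro (i | q)
      · exact hw2 i
      · exact biInter_mono subset_rfl (fun i _ => hv2 i)
    · rintro (i | q)
      · exact analyticOnNhd_const
      · by_cases hz : ∀ b' ∈ NB q.1.1, DQ (deg q.1.1) q.2 (PiB P R q.1.1 b') = 0
        · simp only [Ff, Nf, Sum.elim_inr, if_pos hz]; exact analyticOnNhd_const
        · simp only [Ff, Nf, Sum.elim_inr, if_neg hz]; exact hDan _ _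
    · intro x
      obtain ⟨t, ht, hf⟩ := hfin x
      refine ⟨t, ht, ?_⟩
      have h1 : {a | (Kf a ∩ t).Nonempty} ⊆ Sum.inl '' {i | (closure (v i) ∩ t).Nonempty} ∪
          Sum.inr '' (⋃ β ∈ ({β : {β : Finset α // β.Nonempty} | β.1 ∈ hf.toFinset.powerset} : Set _), range (fun k => (⟨β, k⟩ : βT))) := by
        rintro (i | ⟨β, k⟩) ⟨y, hy, hyt⟩
        · exact Or.inl ⟨i, ⟨y, hwv i hy, hyt⟩, rfl⟩
        · refine Or.inr ⟨_, mem_iUnion₂.mpr ⟨β, ?_, ⟨k, rfl⟩⟩, rfl⟩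
          show β.1 ∈ hf.toFinset.powerset
          rw [Finset.mem_powerset]
          intro i hi
          rw [hf.mem_toFinset]
          exact ⟨y, mem_iInter₂.mp hy i hi, hyt⟩
      refine Set.Finite.subset ?_ h1
      refine (hf.image _).union (Set.Finite.image _ ?_)
      refine Set.Finite.biUnion ?_ (fun β _ => finite_range _)
      exact Set.Finite.preimage (f := fun β : {β : Finset α // β.Nonempty} => β.1) (Subtype.val_injective.injOn) (Finset.finite_toSet _)
    · refine hℓ.subset (image_mono ?_)
      rintro x hx
      obtain ⟨(i | ⟨⟨β, i, hi⟩, k⟩), hx⟩ := mem_iUnion.mp hx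
      · exact mem_iUnion.mpr ⟨i, hv2 i (hwv i hx)⟩
      · exact mem_iUnion.mpr ⟨i, hv2 i (mem_iInter₂.mp hx i hi)⟩
    · rintro (i | q) x hx hev
      · have := hev.self_of_nhds
        simp [Ff] at this
      · by_cases hz : ∀ b' ∈ NB q.1.1, DQ (deg q.1.1) q.2 (PiB P R q.1.1 b') = 0
        · have := hev.self_of_nhds
          simp only [Ff, Sum.elim_inr, if_pos hz] at this
          exact one_ne_zero this
        · simp only [Ff, Sum.elim_inr, if_neg hz] at hev
          have hx' : x ∈ NB q.1.1 := biInter_mono subset_rfl (fun i _ => hv2 i) hx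
          exact hz (fun b' hb' => (hDan _ _).eqOn_zero_of_preconnected_of_eventuallyEq_zero (hNBc _) hx' hev hb')
  -- the sets B
  have hne : ∀ c x, x ∈ C.cl c → (C.op c).Nonempty := by
    intro c x hx
    obtain ⟨V, -, -, ⟨y, hy⟩, -⟩ := C.lconn c x hx univ univ_mem
    exact ⟨y, hy.2⟩
  have hclcl : ∀ c c1 x, x ∈ C.op c → x ∈ C.cl c1 → C.cl c ⊆ C.cl c1 := by
    intro c c1 x hx hx1
    exact (C.cl_sub_closure c).trans (closure_minimal (C.front c1 c x hx1 hx) (C.cl_compact c1).isClosed)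
  let Bs : C.ι → Set α := fun c => {i | ∃ c1, (C.op c ∩ C.cl c1).Nonempty ∧ (C.cl c1 ∩ closure (w i)).Nonempty}
  have hBv : ∀ c, ∀ i ∈ Bs c, C.cl c ⊆ v i := by
    rintro c i ⟨c1, ⟨x, hx1, hx2⟩, hx3⟩
    exact (hclcl c c1 x hx1 hx2).trans (hC2 (Sum.inl i) c1 hx3)
  have hBfin : ∀ c, (Bs c).Finite := by
    intro c
    refine (hlfv.finite_nonempty_inter_compact (C.cl_compact c)).subset ?_
    intro i hi
    obtain ⟨x, hx⟩ : (C.op c).Nonempty := by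
      obtain ⟨c1, ⟨x, hx, -⟩, -⟩ := hi
      exact ⟨x, hx⟩
    exact ⟨x, subset_closure (hBv c i hi (C.op_sub c hx)), C.op_sub c hx⟩
  let B : C.ι → Finset α := fun c => (hBfin c).toFinset
  have hBm : ∀ c i, i ∈ B c ↔ i ∈ Bs c := fun c i => (hBfin c).mem_toFinset
  have hBb : ∀ c, ∀ i ∈ B c, C.cl c ⊆ Metric.ball (cen i) (r i) := fun c i hi =>
    ((hBv c i ((hBm c i).mp hi)).trans subset_closure).trans (hv2 i)
  have hBface : ∀ c c' b, b ∈ C.op c' → b ∈ C.cl c → B c ⊆ B c' := by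
    intro c c' b hb' hb i hi
    rw [hBm] at hi ⊢
    obtain ⟨c1, ⟨x, hx1, hx2⟩, hx3⟩ := hi
    exact ⟨c1, ⟨b, hb', hclcl c c1 x hx1 hx2 hb⟩, hx3⟩
  have hcard : ∀ c, ∃ m, ∀ b ∈ C.op c, (cr (PiB P R (B c) b)).card = m := by
    intro c
    refine card_const (n := deg (B c)) (fun b _ => PiB_monic (fun i _ => hm i b)) (fun b _ => PiB_deg (fun i _ => hm i b) (fun i _ => hd i b)) ?_
    intro k hk
    by_cases hB : (B c).Nonempty
    · by_cases hop : (C.op c).Nonempty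
      · have h1 := hC3 (Sum.inr ⟨⟨B c, hB⟩, ⟨k, Nat.lt_succ_of_le hk⟩⟩) c (by
          obtain ⟨x, hx⟩ := hop
          refine ⟨x, hx, mem_iInter₂.mpr (fun i hi => subset_closure (hBv c i ((hBm c i).mp hi) (C.op_sub c hx)))⟩)
        have hsub : C.op c ⊆ NB (B c) := fun x hx => (hmem _ _).mpr (fun i hi => hBb c i hi (C.op_sub c hx))
        by_cases hz : ∀ b' ∈ NB (B c), DQ (deg (B c)) k (PiB P R (B c) b') = 0
        · left; exact fun b hb => hz b (hsub hb)
        · simpa only [Ff, Sum.elim_inr, if_neg hz] using h1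
      · left; intro b hb; exact absurd ⟨b, hb⟩ hop
    · rw [Finset.not_nonempty_iff_eq_empty] at hB
      simp only [hB, PiB, Finset.prod_empty]
      by_cases h0 : DQ (deg ∅) k ((X ^ 2 - Polynomial.C (R ^ 2)) * 1) = 0
      · left; intro _ _; exact h0
      · right; intro _ _; exact h0
  choose m hm' using hcard
  obtain ⟨S, hS⟩ : ∃ S : C.Sections, ∀ c, ∀ b ∈ C.op c, ∀ y, (PiB P R (B c) b).eval y = 0 ↔ ∃ j ≤ S.k c, S.ξ c j b = y := by
    refine sections_exist C (fun c => PiB P R (B c)) (fun c => deg (B c)) m R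
      (fun c b _ => PiB_monic (fun i _ => hm i b)) (fun c b _ => PiB_deg (fun i _ => hm i b) (fun i _ => hd i b))
      (fun c i b hb => (PiB_an (fun j hj i => han j i b (hBb c j hj hb)) i).continuousAt.continuousWithinAt) hm' ?_ ?_ ?_
    · intro c c' b hb' hb y hy
      rw [PiB_root] at hy ⊢
      refine hy.imp id ?_
      rintro ⟨i, hi, h⟩
      exact ⟨i, hBface c c' b hb' hb hi, h⟩
    · intro c b hb y hy
      rw [PiB_root] at hy
      rcases hy with (rfl | rfl) | ⟨i, hi, h⟩
      · rw [abs_of_nonneg hR]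
      · rw [abs_neg, abs_of_nonneg hR]
      · exact hbd i b (hBb c i hi hb) y h
    · intro c b _
      rw [PiB_root]; exact Or.inl (Or.inl rfl)
  refine ⟨C, B, m, S, fun i => hC1 (Sum.inl i), ?_, hBb, hm', hS⟩
  intro c i x hx hxw
  rw [hBm]
  obtain ⟨y, hy⟩ := hne c x hx
  exact ⟨c, ⟨y, hy, C.op_sub c hy⟩, ⟨x, hx, hxw⟩⟩
end
end Piece10

section Piece11
open unitInterval Topology Set Filter Polynomial

section
variable {E : Type} [NormedAddCommGroup E] [NormedSpace ℝ E]

theorem LocGood.mono {𝒜 : Type} {K : 𝒜 → Set (E × ℝ)} {F : 𝒜 → E × ℝ → ℝ} {δ : 𝒜 → ℝ} {R0 : ℝ} {b0 : E} {r r' : ℝ}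
    {P : E → ℝ[X]} {n : ℕ} (h : LocGood K F δ R0 b0 r P n) (hr : r' ≤ r) : LocGood K F δ R0 b0 r' P n := by
  have hs : Metric.ball b0 r' ⊆ Metric.ball b0 r := Metric.ball_subset_ball hr
  refine ⟨h.monic, h.deg, fun i => (h.an i).mono hs, fun b hb => h.bd b (hs hb), fun a => ?_⟩
  rcases h.fam a with h1 | ⟨h1, h2, G, d, hG1, hG2, hG3, hG4, hG5⟩
  · exact Or.inl (fun x hx hb => h1 x hx (hs hb))
  · exact Or.inr ⟨hr.trans h1, h2, G, d, hG1, hG2, fun i => (hG3 i).mono hs, hG4, fun b hb => hG5 b (hs hb)⟩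

theorem level_sep_le {s : Set (E × ℝ)} (hs : IsPreconnected s) {t : ℝ} 
    (h : (∀ x ∈ s, x.2 - t = 0) ∨ (∀ x ∈ s, x.2 - t ≠ 0)) {x1 : E × ℝ} (hx1 : x1 ∈ closure s) (hlt : x1.2 < t) :
    ∀ x ∈ closure s, x.2 ≤ t := by
  have hcl : IsClosed {x : E × ℝ | x.2 ≤ t} := isClosed_le continuous_snd continuous_const
  have hop : IsOpen {x : E × ℝ | x.2 < t} := isOpen_lt continuous_snd continuous_const
  obtain ⟨x2, hx2, hx2s⟩ := mem_closure_iff.mp hx1 _ hop hlt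
  refine fun x hx => (closure_minimal (t := {x : E × ℝ | x.2 ≤ t}) ?_ hcl) hx
  rcases h with h | h
  · intro z hz; have := h z hz; simp only [mem_ofPred_eq]; linarith
  · intro z hz
    by_contra hzt
    simp only [mem_ofPred_eq, not_le] at hzt
    have h3 : IsPreconnected (Prod.snd '' s) := hs.image _ continuous_snd.continuousOn
    have h4 := h3.Icc_subset (mem_image_of_mem _ hx2s) (mem_image_of_mem _ hz) ⟨le_of_lt hx2, hzt.le⟩
    obtain ⟨w, hw, hwt⟩ := h4
    exact h w hw (by rw [hwt, sub_self])

theorem level_sep_ge {s : Set (E × ℝ)} (hs : IsPreconnected s) {t : ℝ} 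
    (h : (∀ x ∈ s, x.2 - t = 0) ∨ (∀ x ∈ s, x.2 - t ≠ 0)) {x1 : E × ℝ} (hx1 : x1 ∈ closure s) (hlt : t < x1.2) :
    ∀ x ∈ closure s, t ≤ x.2 := by
  have hcl : IsClosed {x : E × ℝ | t ≤ x.2} := isClosed_le continuous_const continuous_snd
  have hop : IsOpen {x : E × ℝ | t < x.2} := isOpen_lt continuous_const continuous_snd
  obtain ⟨x2, hx2, hx2s⟩ := mem_closure_iff.mp hx1 _ hop hlt
  refine fun x hx => (closure_minimal (t := {x : E × ℝ | t ≤ x.2}) ?_ hcl) hx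
  rcases h with h | h
  · intro z hz; have := h z hz; simp only [mem_ofPred_eq]; linarith
  · intro z hz
    by_contra hzt
    simp only [mem_ofPred_eq, not_le] at hzt
    have h3 : IsPreconnected (Prod.snd '' s) := hs.image _ continuous_snd.continuousOn
    have h4 := h3.Icc_subset (mem_image_of_mem _ hz) (mem_image_of_mem _ hx2s) ⟨hzt.le, le_of_lt hx2⟩
    obtain ⟨w, hw, hwt⟩ := h4
    exact h w hw (by rw [hwt, sub_self])

theorem step_good [FiniteDimensional ℝ E] {L : Type} [NormedAddCommGroup L] [NormedSpace ℝ L] {ℓ : E →L[ℝ] L}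
    (hE : Claim E L ℓ) {𝒜 : Type} {K N : 𝒜 → Set (E × ℝ)} {F : 𝒜 → E × ℝ → ℝ} {R0 : ℝ}
    (hK : ∀ a, IsCompact (K a)) (hN : ∀ a, IsOpen (N a)) (hKN : ∀ a, K a ⊆ N a) (hF : ∀ a, AnalyticOnNhd ℝ (F a) (N a))
    (hlf : LocallyFinite K) (hR : 0 ≤ R0) (hR0 : ∀ a, ∀ x ∈ K a, |x.2| ≤ R0)
    (hℓ : Bornology.IsBounded (ℓ '' ⋃ a, Prod.fst '' K a))
    (hg : ∀ a, ∀ x ∈ K a, ¬ ∀ᶠ y in 𝓝 x.2, F a (x.1, y) = 0) :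
    ∃ C : RC (E × ℝ), (∀ a, K a ⊆ ⋃ c, C.cl c) ∧ (∀ a c, (C.cl c ∩ K a).Nonempty → C.cl c ⊆ N a) ∧
      ∀ a c, (C.op c ∩ K a).Nonempty → (∀ x ∈ C.op c, F a x = 0) ∨ (∀ x ∈ C.op c, F a x ≠ 0) := by
  classical
  have : ProperSpace E := FiniteDimensional.proper ℝ E
  let Ω : 𝒜 → Set (E × ℝ) := fun a => {x | x ∈ N a ∧ ¬ ∀ᶠ y in 𝓝 x.2, F a (x.1, y) = 0} ∩ {x | |x.2| < R0 + 2}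
  have hΩ : ∀ a, IsOpen (Ω a) := fun a => (good_open (hN a) (hF a)).inter
    (isOpen_lt (continuous_snd.abs) continuous_const)
  have hKΩ : ∀ a, K a ⊆ Ω a := fun a x hx => ⟨⟨hKN a hx, hg a x hx⟩, by
    have := hR0 a x hx; simp only [mem_ofPred_eq]; linarith⟩
  choose δ hδ hδΩ using fun a => (hK a).exists_cthickening_subset_open (hΩ a) (hKΩ a)
  choose r hr hr1 P n hP using fun b : E => local_data (R0 := R0) hK hΩ (fun a => (hF a).mono (fun x hx => hx.1.1)) hlf hR0 hδ hδΩ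
    (fun a x hx => hx.2) (fun a x hx => hx.1.2) b (r0 := 1) one_pos
  let Sb : Set E := closure (⋃ a, Prod.fst '' K a)
  obtain ⟨α, cen, ρ, hα, hαc, hαlf⟩ := refinement_of_locallyCompact_sigmaCompact_of_nhds_basis_set (X := E) (s := Sb)
    (ι := fun _ => ℝ) (p := fun x q => 0 < q ∧ q < r x) (B := fun x q => Metric.ball x q) isClosed_closure
    (fun x _ => Metric.nhds_basis_ball.to_hasBasis (fun i hi => ⟨min i (r x / 2), ⟨lt_min hi (half_pos (hr x)),
      (min_le_right _ _).trans_lt (half_lt_self (hr x))⟩, Metric.ball_subset_ball (min_le_left _ _)⟩)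
      (fun i hi => ⟨i, hi.1, subset_rfl⟩))
  have hcnt : Countable α := countable_univ_iff.mp (hαlf.countable_univ (fun i => ⟨cen i, Metric.mem_ball_self (hα i).2.1⟩))
  have hLG : ∀ i, LocGood K F δ R0 (cen i) (ρ i) (P (cen i)) (n (cen i)) := fun i => (hP (cen i)).mono (hα i).2.2.le
  obtain ⟨v, hv1, hv2, hv3⟩ := exists_subset_iUnion_closure_subset (s := Sb) isClosed_closure
    (fun i => Metric.isOpen_ball) (fun x _ => hαlf.point_finite x) hαc
  have hvlf : LocallyFinite v := hαlf.subset (fun i => subset_closure.trans (hv3 i))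
  obtain ⟨w, hw1, hw2, hw3⟩ := exists_subset_iUnion_closure_subset (s := Sb) isClosed_closure
    hv2 (fun x _ => hvlf.point_finite x) hv1
  have hbb : Bornology.IsBounded (ℓ '' ⋃ i, Metric.ball (cen i) (ρ i)) := by
    have h1 : Bornology.IsBounded (ℓ '' Sb) := hℓ.closure.subset (image_closure_subset_closure_image ℓ.continuous)
    obtain ⟨M, hM⟩ := isBounded_iff_forall_norm_le.mp h1
    refine isBounded_iff_forall_norm_le.mpr ⟨M + ‖ℓ‖ * 1, ?_⟩
    rintro _ ⟨x, hx, rfl⟩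
    obtain ⟨i, hi⟩ := mem_iUnion.mp hx
    have h2 := hM _ ⟨cen i, (hα i).1, rfl⟩
    have h3 : ‖ℓ (x - cen i)‖ ≤ ‖ℓ‖ * 1 := by
      refine (ℓ.le_opNorm _).trans (mul_le_mul_of_nonneg_left ?_ (norm_nonneg _))
      rw [← dist_eq_norm]
      have := Metric.mem_ball.mp hi
      have := (hα i).2.2
      have := hr1 (cen i)
      linarith
    calc ‖ℓ x‖ = ‖ℓ (cen i) + ℓ (x - cen i)‖ := by rw [← map_add]; congr 2; abel
      _ ≤ _ := (norm_add_le _ _).trans (add_le_add h2 h3)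
  obtain ⟨C, B, m, S, hC1, hC2, hC3, hC4, hC5⟩ := base_complex hE (R := R0 + 2) (fun i => (hLG i).monic) (fun i => (hLG i).deg)
    (fun i => (hLG i).an) (fun i b hb y hy => ((hLG i).bd b hb y hy).le) (by linarith) hαlf hv2 hv3 hw3 hbb
  have hlc := lift_const C S (fun c => PiB (fun i => P (cen i)) (R0 + 2) (B c)) (fun c => 2 + ∑ i ∈ B c, n (cen i)) m
    (fun c b _ => PiB_monic (fun i _ => (hLG i).monic b)) 
    (fun c b _ => PiB_deg (fun i _ => (hLG i).monic b) (fun i _ => (hLG i).deg b))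
    (fun c i b hb => (PiB_an (fun j hj i => (hLG j).an i b (hC3 c j hj hb)) i).continuousAt.continuousWithinAt) hC4 hC5
  have hSb : ∀ a, ∀ x ∈ K a, x.1 ∈ Sb := fun a x hx => subset_closure (mem_iUnion.mpr ⟨a, x, hx, rfl⟩)
  have hdvd : ∀ c, ∀ i ∈ B c, ∀ b (G : ℝ[X]), G ∣ P (cen i) b → G ∣ PiB (fun i => P (cen i)) (R0 + 2) (B c) b :=
    fun c i hi b G hG => hG.trans ((Finset.dvd_prod_of_mem (fun i => P (cen i) b) hi).trans (dvd_mul_left _ _))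
  -- main local fact
  have key : ∀ a (p : S.ix), (S.lift.cl p ∩ K a).Nonempty → S.lift.cl p ⊆ Metric.cthickening (δ a) (K a) ∧
      ∃ (G : E → ℝ[X]), ((∀ x ∈ S.op p, (G x.1).eval x.2 = 0) ∨ (∀ x ∈ S.op p, (G x.1).eval x.2 ≠ 0)) ∧ 
        ∀ b ∈ C.cl p.1.1, ∀ y, ((b, y) ∈ Metric.cthickening (δ a) (K a) → F a (b, y) = 0 → (G b).eval y = 0) ∧
        ((G b).eval y = 0 → F a (b, y) = 0) := by
    rintro a p ⟨x1, hx1, hx1K⟩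
    have hx1b : x1.1 ∈ C.cl p.1.1 := hx1.1
    obtain ⟨i, hi⟩ := mem_iUnion.mp (hw1 (hSb a x1 hx1K))
    have hiB : i ∈ B p.1.1 := hC2 _ i _ hx1b (subset_closure hi)
    have hcb := hC3 _ i hiB
    rcases (hLG i).fam a with h0 | ⟨h1, ⟨T, hT1, hT2⟩, G, d, hG1, hG2, hG3, hG4, hG5⟩
    · exact absurd (hcb hx1b) (h0 x1 hx1K)
    have hlev : ∀ t ∈ T, (∀ x ∈ S.op p, x.2 - t = 0) ∨ (∀ x ∈ S.op p, x.2 - t ≠ 0) := by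
      intro t ht
      have := hlc p (G := fun _ => X - Polynomial.C t) (d := 1) (fun _ _ => monic_X_sub_C t) (fun _ _ => natDegree_X_sub_C t)
        (fun _ => continuousOn_const) (fun b _ => hdvd _ i hiB b _ (hT1 t ht b))
      simpa only [eval_sub, eval_X, eval_C] using this
    have hconn : IsPreconnected (S.op p) := S.lift.conn p
    have hcls : S.lift.cl p ⊆ closure (S.op p) := S.lift.cl_sub_closure p
    obtain ⟨⟨t1, ht1, ht1a, ht1b⟩, ⟨t2, ht2, ht2a, ht2b⟩⟩ := hT2 x1.2 (hR0 a x1 hx1K)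
    constructor
    · intro x hx
      refine Metric.mem_cthickening_of_dist_le x x1 _ _ hx1K ?_
      have h2 := level_sep_le hconn (hlev t1 ht1) (hcls hx1) ht1a x (hcls hx)
      have h3 := level_sep_ge hconn (hlev t2 ht2) (hcls hx1) ht2a x (hcls hx)
      rw [Prod.dist_eq]
      refine max_le ?_ ?_
      · have h4 := Metric.mem_ball.mp (hcb hx1b)
        have h5 := Metric.mem_ball.mp (hcb hx.1)
        have h6 := dist_triangle_right x.1 x1.1 (cen i)
        have := hδ a
        linarith
      · rw [Real.dist_eq, abs_le]
        have := hδ a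
        constructor <;> linarith
    · refine ⟨G, ?_, fun b hb => hG5 b (hcb hb)⟩
      exact hlc p (d := d) (fun b _ => hG1 b) (fun b _ => hG2 b)
        (fun i => (hG3 i).continuousOn.mono ((C.op_sub _).trans hcb)) (fun b _ => hdvd _ i hiB b _ (hG4 b))
  refine ⟨S.lift, ?_, ?_, ?_⟩
  · intro a x hx
    obtain ⟨i, hi⟩ := mem_iUnion.mp (hw1 (hSb a x hx))
    obtain ⟨c0, hc0⟩ := mem_iUnion.mp (hC1 i (subset_closure hi))
    obtain ⟨c, hc⟩ := C.cover c0 _ hc0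
    obtain ⟨j1, hj1, hj1'⟩ := (hC5 c x.1 hc (-(R0 + 2))).mp (by rw [PiB_root]; exact Or.inl (Or.inr rfl))
    obtain ⟨j2, hj2, hj2'⟩ := (hC5 c x.1 hc (R0 + 2)).mp (by rw [PiB_root]; exact Or.inl (Or.inl rfl))
    have h3 := abs_le.mp (hR0 a x hx)
    obtain ⟨p, -, hp⟩ := S.loc c hc (y := x.2) (j1 := j1) (j2 := j2) (by rw [hj1']; linarith) (by rw [hj2']; linarith) hj1 hj2
    exact mem_iUnion.mpr ⟨p, S.lift.op_sub p hp⟩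
  · intro a p hp
    exact ((key a p hp).1.trans (hδΩ a)).trans (fun x hx => hx.1.1)
  · rintro a p ⟨x1, hx1, hx1K⟩
    obtain ⟨h1, G, hG, hG2⟩ := key a p ⟨x1, S.lift.op_sub p hx1, hx1K⟩
    have hm : ∀ x ∈ S.op p, x.1 ∈ C.cl p.1.1 := fun x hx => C.op_sub _ hx.1
    refine hG.imp ?_ ?_
    · intro h x hx
      exact (hG2 x.1 (hm x hx) x.2).2 (h x hx)
    · intro h x hx h0
      exact h x hx ((hG2 x.1 (hm x hx) x.2).1 (h1 (S.lift.op_sub p hx)) h0)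
end
end Piece11

section Piece12
open unitInterval Topology Set Filter Polynomial

section
variable {E : Type} [NormedAddCommGroup E] [NormedSpace ℝ E]

theorem piece_antilip {G : Type} [NormedAddCommGroup G] [NormedSpace ℝ G] {h : E × ℝ → G} {q : E × ℝ}
    {h' : E × ℝ →L[ℝ] G} (hh : HasStrictFDerivAt h h' q) (hne : ∃ e : E, h' (e, 0) ≠ 0) :
    ∃ (lam : E →L[ℝ] ℝ), lam ≠ 0 ∧ ∃ p : E →L[ℝ] LinearMap.ker (lam : E →ₗ[ℝ] ℝ), ∃ O : Set (E × ℝ), IsOpen O ∧ q ∈ O ∧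
      ∀ s x x', (x, s) ∈ O → (x', s) ∈ O → h (x, s) = 0 → h (x', s) = 0 → ‖x - x'‖ ≤ 2 * ‖p x - p x'‖ := by
  obtain ⟨e, he⟩ := hne
  obtain ⟨ψ, -, hψ⟩ := exists_dual_vector ℝ (h' (e, 0)) (norm_ne_zero_iff.mpr he)
  have hψ0 : ψ (h' (e, 0)) ≠ 0 := by rw [hψ]; simpa using he
  let lam : E →L[ℝ] ℝ := (ψ.comp h').comp (ContinuousLinearMap.inl ℝ E ℝ)
  have hlam : ∀ x, lam x = ψ (h' (x, 0)) := fun x => rfl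
  let e1 : E := (lam e)⁻¹ • e
  have he1 : lam e1 = 1 := by
    simp only [e1, map_smul, smul_eq_mul]; exact inv_mul_cancel₀ hψ0
  let p0 : E →L[ℝ] E := ContinuousLinearMap.id ℝ E - lam.smulRight e1
  have hp0 : ∀ x, p0 x = x - lam x • e1 := fun x => rfl
  let p : E →L[ℝ] LinearMap.ker (lam : E →ₗ[ℝ] ℝ) := p0.codRestrict _ (fun x => by
    rw [LinearMap.mem_ker, hp0]
    simp only [ContinuousLinearMap.coe_coe, map_sub, map_smul, he1, smul_eq_mul, mul_one, sub_self])
  have hpn : ∀ x, ‖p x‖ = ‖x - lam x • e1‖ := fun x => rfl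
  refine ⟨lam, fun h0 => hψ0 (by rw [← hlam, h0]; rfl), p, ?_⟩
  have hs : HasStrictFDerivAt (fun z => ψ (h z)) (ψ.comp h') q := ψ.hasStrictFDerivAt.comp q hh
  let c : NNReal := 1 / (2 * (‖e1‖₊ + 1))
  have hc0 : 0 < c := by positivity
  obtain ⟨s, hsq, happ⟩ := hs.approximates_deriv_on_nhds (c := c) (Or.inr hc0)
  obtain ⟨O, hOs, hO, hqO⟩ := mem_nhds_iff.mp hsq
  refine ⟨O, hO, hqO, ?_⟩
  intro t x x' hx hx' h0 h0'
  have h1 := happ (x, t) (hOs hx) (x', t) (hOs hx')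
  have h2 : (x, t) - (x', t) = (x - x', (0:ℝ)) := by simp
  rw [h2] at h1
  have h3 : ‖(x - x', (0:ℝ))‖ = ‖x - x'‖ := by simp [Prod.norm_def]
  simp only [h0, h0', map_zero, sub_self, zero_sub, norm_neg, h3] at h1
  have h4 : ‖lam (x - x')‖ ≤ c * ‖x - x'‖ := h1
  rw [← map_sub, hpn]
  have h5 : ‖x - x'‖ ≤ ‖(x - x') - lam (x - x') • e1‖ + ‖lam (x - x') • e1‖ := by
    simpa using norm_add_le ((x - x') - lam (x - x') • e1) (lam (x - x') • e1)
  rw [norm_smul] at h5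
  have h6 : (c : ℝ) * ‖e1‖ ≤ 1 / 2 := by
    simp only [c, NNReal.coe_div, NNReal.coe_one, NNReal.coe_mul, NNReal.coe_ofNat, NNReal.coe_add, coe_nnnorm]
    rw [div_mul_eq_mul_div, one_mul, div_le_div_iff₀ (by positivity) (by norm_num)]
    linarith
  have h7 : ‖lam (x - x')‖ * ‖e1‖ ≤ 1 / 2 * ‖x - x'‖ := by
    calc ‖lam (x - x')‖ * ‖e1‖ ≤ (c * ‖x - x'‖) * ‖e1‖ := mul_le_mul_of_nonneg_right h4 (norm_nonneg _)
      _ = (c * ‖e1‖) * ‖x - x'‖ := by ring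
      _ ≤ _ := mul_le_mul_of_nonneg_right h6 (norm_nonneg _)
  linarith

/-- polynomial curve without constant term -/
def pc {J : ℕ} (c : Fin J → E) (s : ℝ) : E := ∑ j : Fin J, s ^ (j.1 + 1) • c j

theorem piece_dim [FiniteDimensional ℝ E] {Z : ℝ → Set E} {lam : E →L[ℝ] ℝ} (hlam : lam ≠ 0) 
    (p : E →L[ℝ] LinearMap.ker (lam : E →ₗ[ℝ] ℝ))
    (hp : ∀ s, ∀ x ∈ Z s, ∀ x' ∈ Z s, ‖x - x'‖ ≤ 2 * ‖p x - p x'‖) (J : ℕ) (nd : Fin (J + 1) → ℝ) (hnd : Function.Injective nd) :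
    dimH {c : Fin J → E | ∃ b, ∀ k, b + pc c (nd k) ∈ Z (nd k)} ≤ ((J + 1) * (Module.finrank ℝ E - 1) : ℕ) := by
  classical
  let Zp : Set (Fin (J + 1) → E) := {x | ∀ k, x k ∈ Z (nd k)}
  have h1 : dimH Zp ≤ ((J + 1) * (Module.finrank ℝ E - 1) : ℕ) := by
    let f : Zp → (Fin (J + 1) → LinearMap.ker (lam : E →ₗ[ℝ] ℝ)) := fun x k => p (x.1 k)
    have hf : AntilipschitzWith 2 f := by
      refine AntilipschitzWith.of_le_mul_dist (fun x y => ?_)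
      rw [Subtype.dist_eq, dist_pi_le_iff (by positivity)]
      intro k
      rw [dist_eq_norm]
      refine (hp _ _ (x.2 k) _ (y.2 k)).trans ?_
      rw [← dist_eq_norm]
      exact mul_le_mul_of_nonneg_left (dist_le_pi_dist (f x) (f y) k) (by norm_num)
    have h2 := hf.le_dimH_image univ
    have h3 : dimH (univ : Set Zp) = dimH Zp := by
      have := (isometry_subtype_coe (s := Zp)).dimH_image univ
      rw [image_univ, Subtype.range_coe] at this
      exact this.symm
    rw [← h3]
    refine h2.trans ((dimH_mono (subset_univ _)).trans ?_)
    rw [Real.dimH_univ_eq_finrank, Module.finrank_pi_fintype]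
    have h4 : Module.finrank ℝ (LinearMap.ker (lam : E →ₗ[ℝ] ℝ)) = Module.finrank ℝ E - 1 := by
      have h5 := LinearMap.finrank_range_add_finrank_ker (lam : E →ₗ[ℝ] ℝ)
      have h6 : LinearMap.range (lam : E →ₗ[ℝ] ℝ) = ⊤ := by
        refine LinearMap.range_eq_top.mpr (LinearMap.surjective ?_)
        intro h0; exact hlam (ContinuousLinearMap.coe_injective h0)
      rw [h6, finrank_top, Module.finrank_self] at h5
      omega
    simp only [h4, Finset.sum_const, Finset.card_univ, Fintype.card_fin, smul_eq_mul]
    exact le_rfl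
  let M : Matrix (Fin (J + 1)) (Fin (J + 1)) ℝ := Matrix.vandermonde nd
  have hM : M⁻¹ * M = 1 := Matrix.nonsing_inv_mul _ (isUnit_iff_ne_zero.mpr (Matrix.det_vandermonde_ne_zero_iff.mpr hnd))
  let T : (Fin (J + 1) → E) →ₗ[ℝ] (Fin J → E) := LinearMap.pi (fun j => ∑ k, M⁻¹ j.succ k • LinearMap.proj k)
  have hT : ∀ x j, T x j = ∑ k, M⁻¹ j.succ k • x k := by
    intro x j
    simp only [T, LinearMap.pi_apply, LinearMap.sum_apply, LinearMap.smul_apply, LinearMap.proj_apply]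
  let T' := LinearMap.toContinuousLinearMap T
  refine le_trans ?_ ((T'.lipschitz.dimH_image_le Zp).trans h1)
  refine dimH_mono ?_
  rintro c ⟨b, hb⟩
  refine ⟨fun k => b + pc c (nd k), hb, ?_⟩
  show T _ = c
  ext1 j
  rw [hT]
  have h2 : ∀ k, b + pc c (nd k) = ∑ i : Fin (J + 1), M k i • (Fin.cons b c : Fin (J + 1) → E) i := by
    intro k
    rw [Fin.sum_univ_succ]
    simp [M, Matrix.vandermonde_apply, pc]
  simp only [h2, Finset.smul_sum, smul_smul]
  rw [Finset.sum_comm]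
  simp only [← Finset.sum_smul]
  have h3 : ∀ i, ∑ k, M⁻¹ j.succ k * M k i = if j.succ = i then 1 else 0 := by
    intro i
    have := congrFun (congrFun hM j.succ) i
    rw [Matrix.mul_apply, Matrix.one_apply] at this
    exact this
  simp only [h3, ite_smul, one_smul, zero_smul, Finset.sum_ite_eq, Finset.mem_univ, if_true, Fin.cons_succ]
end
end Piece12

section Piece13
open unitInterval Topology Set Filter Polynomial

section
variable {E : Type} [NormedAddCommGroup E] [NormedSpace ℝ E]

theorem germ_zero_of_iterated {V : Type} [NormedAddCommGroup V] [NormedSpace ℝ V] {F : V → ℝ} {x : V} (hF : AnalyticAt ℝ F x)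
    (h : ∀ d, iteratedFDeriv ℝ d F x = 0) : ∀ᶠ z in 𝓝 x, F z = 0 := by
  obtain ⟨p, r, hp⟩ := hF
  filter_upwards [Metric.eball_mem_nhds x hp.r_pos] with z hz
  have hz' : z - x ∈ Metric.eball (0 : V) r := by
    rw [Metric.mem_eball, edist_eq_enorm_sub] at hz ⊢
    simpa using hz
  have h1 := hp.hasSum hz'
  have h2 : (fun n => p n fun _ => z - x) = fun _ => 0 := by
    ext n
    have h3 := hp.factorial_smul (z - x) n
    rw [h n] at h3
    simp only [ContinuousMultilinearMap.zero_apply, nsmul_eq_mul, mul_eq_zero, Nat.cast_eq_zero] at h3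
    exact h3.resolve_left (Nat.factorial_ne_zero n)
  rw [h2] at h1
  have h4 := h1.unique hasSum_zero
  simpa using h4

theorem pc_differentiable {J : ℕ} (c : Fin J → E) : Differentiable ℝ (pc c) := by
  unfold pc
  fun_prop

theorem bad_local {F : E × ℝ → ℝ} {N : Set (E × ℝ)} (hN : IsOpen N) (hF : AnalyticOnNhd ℝ F N) {J : ℕ} (c : Fin J → E)
    {b : E} {y : ℝ} (hy : (b + pc c y, y) ∈ N) (hg : ¬ ∀ᶠ z in 𝓝 (b + pc c y, y), F z = 0)
    (hbad : ∀ᶠ s in 𝓝 y, F (b + pc c s, s) = 0) :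
    ∃ d s0, (b + pc c s0, s0) ∈ N ∧ (∃ e : E, fderiv ℝ (iteratedFDeriv ℝ d F) (b + pc c s0, s0) (e, 0) ≠ 0) ∧
      ∀ᶠ s in 𝓝 s0, iteratedFDeriv ℝ d F (b + pc c s, s) = 0 := by
  classical
  let Γ : ℝ → E × ℝ := fun s => (b + pc c s, s)
  have hpd := pc_differentiable c
  have hΓ : Differentiable ℝ Γ := ((differentiable_const b).add hpd).prodMk differentiable_id
  have hex : ∃ d, ¬ ∀ᶠ s in 𝓝 y, iteratedFDeriv ℝ d F (Γ s) = 0 := by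
    by_contra hcon
    push Not at hcon
    exact hg (germ_zero_of_iterated (hF _ hy) (fun d => (hcon d).self_of_nhds))
  have hfind := Nat.find_spec hex
  have hmin := fun m => Nat.find_min (H := hex) (m := m)
  generalize Nat.find hex = d0 at hfind hmin
  obtain _ | d := d0
  · exact absurd (hbad.mono (fun s hs => by
      rw [← norm_eq_zero, norm_iteratedFDeriv_zero, hs, norm_zero])) hfind
  have h1 := not_not.mp (hmin d (Nat.lt_succ_self d))
  have h2 : ∀ᶠ s in 𝓝 y, Γ s ∈ N := hΓ.continuous.continuousAt.eventually (hN.mem_nhds hy)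
  obtain ⟨s0, hs0, hs1, hs2⟩ := ((not_eventually.mp hfind).and_eventually (h1.eventually_nhds.and h2)).exists
  refine ⟨d, s0, hs2, ?_, hs1⟩
  by_contra hcon
  push Not at hcon
  apply hs0
  have han := (hF.iteratedFDeriv d) (Γ s0) hs2
  have hd1 := han.differentiableAt.hasFDerivAt.comp_hasDerivAt s0 (hΓ s0).hasDerivAt
  have hd2 : HasDerivAt (iteratedFDeriv ℝ d F ∘ Γ) 0 s0 := by
    refine (hasDerivAt_const s0 (0 : ContinuousMultilinearMap ℝ (fun _ : Fin d => E × ℝ) ℝ)).congr_of_eventuallyEq hs1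
  have hd3 := hd1.unique hd2
  have hd4 : HasDerivAt Γ (deriv (pc c) s0, 1) s0 := ((hpd s0).hasDerivAt.const_add b).prodMk (hasDerivAt_id s0)
  rw [hd4.deriv] at hd3
  rw [← norm_eq_zero, ← norm_fderiv_iteratedFDeriv]
  have h01 : fderiv ℝ (iteratedFDeriv ℝ d F) (Γ s0) (0, 1) = 0 := by
    have e : ((0 : E), (1:ℝ)) = (deriv (pc c) s0, 1) - (deriv (pc c) s0, 0) := by simp
    rw [e, map_sub, hd3, hcon, sub_zero]
  have hz : fderiv ℝ (iteratedFDeriv ℝ d F) (Γ s0) = 0 := by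
   refine ContinuousLinearMap.ext (fun x => ?_)
   have e : x = (x.1, 0) + x.2 • ((0 : E), (1:ℝ)) := by
    ext <;> simp
   rw [e, map_add, map_smul, h01, hcon]
   simp
  rw [hz]
  exact ContinuousLinearMap.opNorm_zero

theorem generic_shear [FiniteDimensional ℝ E] {𝒜 : Type} [Countable 𝒜] {N : 𝒜 → Set (E × ℝ)} {F : 𝒜 → E × ℝ → ℝ}
    (hN : ∀ a, IsOpen (N a)) (hF : ∀ a, AnalyticOnNhd ℝ (F a) (N a)) :
    ∃ (J : ℕ) (c : Fin J → E), ∀ a b y, (b + pc c y, y) ∈ N a → (¬ ∀ᶠ z in 𝓝 (b + pc c y, y), F a z = 0) →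
      ¬ ∀ᶠ s in 𝓝 y, F a (b + pc c s, s) = 0 := by
  classical
  let m := Module.finrank ℝ E
  let Q : 𝒜 × ℕ → Set (E × ℝ) := fun i => {q | q ∈ N i.1 ∧ ∃ e : E, fderiv ℝ (iteratedFDeriv ℝ i.2 (F i.1)) q (e, 0) ≠ 0}
  have hO : ∀ i, ∀ q ∈ Q i, ∃ O : Set (E × ℝ), q ∈ O ∧ IsOpen O ∧ ∃ (lam : E →L[ℝ] ℝ), lam ≠ 0 ∧
      ∃ p : E →L[ℝ] LinearMap.ker (lam : E →ₗ[ℝ] ℝ),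
      ∀ s x x', (x, s) ∈ O → (x', s) ∈ O → iteratedFDeriv ℝ i.2 (F i.1) (x, s) = 0 →
        iteratedFDeriv ℝ i.2 (F i.1) (x', s) = 0 → ‖x - x'‖ ≤ 2 * ‖p x - p x'‖ := by
    intro i q hq
    obtain ⟨lam, hl, p, O, hO1, hO2, hO3⟩ := piece_antilip (((hF i.1).iteratedFDeriv i.2) q hq.1).hasStrictFDerivAt hq.2
    exact ⟨O, hO2, hO1, lam, hl, p, hO3⟩
  choose! O hqO hOo hOd using hO
  have hD : ∀ i, ∃ D ⊆ Q i, D.Countable ∧ Q i ⊆ ⋃ q ∈ D, O i q := fun i =>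
    TopologicalSpace.countable_cover_nhdsWithin (fun q hq => mem_nhdsWithin_of_mem_nhds ((hOo i q hq).mem_nhds (hqO i q hq)))
  choose D hDQ hDc hDcov using hD
  have : ∀ i, Countable (D i) := fun i => (hDc i).to_subtype
  let nd : ℚ × ℕ → Fin (m + 1) → ℝ := fun w k => w.1 + k.1 / ((w.2 : ℝ) + 1)
  have hnd : ∀ w, Function.Injective (nd w) := by
    intro w k k' h
    have h1 : ((w.2 : ℝ) + 1) ≠ 0 := by positivity
    simp only [nd, add_right_inj, div_left_inj' h1, Nat.cast_inj] at h
    exact Fin.ext h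
  let Z : (Σ i, D i) → ℝ → Set E := fun i s => {x | (x, s) ∈ O i.1 i.2 ∧ iteratedFDeriv ℝ i.1.2 (F i.1.1) (x, s) = 0}
  let Bad : (Σ i, D i) × ℚ × ℕ → Set (Fin m → E) := fun w => {c | ∃ b, ∀ k, b + pc c (nd w.2 k) ∈ Z w.1 (nd w.2 k)}
  have hBad : dimH (⋃ w, Bad w) ≤ ((m + 1) * (m - 1) : ℕ) := by
    rw [dimH_iUnion]
    refine iSup_le (fun w => ?_)
    obtain ⟨lam, hl, p, hp⟩ := hOd w.1.1 w.1.2 (hDQ _ w.1.2.2)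
    exact piece_dim hl p (fun s x hx x' hx' => hp s x x' hx.1 hx'.1 hx.2 hx'.2) m (nd w.2) (hnd w.2)
  obtain ⟨c, hc⟩ : ∃ c : Fin m → E, m = 0 ∨ c ∉ ⋃ w, Bad w := by
    by_cases hm : m = 0
    · exact ⟨0, Or.inl hm⟩
    · have h1 : dimH (⋃ w, Bad w) < (Module.finrank ℝ (Fin m → E) : ℕ) := by
        refine hBad.trans_lt ?_
        rw [Module.finrank_pi_fintype, Finset.sum_const, Finset.card_univ, Fintype.card_fin, smul_eq_mul]
        show (((m + 1) * (m - 1) : ℕ) : ENNReal) < ((m * m : ℕ) : ENNReal)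
        rw [Nat.cast_lt]
        obtain ⟨k, hk⟩ := Nat.exists_eq_succ_of_ne_zero hm
        rw [hk]
        simp only [Nat.succ_eq_add_one, Nat.add_sub_cancel]
        ring_nf
        omega
      obtain ⟨c, hc⟩ := (dense_compl_of_dimH_lt_finrank h1).nonempty
      exact ⟨c, Or.inr hc⟩
  refine ⟨m, c, ?_⟩
  intro a b y hy hg hbad
  obtain ⟨d, s0, hs0, ⟨e, he⟩, hs1⟩ := bad_local (hN a) (hF a) c hy hg hbad
  rcases hc with hm | hc
  · have : Subsingleton E := Module.finrank_zero_iff.mp hm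
    rw [Subsingleton.elim e 0] at he
    exact he (map_zero _)
  · apply hc
    have hq : (b + pc c s0, s0) ∈ Q (a, d) := ⟨hs0, e, he⟩
    obtain ⟨q, hq1, hq2⟩ := mem_iUnion₂.mp (hDcov _ hq)
    have hcont : Continuous (fun s => (b + pc c s, s)) := 
      (continuous_const.add (pc_differentiable c).continuous).prodMk continuous_id
    have h1 : ∀ᶠ s in 𝓝 s0, b + pc c s ∈ Z ⟨(a, d), q, hq1⟩ s :=
      (hcont.continuousAt.eventually ((hOo _ _ (hDQ _ hq1)).mem_nhds hq2)).and hs1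
    obtain ⟨ε, hε, hε1⟩ := Metric.eventually_nhds_iff.mp h1
    obtain ⟨u, hu1, hu2⟩ := exists_rat_btwn (show s0 < s0 + ε / 2 by linarith)
    obtain ⟨n, hn⟩ := exists_nat_gt ((m : ℝ) / (ε / 2))
    refine mem_iUnion.mpr ⟨(⟨(a, d), q, hq1⟩, u, n), b, fun k => ?_⟩
    refine hε1 ?_
    have hk : (k.1 : ℝ) ≤ m := by exact_mod_cast Nat.lt_succ_iff.mp k.2
    have h2 : (k.1 : ℝ) / ((n : ℝ) + 1) < ε / 2 := by
      rw [div_lt_iff₀ (by positivity)] at hn ⊢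
      nlinarith
    have h3 : 0 ≤ (k.1 : ℝ) / ((n : ℝ) + 1) := by positivity
    simp only [nd, Real.dist_eq]
    rw [abs_of_pos (by linarith)]
    linarith
end
end Piece13

section Piece14
open unitInterval Topology Set Filter Polynomial

section
variable {E E' : Type} [NormedAddCommGroup E] [NormedSpace ℝ E] [NormedAddCommGroup E'] [NormedSpace ℝ E']

theorem concl_transfer (h : E ≃ₜ E') {𝒜 : Type} {K N : 𝒜 → Set E'} {F : 𝒜 → E' → ℝ}
    (H : ∃ C : RC E, (∀ a, h ⁻¹' K a ⊆ ⋃ c, C.cl c) ∧ (∀ a c, (C.cl c ∩ h ⁻¹' K a).Nonempty → C.cl c ⊆ h ⁻¹' N a) ∧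
      ∀ a c, (C.op c ∩ h ⁻¹' K a).Nonempty → (∀ x ∈ C.op c, F a (h x) = 0) ∨ (∀ x ∈ C.op c, F a (h x) ≠ 0)) :
    ∃ C : RC E', (∀ a, K a ⊆ ⋃ c, C.cl c) ∧ (∀ a c, (C.cl c ∩ K a).Nonempty → C.cl c ⊆ N a) ∧
      ∀ a c, (C.op c ∩ K a).Nonempty → (∀ x ∈ C.op c, F a x = 0) ∨ (∀ x ∈ C.op c, F a x ≠ 0) := by
  obtain ⟨C, h1, h2, h3⟩ := H
  refine ⟨C.map h, ?_, ?_, ?_⟩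
  · intro a x hx
    obtain ⟨c, hc⟩ := mem_iUnion.mp (h1 a (show h.symm x ∈ h ⁻¹' K a by simpa using hx))
    exact mem_iUnion.mpr ⟨c, hc⟩
  · rintro a c ⟨x, hx, hxK⟩ z hz
    have := h2 a c ⟨h.symm x, hx, by simpa using hxK⟩ (show h.symm z ∈ C.cl c from hz)
    simpa using this
  · rintro a c ⟨x, hx, hxK⟩
    refine (h3 a c ⟨h.symm x, hx, by simpa using hxK⟩).imp ?_ ?_
    · intro h4 z hz
      simpa using h4 (h.symm z) hz
    · intro h4 z hz
      simpa using h4 (h.symm z) hz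

theorem germ_transfer (h : E ≃ₜ E') {F : E' → ℝ} {x : E} (hx : ¬ ∀ᶠ z in 𝓝 (h x), F z = 0) : ¬ ∀ᶠ z in 𝓝 x, F (h z) = 0 := by
  intro h1
  apply hx
  rw [← h.map_nhds_eq]
  exact h1

theorem Claim.transport {L L' : Type} [NormedAddCommGroup L] [NormedSpace ℝ L] [NormedAddCommGroup L'] [NormedSpace ℝ L']
    {ℓ : E →L[ℝ] L} (hE : Claim E L ℓ) (e : E ≃L[ℝ] E') (ℓ' : E' →L[ℝ] L') (A : L' →L[ℝ] L) (hA : ∀ x, ℓ x = A (ℓ' (e x))) :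
    Claim E' L' ℓ' := by
  intro 𝒜 _ K N F hK hN hKN hF hlf hb hg
  refine concl_transfer e.toHomeomorph ?_
  refine hE 𝒜 (fun a => e.toHomeomorph ⁻¹' K a) (fun a => e.toHomeomorph ⁻¹' N a) (fun a x => F a (e.toHomeomorph x)) 
    (fun a => e.toHomeomorph.isCompact_preimage.mpr (hK a)) (fun a => (hN a).preimage e.continuous) (fun a => preimage_mono (hKN a))
    ?_ (hlf.preimage_continuous e.continuous) ?_ ?_
  · intro a x hx
    exact (hF a (e x) hx).comp' (e.toContinuousLinearMap.analyticAt x)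
  · have h1 := A.lipschitz.isBounded_image hb
    refine h1.subset ?_
    rintro _ ⟨x, hx, rfl⟩
    obtain ⟨a, ha⟩ := mem_iUnion.mp hx
    exact ⟨ℓ' (e x), ⟨e x, mem_iUnion.mpr ⟨a, ha⟩, rfl⟩, (hA x).symm⟩
  · intro a x hx
    exact germ_transfer e.toHomeomorph (hg a _ hx)

/-- the polynomial shear -/
def shear {J : ℕ} (c : Fin J → E) : E × ℝ ≃ₜ E × ℝ where
  toFun x := (x.1 + pc c x.2, x.2)
  invFun x := (x.1 - pc c x.2, x.2)
  left_inv x := by simp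
  right_inv x := by simp
  continuous_toFun := by
    have := (pc_differentiable c).continuous
    fun_prop
  continuous_invFun := by
    have := (pc_differentiable c).continuous
    fun_prop

theorem Claim.step [FiniteDimensional ℝ E] {L : Type} [NormedAddCommGroup L] [NormedSpace ℝ L] 
    {ℓ : E →L[ℝ] L} (hE : Claim E L ℓ) : Claim (E × ℝ) (L × ℝ) (ℓ.prodMap (ContinuousLinearMap.id ℝ ℝ)) := by
  intro 𝒜 _ K N F hK hN hKN hF hlf hb hg
  obtain ⟨J, c, hc⟩ := generic_shear hN hF
  obtain ⟨M0, hM0⟩ := isBounded_iff_forall_norm_le.mp hb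
  let M := max M0 0
  have hM : ∀ a, ∀ x ∈ K a, ‖ℓ x.1‖ ≤ M ∧ |x.2| ≤ M := by
    intro a x hx
    have := hM0 _ ⟨x, mem_iUnion.mpr ⟨a, hx⟩, rfl⟩
    have h2 : ‖(ℓ x.1, x.2)‖ ≤ M0 := this
    rw [Prod.norm_def] at h2
    exact ⟨(le_max_left _ _).trans (h2.trans (le_max_left _ _)), (le_max_right _ _).trans (h2.trans (le_max_left _ _))⟩
  have hpc := (pc_differentiable c).continuous
  refine concl_transfer (shear c) ?_
  refine step_good hE (R0 := M) (fun a => (shear c).isCompact_preimage.mpr (hK a)) (fun a => (hN a).preimage (shear c).continuous)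
    (fun a => preimage_mono (hKN a)) (F := fun a x => F a (shear c x)) ?_ (hlf.preimage_continuous (shear c).continuous)
    (le_max_right _ _) ?_ ?_ ?_
  · intro a x hx
    refine (hF a (shear c x) hx).comp' ?_
    show AnalyticAt ℝ (fun x : E × ℝ => (x.1 + ∑ j : Fin J, x.2 ^ (j.1 + 1) • c j, x.2)) x
    refine AnalyticAt.prod (analyticAt_fst.add ?_) analyticAt_snd
    exact Finset.analyticAt_fun_sum _ (fun j _ => (analyticAt_snd.pow _).smul analyticAt_const)
  · intro a x hx
    exact (hM a _ hx).2
  · obtain ⟨M2, hM2⟩ := (isCompact_Icc (a := -M) (b := M)).exists_bound_of_continuousOn ((ℓ.continuous.comp hpc).continuousOn)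
    refine isBounded_iff_forall_norm_le.mpr ⟨M + M2, ?_⟩
    rintro _ ⟨b, hb, rfl⟩
    obtain ⟨a, x, hx, rfl⟩ := mem_iUnion.mp hb
    have h1 := hM a _ hx
    have h2 := hM2 x.2 (abs_le.mp h1.2)
    have h3 : ‖ℓ (x.1 + pc c x.2)‖ ≤ M := h1.1
    calc ‖ℓ x.1‖ = ‖ℓ (x.1 + pc c x.2) - ℓ (pc c x.2)‖ := by rw [← map_sub, add_sub_cancel_right]
      _ ≤ _ := (norm_sub_le _ _).trans (add_le_add h3 h2)
  · intro a x hx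
    exact hc a x.1 x.2 (hKN a hx) (hg a _ hx)
end
end Piece14

section Piece15
open unitInterval Topology Set Filter Polynomial

/-- the complex of a closed discrete subset of the line -/
noncomputable def lineRC (Δ : Set ℝ) (nx : ℝ → ℝ) (h1 : ∀ d ∈ Δ, d < nx d) (h2 : ∀ d ∈ Δ, nx d ∈ Δ)
    (h3 : ∀ d ∈ Δ, ∀ d' ∈ Δ, d < d' → nx d ≤ d') (h4 : ∀ y, ∃ d ∈ Δ, d ≤ y ∧ y < nx d)
    (h5 : ∀ u v, (Δ ∩ Icc u v).Finite) : RC ℝ where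
  ι := Δ × Bool
  dim c := if c.2 then 1 else 0
  op c := if c.2 then Ioo c.1.1 (nx c.1.1) else {c.1.1}
  cl c := if c.2 then Icc c.1.1 (nx c.1.1) else {c.1.1}
  nrm c x := if c.2 then |2 * x - c.1.1 - nx c.1.1| / (nx c.1.1 - c.1.1) else 0
  th c x s := if c.2 then (c.1.1 + nx c.1.1) / 2 + s * (x - (c.1.1 + nx c.1.1) / 2) else x
  cl_compact := by
    rintro ⟨d, _ | _⟩
    · simp
    · simpa using isCompact_Icc
  op_sub := by
    rintro ⟨d, _ | _⟩
    · simp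
    · simpa using Ioo_subset_Icc_self
  cover := by
    intro c x _
    obtain ⟨d, hd, hd1, hd2⟩ := h4 x
    rcases hd1.eq_or_lt with h | h
    · exact ⟨(⟨d, hd⟩, false), by simp [h]⟩
    · exact ⟨(⟨d, hd⟩, true), by simpa using ⟨h, hd2⟩⟩
  disj := by
    rintro ⟨⟨d, hd⟩, _ | _⟩ ⟨⟨d', hd'⟩, _ | _⟩ x hx hx'
    · simp at hx hx'
      simp [← hx, ← hx']
    · simp at hx hx'
      subst hx
      exact absurd (h3 d' hd' x hd hx'.1) (not_le.mpr hx'.2)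
    · simp at hx hx'
      subst hx'
      exact absurd (h3 d hd x hd' hx.1) (not_le.mpr hx.2)
    · simp at hx hx'
      have : d = d' := by
        rcases lt_trichotomy d d' with h | h | h
        · have := h3 d hd d' hd' h; linarith [hx.2, hx'.1]
        · exact h
        · have := h3 d' hd' d hd h; linarith [hx.1, hx'.2]
      simp [this]
  lf := by
    intro x
    refine ⟨Ioo (x - 1) (x + 1), Ioo_mem_nhds (by linarith) (by linarith), ?_⟩
    obtain ⟨d1, hd1, hd1a, -⟩ := h4 (x - 2)
    have hfin : {d : Δ | d.1 ∈ Δ ∩ Icc d1 (x + 1)}.Finite := (h5 d1 (x + 1)).preimage (Subtype.val_injective.injOn)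
    refine (hfin.prod (finite_univ (α := Bool))).subset ?_
    rintro ⟨⟨d, hd⟩, bb⟩ ⟨z, hz, hz1, hz2⟩
    refine ⟨⟨hd, ?_⟩, mem_univ _⟩
    have hz' : d ≤ z ∧ z ≤ nx d := by
      cases bb
      · simp at hz; subst hz; exact ⟨le_rfl, (h1 _ hd).le⟩
      · simpa using hz
    refine ⟨?_, by show d ≤ x + 1; linarith [hz'.1]⟩
    by_contra hlt
    have := h3 d hd d1 hd1 (not_le.mp hlt)
    linarith [hz'.2]
  front := by
    rintro ⟨⟨d, hd⟩, _ | _⟩ ⟨⟨d', hd'⟩, _ | _⟩ x hx hx'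
    · simp at hx hx' ⊢
      rw [← hx, ← hx']
    · simp at hx hx'
      subst hx
      exact absurd (h3 d' hd' x hd hx'.1) (not_le.mpr hx'.2)
    · simp at hx hx' ⊢
      subst hx'; exact hx
    · simp at hx hx'
      have : d = d' := by
        rcases lt_trichotomy d d' with h | h | h
        · have := h3 d hd d' hd' h; linarith [hx.2, hx'.1]
        · exact h
        · have := h3 d' hd' d hd h; linarith [hx.1, hx'.2]
      simpa [this] using Ioo_subset_Icc_self
  front_dim := by
    rintro ⟨⟨d, hd⟩, _ | _⟩ ⟨⟨d', hd'⟩, _ | _⟩ x hx hx'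
    · simp at hx hx' ⊢
      rw [← hx, ← hx']
    · simp at hx hx'
      subst hx
      exact absurd (h3 d' hd' x hd hx'.1) (not_le.mpr hx'.2)
    · simp
    · simp at hx hx'
      have : d = d' := by
        rcases lt_trichotomy d d' with h | h | h
        · have := h3 d hd d' hd' h; linarith [hx.2, hx'.1]
        · exact h
        · have := h3 d' hd' d hd h; linarith [hx.1, hx'.2]
      simp [this]
  conn := by
    rintro ⟨d, _ | _⟩
    · simpa using isPreconnected_singleton
    · simpa using isPreconnected_Ioo
  lconn := by
    rintro ⟨⟨d, hd⟩, _ | _⟩ x hx V hV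
    · simp at hx
      refine ⟨V, hV, subset_rfl, ?_⟩
      subst hx
      have : V ∩ {x} = {x} := by
        rw [inter_eq_right, singleton_subset_iff]; exact mem_of_mem_nhds hV
      simp [this, isPreconnected_singleton]
    · simp at hx
      obtain ⟨ε, hε, hV'⟩ := Metric.mem_nhds_iff.mp hV
      refine ⟨Metric.ball x ε, Metric.ball_mem_nhds x hε, hV', ?_, ?_⟩
      · have hcl : x ∈ closure (Ioo d (nx d)) := by
          rw [closure_Ioo (h1 d hd).ne]; exact hx
        obtain ⟨z, hz, hz2⟩ := mem_closure_iff.mp hcl _ Metric.isOpen_ball (Metric.mem_ball_self hε)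
        exact ⟨z, hz, by simpa using hz2⟩
      · simpa using ((convex_ball x ε).inter (convex_Ioo d (nx d))).isPreconnected
  nrm_cont := by
    rintro ⟨⟨d, hd⟩, _ | _⟩
    · simpa using continuousOn_const
    · simp only [if_true]; fun_prop
  nrm_nonneg := by
    rintro ⟨⟨d, hd⟩, _ | _⟩ x hx
    · simp
    · simp only [if_true]
      have := h1 d hd
      exact div_nonneg (abs_nonneg _) (by linarith)
  nrm_le := by
    rintro ⟨⟨d, hd⟩, _ | _⟩ x hx
    · simp
    · simp at hx
      simp only [if_true]
      have := h1 d hd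
      rw [div_le_one (by linarith), abs_le]
      constructor <;> linarith [hx.1, hx.2]
  nrm_eq := by
    rintro ⟨⟨d, hd⟩, _ | _⟩ x hx
    · simp at hx; simp [hx]
    · simp at hx
      simp only [if_true, mem_Ioo]
      have := h1 d hd
      rw [div_eq_one_iff_eq (by linarith)]
      constructor
      · intro h
        rcases abs_cases (2 * x - d - nx d) with ⟨h6, _⟩ | ⟨h6, _⟩
        · have : x = nx d := by linarith
          simp [this]
        · have : x = d := by linarith
          simp [this]
      · intro h
        have : x = d ∨ x = nx d := by
          by_contra hcon
          push Not at hcon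
          exact h ⟨lt_of_le_of_ne hx.1 (Ne.symm hcon.1), lt_of_le_of_ne hx.2 hcon.2⟩
        rcases this with rfl | h7
        · rw [abs_of_nonpos] <;> linarith
        · rw [h7, abs_of_nonneg] <;> linarith
  th_cont := by
    rintro ⟨⟨d, hd⟩, _ | _⟩
    · simpa using continuousOn_fst
    · simp only [if_true]; fun_prop
  th_mem := by
    rintro ⟨⟨d, hd⟩, _ | _⟩ x hx s hs hs1
    · simpa using hx
    · simp only [if_true] at hs1 ⊢
      have := h1 d hd
      rw [mul_div_assoc', div_le_one (by linarith), ← abs_of_nonneg (show 0 ≤ s by linarith), ← abs_mul, abs_le] at hs1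
      constructor <;> nlinarith [hs1.1, hs1.2]
  th_nrm := by
    rintro ⟨⟨d, hd⟩, _ | _⟩ x hx s hs hs1
    · simp
    · simp only [if_true] at hs1 ⊢
      have e : 2 * ((d + nx d) / 2 + s * (x - (d + nx d) / 2)) - d - nx d = s * (2 * x - d - nx d) := by ring
      rw [e, abs_mul, abs_of_nonneg (show 0 ≤ s by linarith), mul_div_assoc]
  th_one := by
    rintro ⟨⟨d, hd⟩, _ | _⟩ x hx
    · simp
    · simp
  th_th := by
    rintro ⟨⟨d, hd⟩, _ | _⟩ x hx s s' _ _ _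
    · simp
    · simp only [if_true]; ring
  bdd := ⟨1, fun c => by split_ifs <;> omega⟩

theorem finite_zeros {F : ℝ → ℝ} {K : Set ℝ} (hK : IsCompact K) (hF : ∀ x ∈ K, AnalyticAt ℝ F x) 
    (hg : ∀ x ∈ K, ¬ ∀ᶠ z in 𝓝 x, F z = 0) : {x ∈ K | F x = 0}.Finite := by
  have h1 : ∀ x ∈ K, ∃ U ∈ 𝓝 x, ∀ z ∈ U, F z = 0 → z = x := by
    intro x hx
    have h2 := ((hF x hx).eventually_eq_zero_or_eventually_ne_zero).resolve_left (hg x hx)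
    rw [eventually_nhdsWithin_iff] at h2
    exact ⟨_, h2, fun z hz h0 => by_contra (fun hne => hz hne h0)⟩
  choose! U hU hU2 using h1
  obtain ⟨t, ht, hcov⟩ := hK.elim_nhds_subcover U hU
  refine t.finite_toSet.subset ?_
  rintro x ⟨hx, h0⟩
  obtain ⟨z, hz, hxz⟩ := mem_iUnion₂.mp (hcov hx)
  rw [hU2 z (ht z hz) x hxz h0]
  exact hz

theorem line_complex {Δ : Set ℝ} (h5 : ∀ u v, (Δ ∩ Icc u v).Finite) (hup : ∀ y, ∃ d ∈ Δ, y < d) (hdn : ∀ y, ∃ d ∈ Δ, d ≤ y) :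
    ∃ C : RC ℝ, (∀ y, ∃ c, y ∈ C.cl c) ∧ ∀ c, (∃ d ∈ Δ, C.op c = {d} ∧ C.cl c = {d}) ∨
      ∃ d ∈ Δ, ∃ d' ∈ Δ, d < d' ∧ (∀ e ∈ Δ, e ≤ d ∨ d' ≤ e) ∧ C.op c = Ioo d d' ∧ C.cl c = Icc d d' := by
  have hnx : ∀ y, ∃ d' ∈ Δ, y < d' ∧ ∀ e ∈ Δ, y < e → d' ≤ e := by
    intro y
    obtain ⟨z, hz, hyz⟩ := hup y
    obtain ⟨m, ⟨⟨hm, hm2⟩, hm3⟩, hmin⟩ := Set.exists_min_image ((Δ ∩ Icc y z) ∩ Ioi y) id ((h5 y z).inter_of_left _) ⟨z, ⟨hz, hyz.le, le_rfl⟩, hyz⟩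
    refine ⟨m, hm, hm3, fun e he hye => ?_⟩
    by_cases hez : e ≤ z
    · exact hmin e ⟨⟨he, hye.le, hez⟩, hye⟩
    · exact hm2.2.trans (not_le.mp hez).le
  choose nx hnx1 hnx2 hnx3 using hnx
  have h4 : ∀ y, ∃ d ∈ Δ, d ≤ y ∧ y < nx d := by
    intro y
    obtain ⟨z, hz, hyz⟩ := hdn y
    obtain ⟨m, ⟨hm, hm2⟩, hmax⟩ := Set.exists_max_image (Δ ∩ Icc z y) id (h5 z y) ⟨z, hz, le_rfl, hyz⟩
    refine ⟨m, hm, hm2.2, ?_⟩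
    by_contra hcon
    have := hmax (nx m) ⟨hnx1 m, hm2.1.trans (hnx2 m).le, not_lt.mp hcon⟩
    exact absurd (hnx2 m) (not_lt.mpr this)
  refine ⟨lineRC Δ nx (fun d _ => hnx2 d) (fun d _ => hnx1 d) (fun d _ d' hd' h => hnx3 d d' hd' h) h4 h5, ?_, ?_⟩
  · intro y
    obtain ⟨d, hd, hd1, hd2⟩ := h4 y
    exact ⟨(⟨d, hd⟩, true), by simpa [lineRC] using ⟨hd1, hd2.le⟩⟩
  · rintro ⟨⟨d, hd⟩, _ | _⟩
    · exact Or.inl ⟨d, hd, by simp [lineRC], by simp [lineRC]⟩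
    · refine Or.inr ⟨d, hd, nx d, hnx1 d, hnx2 d, fun e he => ?_, by simp [lineRC], by simp [lineRC]⟩
      rcases le_or_gt e d with h | h
      · exact Or.inl h
      · exact Or.inr (hnx3 d e he h)

theorem Claim.base (L : Type) [NormedAddCommGroup L] [NormedSpace ℝ L] (ℓ : ℝ →L[ℝ] L) : Claim ℝ L ℓ := by
  intro 𝒜 _ K N F hK hN hKN hF hlf _ hg
  let Ω : 𝒜 → Set ℝ := fun a => N a ∩ {x | ¬ ∀ᶠ z in 𝓝 x, F a z = 0}
  have hΩ : ∀ a, IsOpen (Ω a) := by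
    intro a
    rw [isOpen_iff_mem_nhds]
    rintro x ⟨hx, hx2⟩
    have h2 := ((hF a x hx).eventually_eq_zero_or_eventually_ne_zero).resolve_left hx2
    rw [eventually_nhdsWithin_iff] at h2
    filter_upwards [(hN a).mem_nhds hx, h2.eventually_nhds] with z hz hz2
    refine ⟨hz, fun hcon => ?_⟩
    by_cases hzx : z = x
    · subst hzx; exact hx2 hcon
    · have h3 : ∀ᶠ w in 𝓝 z, w ≠ x := isOpen_ne.mem_nhds hzx
      obtain ⟨w, hw1, hw2, hw3⟩ := (hcon.and (h3.and hz2)).exists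
      exact hw3 hw2 hw1
  choose δ0 hδ0 hδΩ0 using fun a => (hK a).exists_cthickening_subset_open (hΩ a) (fun x hx => ⟨hKN a hx, hg a x hx⟩)
  let δ : 𝒜 → ℝ := fun a => min (δ0 a) 1
  have hδ : ∀ a, 0 < δ a := fun a => lt_min (hδ0 a) one_pos
  have hδΩ : ∀ a, Metric.cthickening (δ a) (K a) ⊆ Ω a := fun a => (Metric.cthickening_mono (min_le_left _ _) _).trans (hδΩ0 a)
  have hc : ∀ a, IsCompact (Metric.cthickening (δ a) (K a)) := fun a => (hK a).cthickening
  have hT : ∀ a, ∃ T : Finset ℝ, (∀ t ∈ T, t ∈ Metric.cthickening (δ a) (K a)) ∧ ∀ y ∈ K a, (∃ t ∈ T, y < t ∧ t < y + δ a) ∧ 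
      (∃ t ∈ T, t < y ∧ y - δ a < t) := by
    classical
    intro a
    obtain ⟨R0, hR0⟩ := (hK a).exists_bound_of_continuousOn continuousOn_id
    obtain ⟨T, -, hT⟩ := levels_exist R0 (δ a) (hδ a) (min_le_right _ _)
    refine ⟨T.filter (fun t => t ∈ Metric.cthickening (δ a) (K a)), fun t ht => (Finset.mem_filter.mp ht).2, fun y hy => ?_⟩
    obtain ⟨⟨t1, h1, h1a, h1b⟩, ⟨t2, h2, h2a, h2b⟩⟩ := hT y (hR0 y hy)
    refine ⟨⟨t1, Finset.mem_filter.mpr ⟨h1, ?_⟩, h1a, h1b⟩, ⟨t2, Finset.mem_filter.mpr ⟨h2, ?_⟩, h2a, h2b⟩⟩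
    · refine Metric.mem_cthickening_of_dist_le _ y _ _ hy ?_
      rw [Real.dist_eq, abs_of_pos] <;> linarith
    · refine Metric.mem_cthickening_of_dist_le _ y _ _ hy ?_
      rw [Real.dist_eq, abs_of_neg] <;> linarith
  choose T hT1 hT2 using hT
  let D : 𝒜 → Set ℝ := fun a => {x ∈ Metric.cthickening (δ a) (K a) | F a x = 0} ∪ T a
  have hDfin : ∀ a, (D a).Finite := fun a => (finite_zeros (hc a) (fun x hx => hF a x (hδΩ a hx).1) (fun x hx => (hδΩ a hx).2)).union
    (T a).finite_toSet
  have hDsub : ∀ a, D a ⊆ Metric.cthickening (δ a) (K a) := fun a => union_subset (fun x hx => hx.1) (hT1 a)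
  let Δ : Set ℝ := range (fun n : ℤ => (n : ℝ)) ∪ ⋃ a, D a
  have h5 : ∀ u v, (Δ ∩ Icc u v).Finite := by
    intro u v
    have hA := hlf.finite_nonempty_inter_compact (isCompact_Icc (a := u - 2) (b := v + 2))
    refine (((Set.finite_Icc ⌊u⌋ ⌈v⌉).image (fun n : ℤ => (n : ℝ))).union (hA.biUnion (fun a _ => hDfin a))).subset ?_
    rintro x ⟨⟨n, rfl⟩ | hx, hx1, hx2⟩
    · left
      refine ⟨n, ⟨?_, ?_⟩, rfl⟩
      · exact (Int.cast_le (R := ℝ)).mp ((Int.floor_le u).trans hx1)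
      · exact (Int.cast_le (R := ℝ)).mp (hx2.trans (Int.le_ceil v))
    · right
      obtain ⟨a, ha⟩ := mem_iUnion.mp hx
      refine mem_iUnion₂.mpr ⟨a, ?_, ha⟩
      have h6 := hDsub a ha
      have h7 := Metric.cthickening_subset_thickening' (δ₂ := 2) (by norm_num) (lt_of_le_of_lt (min_le_right _ _) (by norm_num)) (K a) h6
      obtain ⟨z, hz, hzx⟩ := Metric.mem_thickening_iff.mp h7
      rw [Real.dist_eq, abs_lt] at hzx
      exact ⟨z, hz, by constructor <;> linarith [hzx.1, hzx.2]⟩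
  obtain ⟨C, hC1, hC2⟩ := line_complex h5 (fun y => ⟨(⌊y⌋ + 1 : ℤ), Or.inl ⟨_, rfl⟩, by push_cast; exact Int.lt_floor_add_one y⟩)
    (fun y => ⟨(⌊y⌋ : ℤ), Or.inl ⟨_, rfl⟩, Int.floor_le y⟩)
  have hTΔ : ∀ a, ∀ t ∈ T a, t ∈ Δ := fun a t ht => Or.inr (mem_iUnion.mpr ⟨a, Or.inr ht⟩)
  have key : ∀ a c, (C.cl c ∩ K a).Nonempty → C.cl c ⊆ Metric.cthickening (δ a) (K a) := by
    rintro a c ⟨y, hy, hyK⟩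
    rcases hC2 c with ⟨d, hd, -, h2⟩ | ⟨d, hd, d', hd', hdd, hnb, -, h2⟩
    · rw [h2] at hy ⊢
      rw [mem_singleton_iff] at hy
      subst hy
      rw [singleton_subset_iff]
      exact Metric.self_subset_cthickening _ hyK
    · rw [h2] at hy ⊢
      obtain ⟨⟨t1, h1, h1a, h1b⟩, ⟨t2, h2, h2a, h2b⟩⟩ := hT2 a y hyK
      have e1 : d' ≤ t1 := (hnb t1 (hTΔ a t1 h1)).resolve_left (fun h => by linarith [hy.1])
      have e2 : t2 ≤ d := (hnb t2 (hTΔ a t2 h2)).resolve_right (fun h => by linarith [hy.2])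
      intro x hx
      refine Metric.mem_cthickening_of_dist_le _ y _ _ hyK ?_
      rw [Real.dist_eq, abs_le]
      constructor <;> linarith [hx.1, hx.2]
  refine ⟨C, ?_, ?_, ?_⟩
  · intro a x _
    exact mem_iUnion.mpr (hC1 x)
  · exact fun a c h x hx => (hδΩ a (key a c h hx)).1
  · rintro a c ⟨y, hy, hyK⟩
    have hk := key a c ⟨y, C.op_sub c hy, hyK⟩
    rcases hC2 c with ⟨d, hd, h1, -⟩ | ⟨d, hd, d', hd', hdd, hnb, h1, -⟩
    · rw [h1]
      simp only [mem_singleton_iff, forall_eq]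
      exact em _
    · right
      intro x hx h0
      have hxΔ : x ∈ Δ := Or.inr (mem_iUnion.mpr ⟨a, Or.inl ⟨hk (C.op_sub c hx), h0⟩⟩)
      rw [h1] at hx
      rcases hnb x hxΔ with h | h
      · exact absurd hx.1 (not_lt.mpr h)
      · exact absurd hx.2 (not_lt.mpr h)
end Piece15

section Piece16
open unitInterval Topology Set Filter Polynomial

noncomputable def swapEq (V' V : Type) [NormedAddCommGroup V'] [NormedSpace ℝ V'] [NormedAddCommGroup V] [NormedSpace ℝ V]
    [FiniteDimensional ℝ V'] (e : (V' × ℝ) ≃L[ℝ] V) : ((V' × ℝ) × ℝ) ≃L[ℝ] (V × ℝ) :=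
  LinearEquiv.toContinuousLinearEquiv
  { toFun := fun x => (e (x.1.1, x.2), x.1.2)
    invFun := fun y => (((e.symm y.1).1, y.2), (e.symm y.1).2)
    map_add' := fun x y => by
      have h : ((x + y).1.1, (x + y).2) = (x.1.1, x.2) + (y.1.1, y.2) := rfl
      rw [h, map_add]; rfl
    map_smul' := fun c x => by
      have h : ((c • x).1.1, (c • x).2) = c • (x.1.1, x.2) := rfl
      rw [h, map_smul]; rfl
    left_inv := fun x => by simp
    right_inv := fun x => by simp }

theorem claim_all (m : ℕ) : ∀ (V : Type) [NormedAddCommGroup V] [NormedSpace ℝ V] [FiniteDimensional ℝ V],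
    Module.finrank ℝ V = m → Claim (V × ℝ) V (ContinuousLinearMap.fst ℝ V ℝ) := by
  induction m with
  | zero =>
    intro V _ _ _ hm
    have hc : Module.finrank ℝ ℝ = Module.finrank ℝ (V × ℝ) := by
      rw [Module.finrank_prod, hm, zero_add]
    refine (Claim.base V (0 : ℝ →L[ℝ] V)).transport (ContinuousLinearEquiv.ofFinrankEq hc) _ 0 ?_
    intro x; simp
  | succ m ih =>
    intro V _ _ _ hm
    have hc : Module.finrank ℝ ((Fin m → ℝ) × ℝ) = Module.finrank ℝ V := by
      rw [Module.finrank_prod, hm]; simp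
    let e := ContinuousLinearEquiv.ofFinrankEq hc
    have h1 := (ih (Fin m → ℝ) (by simp)).step
    refine h1.transport (swapEq (Fin m → ℝ) V e) _ e.symm.toContinuousLinearMap ?_
    intro x
    have h2 : (swapEq (Fin m → ℝ) V e x).1 = e (x.1.1, x.2) := rfl
    simp [h2]
    rfl
end Piece16

section Piece17
open unitInterval Topology Set Filter Polynomial

theorem exists_cover {V : Type} [MetricSpace V] [ProperSpace V] {Ω : Set V} (hΩ : IsOpen Ω) :
    ∃ (α : Type) (_ : Countable α) (p : α → V) (r : α → ℝ) (v : α → Set V),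
      (∀ k, 0 < r k) ∧ (∀ k, Metric.closedBall (p k) (r k) ⊆ Ω) ∧ (∀ k, IsCompact (v k)) ∧
      (∀ k, v k ⊆ Metric.ball (p k) (r k)) ∧ (Ω ⊆ ⋃ k, v k) ∧
      (∀ x ∈ Ω, ∃ t ∈ 𝓝 x, {k | (Metric.ball (p k) (r k) ∩ t).Nonempty}.Finite) := by
  haveI : LocallyCompactSpace Ω := hΩ.locallyCompactSpace
  haveI : SigmaCompactSpace Ω := inferInstance
  have hB : ∀ x : Ω, (𝓝 x).HasBasis (fun r : ℝ => 0 < r ∧ Metric.closedBall (x : V) r ⊆ Ω) (fun r => Metric.ball x r) := by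
    intro x
    refine Metric.nhds_basis_ball.to_hasBasis' ?_ (fun r hr => Metric.ball_mem_nhds _ hr.1)
    intro ε hε
    obtain ⟨δ, hδ, h⟩ := Metric.nhds_basis_closedBall.mem_iff.mp (hΩ.mem_nhds x.2)
    exact ⟨min ε δ, ⟨lt_min hε hδ, (Metric.closedBall_subset_closedBall (min_le_right _ _)).trans h⟩,
      Metric.ball_subset_ball (min_le_left _ _)⟩
  obtain ⟨α, c, r, hr, hU, hlf⟩ := refinement_of_locallyCompact_sigmaCompact_of_nhds_basis.{0,0} hB
  obtain ⟨w, hw, hwc, hwb⟩ := exists_iUnion_eq_closed_subset (fun i => Metric.isOpen_ball) hlf.point_finite hU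
  have hcount : Countable α := by
    rw [← Set.countable_univ_iff]
    exact hlf.countable_univ (fun i => ⟨c i, Metric.mem_ball_self (hr i).1⟩)
  refine ⟨α, hcount, fun k => c k, r, fun k => Subtype.val '' w k, fun k => (hr k).1, fun k => (hr k).2, ?_, ?_, ?_, ?_⟩
  · intro k
    have h1 : IsCompact (Subtype.val ⁻¹' Metric.closedBall (c k : V) (r k) : Set Ω) := by
      refine Topology.IsInducing.subtypeVal.isCompact_preimage' (isCompact_closedBall _ _) ?_
      rw [Subtype.range_coe]; exact (hr k).2
    refine (h1.of_isClosed_subset (hwc k) ?_).image continuous_subtype_val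
    intro x hx
    exact Metric.ball_subset_closedBall (hwb k hx)
  · rintro k _ ⟨x, hx, rfl⟩
    exact hwb k hx
  · intro x hx
    have : (⟨x, hx⟩ : Ω) ∈ ⋃ k, w k := by rw [hw]; trivial
    obtain ⟨k, hk⟩ := mem_iUnion.mp this
    exact mem_iUnion.mpr ⟨k, ⟨x, hx⟩, hk, rfl⟩
  · intro x hx
    obtain ⟨t, ht, hf⟩ := hlf ⟨x, hx⟩
    refine ⟨Subtype.val '' t, ?_, hf.subset ?_⟩
    · exact hΩ.isOpenMap_subtype_val.image_mem_nhds ht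
    · rintro k ⟨_, hy, z, hz, rfl⟩
      exact ⟨z, hy, hz⟩

theorem HasSDR.transfer {E E' : Type} [TopologicalSpace E] [TopologicalSpace E'] {X A : Set E} (hAX : A ⊆ X)
    {g : E → E'} {s : E' → E} (hg : ContinuousOn g X) (hs : Continuous s) (hsg : ∀ x ∈ X, s (g x) = x)
    (h : HasSDR (g '' X) (g '' A)) : HasSDR X A := by
  obtain ⟨W, H, hAW, ⟨O, hO, rfl⟩, hc, hm, h0, h1, hfix, htr, hend⟩ := h
  have hgs : ∀ q ∈ g '' X, g (s q) = q := by rintro _ ⟨x, hx, rfl⟩; rw [hsg x hx]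
  obtain ⟨O', hO', hO'e⟩ := (continuousOn_iff'.mp hg) O hO
  have hmem : ∀ x ∈ O' ∩ X, g x ∈ O ∩ g '' X := fun x hx => by
    have : x ∈ g ⁻¹' O ∩ X := by rw [hO'e]; exact hx
    exact ⟨this.1, x, hx.2, rfl⟩
  have hmem2 : ∀ q ∈ O ∩ g '' X, s q ∈ O' ∩ X := fun q hq => by
    obtain ⟨hq1, x, hx, rfl⟩ := hq
    rw [hsg x hx, ← hO'e]
    exact ⟨hq1, hx⟩
  have hgA : ∀ x ∈ A, g x ∈ g '' A := fun x hx => ⟨x, hx, rfl⟩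
  refine ⟨O' ∩ X, fun x t => s (H (g x) t), ?_, ⟨O', hO', rfl⟩, ?_, ?_, ?_, ?_, ?_, ?_, ?_⟩
  · intro x hx
    rw [← hO'e]
    exact ⟨(hAW (hgA x hx)).1, hAX hx⟩
  · refine hs.comp_continuousOn (hc.comp (f := fun q : E × ℝ => (g q.1, q.2)) ?_ ?_)
    · exact (hg.comp continuousOn_fst (fun q hq => hq.1.2)).prodMk continuousOn_snd
    · rintro q hq; exact ⟨hmem _ hq.1, hq.2⟩
  · intro x hx t ht
    exact hmem2 _ (hm _ (hmem x hx) t ht)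
  · intro x hx
    show s (H (g x) 0) = x
    rw [h0 _ (hmem x hx), hsg x hx.2]
  · intro x hx
    obtain ⟨a, ha, hae⟩ := h1 _ (hmem x hx)
    show s (H (g x) 1) ∈ A
    rw [← hae, hsg a (hAX ha)]; exact ha
  · intro x hx t ht
    show s (H (g x) t) = x
    rw [hfix _ (hgA x hx) t ht, hsg x (hAX hx)]
  · intro x hx a ha b hb
    obtain ⟨u, hu, hue⟩ := htr _ (hmem x hx) a ha b hb
    refine ⟨u, hu, ?_⟩
    show s (H (g (s (H (g x) a))) b) = s (H (g x) u)
    rw [hgs _ (hm _ (hmem x hx) a ha).2, hue]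
  · intro x hx a ha
    show s (H (g (s (H (g x) a))) 1) = s (H (g x) 1)
    rw [hgs _ (hm _ (hmem x hx) a ha).2, hend _ (hmem x hx) a ha]
end Piece17

section Piece18
open unitInterval Topology Set Filter Polynomial

theorem core_abs {V : Type} [NormedAddCommGroup V] [NormedSpace ℝ V] [FiniteDimensional ℝ V] {Ω : Set V}
    {α : Type} [Countable α] {enc : α → ℕ} (henc : Function.Injective enc) {B v : α → Set V} (hBo : ∀ k, IsOpen (B k)) (hBΩ : ∀ k, B k ⊆ Ω)
    (hBc : ∀ k, IsPreconnected (B k)) (hv : ∀ k, IsCompact (v k)) (hvB : ∀ k, v k ⊆ B k) (hcov : Ω ⊆ ⋃ k, v k)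
    (hlf : ∀ x ∈ Ω, ∃ t ∈ 𝓝 x, {k | (B k ∩ t).Nonempty}.Finite)
    (hJ : ∀ k, {j | (B j ∩ B k).Nonempty}.Finite)
    {P : α → V → ℝ} (hPa : ∀ k x, AnalyticAt ℝ (P k) x) (hP1 : ∀ k, ∀ x ∈ v k, 1 + ‖x‖ + enc k ≤ P k x)
    (hP2 : ∀ k, ∀ x ∉ B k, P k x ≤ 0)
    (f : Bool → V → ℝ) (hf : ∀ b, AnalyticOnNhd ℝ (f b) Ω) :
    HasSDR {x ∈ Ω | f true x = 0} {x ∈ Ω | f true x = 0 ∧ f false x = 0} := by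
  classical
  -- the maximum
  have hmax : ∀ x ∈ Ω, ∃ j, x ∈ B j ∧ ∀ i, P i x ≤ P j x := by
    intro x hx
    obtain ⟨t, ht, hfin⟩ := hlf x hx
    have hfin2 : {k | x ∈ B k}.Finite := hfin.subset (fun k hk => ⟨x, hk, mem_of_mem_nhds ht⟩)
    obtain ⟨k, hk⟩ := mem_iUnion.mp (hcov hx)
    obtain ⟨j, hj, hj2⟩ := hfin2.toFinset.exists_max_image (fun i => P i x) ⟨k, by simpa using hvB k hk⟩
    have hjk : P k x ≤ P j x := hj2 k (by simpa using hvB k hk)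
    refine ⟨j, by simpa using hj, fun i => ?_⟩
    by_cases hi : x ∈ B i
    · exact hj2 i (by simpa using hi)
    · have := hP2 i x hi
      have := hP1 k x hk
      have := norm_nonneg x
      have : (0:ℝ) ≤ enc k := Nat.cast_nonneg _
      linarith
  rcases Ω.eq_empty_or_nonempty with hΩe | hΩn
  · have h1 : {x ∈ Ω | f true x = 0} = {x ∈ Ω | f true x = 0 ∧ f false x = 0} := by
      ext x; simp [hΩe]
    rw [h1]; exact HasSDR.refl _
  haveI : Nonempty α := by
    obtain ⟨x, hx⟩ := hΩn
    exact ⟨(hmax x hx).choose⟩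
  choose! jj hjj hjm using hmax
  let φ : V → ℝ := fun x => P (jj x) x
  have hφP : ∀ x ∈ Ω, ∀ i, P i x ≤ φ x := fun x hx i => hjm x hx i
  have hφ1 : ∀ k, ∀ x ∈ v k, 1 + ‖x‖ + enc k ≤ φ x := fun k x hx => (hP1 k x hx).trans (hφP x (hBΩ k (hvB k hx)) k)
  have hφ2 : ∀ x ∈ Ω, 1 + ‖x‖ ≤ φ x := by
    intro x hx
    obtain ⟨k, hk⟩ := mem_iUnion.mp (hcov hx)
    have := hφ1 k x hk
    have : (0:ℝ) ≤ enc k := Nat.cast_nonneg _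
    linarith
  have hφ0 : ∀ x ∈ Ω, 0 < φ x := fun x hx => by have := hφ2 x hx; have := norm_nonneg x; linarith
  have hPc : ∀ k, Continuous (P k) := fun k => continuous_iff_continuousAt.mpr (fun x => (hPa k x).continuousAt)
  have hφc : ContinuousOn φ Ω := by
    intro x hx
    obtain ⟨t, ht, hfin⟩ := hlf x hx
    have hne : hfin.toFinset.Nonempty := ⟨jj x, by simpa using ⟨x, hjj x hx, mem_of_mem_nhds ht⟩⟩
    have h1 : Continuous (fun y => hfin.toFinset.sup' hne (fun k => P k y)) :=
      Continuous.finset_sup'_apply hne (fun k _ => hPc k)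
    refine (h1.continuousWithinAt (s := Ω) (x := x)).congr_of_eventuallyEq_of_mem ?_ hx
    filter_upwards [self_mem_nhdsWithin, mem_nhdsWithin_of_mem_nhds ht] with y hy hyt
    apply le_antisymm
    · exact Finset.le_sup' (fun k => P k y) (by simpa using ⟨y, hjj y hy, hyt⟩)
    · exact Finset.sup'_le _ _ (fun k _ => hφP y hy k)
  let g : V → V × ℝ := fun x => ((φ x)⁻¹ • x, φ x)
  let s : V × ℝ → V := fun q => q.2 • q.1
  have hsc : Continuous s := continuous_snd.smul continuous_fst
  have hsa : ∀ q, AnalyticAt ℝ s q := fun q => analyticAt_snd.smul analyticAt_fst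
  have hgc : ContinuousOn g Ω := ((hφc.inv₀ (fun x hx => (hφ0 x hx).ne')).smul continuousOn_id).prodMk hφc
  have hsg : ∀ x ∈ Ω, s (g x) = x := fun x hx => smul_inv_smul₀ (hφ0 x hx).ne' x
  have hgs : ∀ q : V × ℝ, s q ∈ Ω → q.2 = φ (s q) → g (s q) = q := by
    rintro ⟨u, h⟩ h1 h2
    have h3 := hφ0 _ h1
    simp only at h2
    show ((φ (s (u, h)))⁻¹ • (h • u), φ (s (u, h))) = (u, h)
    rw [← h2] at h3 ⊢
    rw [inv_smul_smul₀ h3.ne']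
  have hvΩ : ∀ k, v k ⊆ Ω := fun k => (hvB k).trans (hBΩ k)
  let KK : α → Set (V × ℝ) := fun k => g '' v k
  have hKK : ∀ k, IsCompact (KK k) := fun k => (hv k).image_of_continuousOn (hgc.mono (hvΩ k))
  let NN : α → Set (V × ℝ) := fun k => {q | 0 < q.2 ∧ s q ∈ B k}
  have hNN : ∀ k, IsOpen (NN k) := fun k => (isOpen_lt continuous_const continuous_snd).inter ((hBo k).preimage hsc)
  have hKN : ∀ k, KK k ⊆ NN k := by
    rintro k _ ⟨x, hx, rfl⟩
    refine ⟨hφ0 x (hvΩ k hx), ?_⟩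
    rw [hsg x (hvΩ k hx)]; exact hvB k hx
  have hKKlf : ∀ q : V × ℝ, ∃ t ∈ 𝓝 q, {k | (KK k ∩ t).Nonempty}.Finite := by
    intro q
    refine ⟨{q' | q'.2 < q.2 + 1}, (isOpen_lt continuous_snd continuous_const).mem_nhds (by simp), ?_⟩
    obtain ⟨M, hM⟩ := exists_nat_gt (q.2 + 1)
    refine ((Set.finite_lt_nat M).preimage henc.injOn).subset ?_
    rintro k ⟨_, ⟨x, hx, rfl⟩, hx2⟩
    have h1 := hφ1 k x hx
    have h2 : φ x < q.2 + 1 := hx2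
    have := norm_nonneg x
    have h3 : (enc k : ℝ) < M := by linarith
    exact_mod_cast h3
  let S : α → Set (α ⊕ Bool) := fun k => {z | (∃ j, z = Sum.inl j ∧ (B j ∩ B k).Nonempty) ∨ ∃ b, z = Sum.inr b ∧ ¬ ∀ x ∈ B k, f b x = 0}
  have hS : ∀ k, (S k).Finite := by
    intro k
    refine (((hJ k).image Sum.inl).union ((Set.finite_univ (α := Bool)).image Sum.inr)).subset ?_
    rintro z (⟨j, rfl, hj⟩ | ⟨b, rfl, hb⟩)
    · left; exact ⟨j, hj, rfl⟩
    · right; exact ⟨b, trivial, rfl⟩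
  let F : α × (α ⊕ Bool) → V × ℝ → ℝ := fun a q => Sum.elim (fun j => q.2 - P j (s q)) (fun b => f b (s q)) a.2
  let K : α × (α ⊕ Bool) → Set (V × ℝ) := fun a => if a.2 ∈ S a.1 then KK a.1 else ∅
  have hKsub : ∀ a, K a ⊆ KK a.1 := by
    intro a; by_cases h : a.2 ∈ S a.1 <;> simp [K, h]
  have hKeq : ∀ k z, z ∈ S k → K (k, z) = KK k := fun k z hz => by simp [K, hz]
  obtain ⟨C, hC1, hC2, hC3⟩ : ∃ C : RC (V × ℝ), (∀ a, K a ⊆ ⋃ c, C.cl c) ∧ (∀ a c, (C.cl c ∩ K a).Nonempty → C.cl c ⊆ NN a.1) ∧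
      ∀ a c, (C.op c ∩ K a).Nonempty → (∀ x ∈ C.op c, F a x = 0) ∨ (∀ x ∈ C.op c, F a x ≠ 0) := by
    refine claim_all _ V rfl (α × (α ⊕ Bool)) K (fun a => NN a.1) F ?_ (fun a => hNN a.1) (fun a => (hKsub a).trans (hKN a.1)) ?_ ?_ ?_ ?_
    · intro a; by_cases h : a.2 ∈ S a.1 
      · simpa [K, h] using hKK a.1
      · simp [K, h]
    · rintro ⟨k, j | b⟩ q hq
      · exact analyticAt_snd.sub ((hPa j (s q)).comp' (hsa q))
      · exact (hf b (s q) (hBΩ k hq.2)).comp' (hsa q)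
    · intro q
      obtain ⟨t, ht, hfin⟩ := hKKlf q
      refine ⟨t, ht, (hfin.biUnion (t := fun k => (fun z => (k, z)) '' S k) (fun k _ => (hS k).image _)).subset ?_⟩
      rintro ⟨k, z⟩ ⟨q', hq1, hq2⟩
      have hz : z ∈ S k := by
        by_contra h
        simp [K, h] at hq1
      exact mem_iUnion₂.mpr ⟨k, ⟨q', hKsub _ hq1, hq2⟩, z, hz, rfl⟩
    · refine (Metric.isBounded_closedBall (x := (0:V)) (r := 1)).subset ?_
      rintro _ ⟨q, hq, rfl⟩
      obtain ⟨a, ha⟩ := mem_iUnion.mp hq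
      obtain ⟨x, hx, rfl⟩ := hKsub a ha
      rw [mem_closedBall_zero_iff]
      show ‖(φ x)⁻¹ • x‖ ≤ 1
      have h1 := hφ2 x (hvΩ _ hx)
      have h2 := hφ0 x (hvΩ _ hx)
      rw [norm_smul, norm_inv, Real.norm_of_nonneg h2.le, inv_mul_le_iff₀ h2]
      linarith
    · rintro ⟨k, z⟩ q hq hev
      have hz : z ∈ S k := by
        by_contra h
        simp [K, h] at hq
      have hq0 := hKN _ (hKsub _ hq)
      obtain ⟨u, h⟩ := q
      have hh : 0 < h := hq0.1
      rcases hz with ⟨j, rfl, hj⟩ | ⟨b, rfl, hb⟩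
      · have hc : ContinuousAt (fun h' : ℝ => (h'⁻¹ • (h • u), h')) h :=
          ((continuousAt_inv₀ hh.ne').smul continuousAt_const).prodMk continuousAt_id
        have he : (fun h' : ℝ => (h'⁻¹ • (h • u), h')) h = (u, h) := by simp [inv_smul_smul₀ hh.ne']
        have h1 := hc.eventually (p := fun q => F (k, Sum.inl j) q = 0) (by rw [he]; exact hev)
        have h2 : ∀ᶠ h' in 𝓝 h, h' = P j (h • u) := by
          filter_upwards [h1, lt_mem_nhds hh] with h' h3 h4
          have h5 : h' - P j (h' • (h'⁻¹ • (h • u))) = 0 := h3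
          rw [smul_inv_smul₀ h4.ne'] at h5
          linarith
        have h3 := h2.self_of_nhds
        obtain ⟨ε, hε, h4⟩ := Metric.eventually_nhds_iff.mp h2
        have h5 := @h4 (h + ε / 2) (by rw [Real.dist_eq, abs_of_pos] <;> linarith)
        linarith
      · apply hb
        have hc : ContinuousAt (fun x : V => (h⁻¹ • x, h)) (s (u, h)) := by fun_prop
        have he : (fun x : V => (h⁻¹ • x, h)) (s (u, h)) = (u, h) := by simp [s, inv_smul_smul₀ hh.ne']
        have h1 := hc.eventually (p := fun q => F (k, Sum.inr b) q = 0) (by rw [he]; exact hev)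
        have h2 : ∀ᶠ x in 𝓝 (s (u, h)), f b x = 0 := by
          filter_upwards [h1] with x h3
          have h5 : f b (h • (h⁻¹ • x)) = 0 := h3
          rwa [smul_inv_smul₀ hh.ne'] at h5
        exact ((hf b).mono (hBΩ k)).eqOn_zero_of_preconnected_of_eventuallyEq_zero (hBc k) hq0.2 h2
  -- cells
  have hself : ∀ k, ∀ q ∈ KK k, Sum.inl k ∈ S k := fun k q hq => Or.inl ⟨k, rfl, ⟨s q, (hKN k hq).2, (hKN k hq).2⟩⟩
  have hcell : ∀ k c, (C.op c ∩ KK k).Nonempty → ∀ q ∈ C.op c, s q ∈ Ω ∧ q.2 = φ (s q) := by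
    rintro k c ⟨q0, hq0, hq0K⟩
    have hsub : C.op c ⊆ NN k := (C.op_sub c).trans
      (hC2 (k, Sum.inl k) c ⟨q0, C.op_sub c hq0, by rw [hKeq _ _ (hself k q0 hq0K)]; exact hq0K⟩)
    obtain ⟨x0, hx0, rfl⟩ := hq0K
    have hx0Ω := hvΩ k hx0
    have hsx := hsg x0 hx0Ω
    intro q hq
    have hqN := hsub hq
    have hqΩ := hBΩ k hqN.2
    have hd : ∀ j, (B j ∩ B k).Nonempty → (∀ x ∈ C.op c, x.2 - P j (s x) = 0) ∨ (∀ x ∈ C.op c, x.2 - P j (s x) ≠ 0) := by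
      intro j hj
      have hjS : Sum.inl j ∈ S k := Or.inl ⟨j, rfl, hj⟩
      exact hC3 (k, Sum.inl j) c ⟨g x0, hq0, by rw [hKeq _ _ hjS]; exact ⟨x0, hx0, rfl⟩⟩
    have hge : ∀ j, P j (s q) ≤ q.2 := by
      intro j
      by_cases hj : (B j ∩ B k).Nonempty
      · rcases hd j hj with h | h
        · have := h q hq; linarith
        · by_contra hlt
          push Not at hlt
          have h0 : 0 ≤ (g x0).2 - P j (s (g x0)) := by
            rw [hsx]; have := hφP x0 hx0Ω j; simpa [g] using this
          obtain ⟨y, hy, hy0⟩ := (C.conn c).intermediate_value hq hq0 (f := fun x => x.2 - P j (s x))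
            (continuous_snd.sub ((hPc j).comp hsc)).continuousOn (show (0:ℝ) ∈ Icc _ _ from ⟨by linarith, h0⟩)
          exact h y hy hy0
      · have : s q ∉ B j := fun hqj => hj ⟨s q, hqj, hqN.2⟩
        exact (hP2 j _ this).trans hqN.1.le
    refine ⟨hqΩ, le_antisymm ?_ (hge _)⟩
    have h1 : ((B (jj x0)) ∩ B k).Nonempty := ⟨x0, hjj x0 hx0Ω, hvB k hx0⟩
    rcases hd _ h1 with h | h
    · have h2 := h q hq
      have := hφP _ hqΩ (jj x0)
      linarith
    · exfalso
      apply h _ hq0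
      rw [hsx]; simp [g, φ]
  have hcellf : ∀ b k c q0, q0 ∈ C.op c → q0 ∈ KK k → f b (s q0) = 0 → ∀ q ∈ C.op c, f b (s q) = 0 := by
    intro b k c q0 hq0 hq0K h0 q hq
    have hsub : C.op c ⊆ NN k := (C.op_sub c).trans
      (hC2 (k, Sum.inl k) c ⟨q0, C.op_sub c hq0, by rw [hKeq _ _ (hself k q0 hq0K)]; exact hq0K⟩)
    by_cases hb : ∀ x ∈ B k, f b x = 0
    · exact hb _ (hsub hq).2
    · have hbS : Sum.inr b ∈ S k := Or.inr ⟨b, rfl, hb⟩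
      rcases hC3 (k, Sum.inr b) c ⟨q0, hq0, by rw [hKeq _ _ hbS]; exact hq0K⟩ with h | h
      · exact h q hq
      · exact absurd h0 (h q0 hq0)
  have hgK : ∀ x ∈ Ω, ∃ k, g x ∈ KK k := fun x hx => by
    obtain ⟨k, hk⟩ := mem_iUnion.mp (hcov hx)
    exact ⟨k, x, hk, rfl⟩
  have hclosed : ∀ Y : Set V, Y ⊆ Ω → (∀ k, IsClosed (v k ∩ Y)) → IsClosed (g '' Y) := by
    intro Y hY hYc
    have h1 : g '' Y = ⋃ k, g '' (v k ∩ Y) := by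
      rw [← image_iUnion, ← iUnion_inter, inter_eq_right.mpr (hY.trans hcov)]
    rw [h1]
    have h2 : LocallyFinite (fun k => g '' (v k ∩ Y)) := LocallyFinite.subset (f := KK) hKKlf (fun k => image_mono inter_subset_left)
    refine h2.isClosed_iUnion (fun k => ?_)
    exact (((hv k).of_isClosed_subset (hYc k) inter_subset_left).image_of_continuousOn (hgc.mono (inter_subset_left.trans (hvΩ k)))).isClosed
  have hvf : ∀ b k, IsClosed (v k ∩ {x | f b x = 0}) := by
    intro b k
    exact (((hf b).continuousOn.mono (hvΩ k)).preimage_isClosed_of_isClosed (hv k).isClosed isClosed_singleton)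
  refine HasSDR.transfer (g := g) (s := s) (fun x hx => ⟨hx.1, hx.2.1⟩) (hgc.mono (fun x hx => hx.1)) hsc (fun x hx => hsg x hx.1) ?_
  refine C.hasSDR ?_ ?_ (image_mono (fun x hx => ⟨hx.1, hx.2.1⟩)) ?_ ?_ ?_
  · refine hclosed _ (fun x hx => hx.1) (fun k => ?_)
    convert hvf true k using 1
    ext x; constructor
    · rintro ⟨h1, h2, h3⟩; exact ⟨h1, h3⟩
    · rintro ⟨h1, h3⟩; exact ⟨h1, hvΩ k h1, h3⟩
  · refine hclosed _ (fun x hx => hx.1) (fun k => ?_)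
    convert (hvf true k).inter (hvf false k) using 1
    ext x; constructor
    · rintro ⟨h1, h2, h3, h4⟩; exact ⟨⟨h1, h3⟩, h1, h4⟩
    · rintro ⟨⟨h1, h3⟩, _, h4⟩; exact ⟨h1, hvΩ k h1, h3, h4⟩
  · rintro _ ⟨x, hx, rfl⟩
    obtain ⟨k, hk⟩ := hgK x hx.1
    have h1 := hC1 (k, Sum.inl k) (by rw [hKeq _ _ (hself k _ hk)]; exact hk)
    obtain ⟨c, hc⟩ := mem_iUnion.mp h1
    exact C.cover c _ hc
  · rintro c ⟨_, hc, x, hx, rfl⟩ q hq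
    obtain ⟨k, hk⟩ := hgK x hx.1
    obtain ⟨h1, h2⟩ := hcell k c ⟨_, hc, hk⟩ q hq
    have h3 := hcellf true k c _ hc hk (by rw [hsg x hx.1]; exact hx.2) q hq
    exact ⟨s q, ⟨h1, h3⟩, hgs q h1 h2⟩
  · rintro c ⟨_, hc, x, hx, rfl⟩ q hq
    obtain ⟨k, hk⟩ := hgK x hx.1
    obtain ⟨h1, h2⟩ := hcell k c ⟨_, hc, hk⟩ q hq
    have h3 := hcellf true k c _ hc hk (by rw [hsg x hx.1]; exact hx.2.1) q hq
    have h4 := hcellf false k c _ hc hk (by rw [hsg x hx.1]; exact hx.2.2) q hq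
    exact ⟨s q, ⟨h1, h3, h4⟩, hgs q h1 h2⟩
end Piece18

section Piece19
open unitInterval Topology Set Filter Polynomial

theorem core_inner {V : Type} [NormedAddCommGroup V] [InnerProductSpace ℝ V] [FiniteDimensional ℝ V] {Ω : Set V} (hΩ : IsOpen Ω)
    (f : Bool → V → ℝ) (hf : ∀ b, AnalyticOnNhd ℝ (f b) Ω) :
    HasSDR {x ∈ Ω | f true x = 0} {x ∈ Ω | f true x = 0 ∧ f false x = 0} := by
  haveI : ProperSpace V := FiniteDimensional.proper ℝ V
  obtain ⟨α, hα, p, r, v, hr, hrΩ, hv, hvB, hcov, hlf⟩ := exists_cover hΩ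
  obtain ⟨enc, henc⟩ := exists_injective_nat α
  let Q : α → V → ℝ := fun k x => r k ^ 2 - ‖x - p k‖ ^ 2
  have hQc : ∀ k, Continuous (Q k) := fun k => by fun_prop
  have hQ1 : ∀ k, ∃ m > 0, ∀ x ∈ v k, m ≤ Q k x := by
    intro k
    rcases (v k).eq_empty_or_nonempty with he | hne
    · exact ⟨1, one_pos, by simp [he]⟩
    obtain ⟨x, hx, hmin⟩ := (hv k).exists_isMinOn hne (hQc k).continuousOn
    refine ⟨Q k x, ?_, fun y hy => hmin hy⟩
    have := hvB k hx
    rw [mem_ball_iff_norm] at this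
    have := norm_nonneg (x - p k)
    simp only [Q]; nlinarith
  choose m hm hmQ using hQ1
  let b : α → ℝ := fun k => 1 + (‖p k‖ + r k) + enc k
  have hb : ∀ k, 0 ≤ b k := fun k => by have := (hr k).le; positivity
  refine core_abs (enc := enc) henc (B := fun k => Metric.ball (p k) (r k)) (v := v) (fun k => Metric.isOpen_ball)
    (fun k => Metric.ball_subset_closedBall.trans (hrΩ k)) (fun k => (convex_ball _ _).isPreconnected) hv hvB hcov hlf ?_
    (P := fun k x => b k / m k * Q k x) ?_ ?_ ?_ f hf
  · intro k
    suffices h : {j | (Metric.ball (p j) (r j) ∩ Metric.closedBall (p k) (r k)).Nonempty}.Finite from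
      h.subset (fun j hj => hj.mono (inter_subset_inter_right _ Metric.ball_subset_closedBall))
    refine (isCompact_closedBall (p k) (r k)).induction_on (p := fun S => {j | (Metric.ball (p j) (r j) ∩ S).Nonempty}.Finite) ?_ ?_ ?_ ?_
    · simp
    · intro s t hst ht
      exact ht.subset (fun j hj => hj.mono (inter_subset_inter_right _ hst))
    · intro s t hs ht
      refine (hs.union ht).subset ?_
      rintro j ⟨x, hx, hx2 | hx2⟩
      · exact Or.inl ⟨x, hx, hx2⟩
      · exact Or.inr ⟨x, hx, hx2⟩
    · intro x hx
      obtain ⟨t, ht, hfin⟩ := hlf x (hrΩ k hx)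
      exact ⟨t, mem_nhdsWithin_of_mem_nhds ht, hfin⟩
  · intro k x
    have h1 : ContDiff ℝ ⊤ (fun x => b k / m k * Q k x) :=
      contDiff_const.mul (contDiff_const.sub ((contDiff_id.sub contDiff_const).norm_sq ℝ))
    exact h1.contDiffAt.analyticAt
  · intro k x hx
    have h1 := hmQ k x hx
    have h2 := hvB k hx
    rw [mem_ball_iff_norm] at h2
    have h3 : ‖x‖ ≤ ‖p k‖ + ‖x - p k‖ := by
      have := norm_add_le (p k) (x - p k); simpa using this
    have h4 : b k = b k / m k * m k := (div_mul_cancel₀ _ (hm k).ne').symm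
    have h5 : b k / m k * m k ≤ b k / m k * Q k x := mul_le_mul_of_nonneg_left h1 (div_nonneg (hb k) (hm k).le)
    have h6 : 1 + ‖x‖ + enc k ≤ b k := by simp only [b]; linarith
    linarith
  · intro k x hx
    rw [mem_ball_iff_norm, not_lt] at hx
    have := hr k
    exact mul_nonpos_of_nonneg_of_nonpos (div_nonneg (hb k) (hm k).le) (by simp only [Q]; nlinarith)

theorem core {V : Type} [NormedAddCommGroup V] [NormedSpace ℝ V] [FiniteDimensional ℝ V] {Ω : Set V} (hΩ : IsOpen Ω)
    (f1 f2 : V → ℝ) (hf1 : AnalyticOnNhd ℝ f1 Ω) (hf2 : AnalyticOnNhd ℝ f2 Ω) :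
    HasSDR {x ∈ Ω | f1 x = 0} {x ∈ Ω | f1 x = 0 ∧ f2 x = 0} := by
  let e : V ≃L[ℝ] EuclideanSpace ℝ (Fin (Module.finrank ℝ V)) := toEuclidean
  have h := core_inner (hΩ.preimage e.symm.continuous) (fun b x => bif b then f1 (e.symm x) else f2 (e.symm x)) (by
    rintro (_ | _) x hx
    · exact (hf2 _ hx).comp' (e.symm.toContinuousLinearMap.analyticAt x)
    · exact (hf1 _ hx).comp' (e.symm.toContinuousLinearMap.analyticAt x))
  refine HasSDR.transfer (g := e) (s := e.symm) (fun x hx => ⟨hx.1, hx.2.1⟩) e.continuous.continuousOn e.symm.continuous (fun x _ => by simp) ?_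
  have h1 : ∀ S : Set V, e '' S = e.symm ⁻¹' S := fun S => by
    ext x; constructor
    · rintro ⟨y, hy, rfl⟩; simpa using hy
    · intro hx; exact ⟨e.symm x, hx, by simp⟩
  rw [h1, h1]
  exact h
end Piece19

section Piece20
open unitInterval Topology Set Filter Polynomial

theorem lin_data {p n : ℕ} (M : Matrix (Fin p) (Fin n) ℂ) (d : ℕ) (hd : Module.finrank ℂ (LinearMap.ker M.mulVecLin) = d) :
    ∃ (S : Matrix (Fin n) (Fin p) ℂ) (B : Matrix (Fin n) (Fin d) ℂ) (β : Matrix (Fin d) (Fin n) ℂ),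
      S * M + B * β = 1 := by
  let f := M.mulVecLin
  obtain ⟨π, hπ⟩ := LinearMap.exists_leftInverse_of_injective (LinearMap.ker f).subtype (Submodule.ker_subtype _)
  have hπ' : ∀ x : LinearMap.ker f, π x = x := fun x => LinearMap.congr_fun hπ x
  have hinj : LinearMap.ker (f.prod π) = ⊥ := by
    rw [LinearMap.ker_eq_bot']
    intro x hx
    have h1 : f x = 0 := congrArg Prod.fst hx
    have h2 : π x = 0 := congrArg Prod.snd hx
    have h3 := hπ' ⟨x, h1⟩
    have h4 := congrArg Subtype.val h3
    simp only [h2] at h4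
    simpa using h4.symm
  obtain ⟨h, hh⟩ := LinearMap.exists_leftInverse_of_injective (f.prod π) hinj
  have hh' : ∀ x, h (f x, π x) = x := fun x => LinearMap.congr_fun hh x
  let e : LinearMap.ker f ≃ₗ[ℂ] (Fin d → ℂ) := LinearEquiv.ofFinrankEq _ _ (by rw [hd]; simp)
  refine ⟨LinearMap.toMatrix' (h ∘ₗ LinearMap.inl ℂ _ _), LinearMap.toMatrix' ((LinearMap.ker f).subtype ∘ₗ e.symm.toLinearMap),
    LinearMap.toMatrix' (e.toLinearMap ∘ₗ π), ?_⟩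
  apply Matrix.toLin'.injective
  rw [map_add, Matrix.toLin'_mul, Matrix.toLin'_mul, Matrix.toLin'_toMatrix', Matrix.toLin'_toMatrix', Matrix.toLin'_toMatrix', Matrix.toLin'_one]
  ext1 i
  ext1
  simp only [LinearMap.comp_apply, LinearMap.add_apply, LinearMap.id_apply]
  generalize (LinearMap.single ℂ (fun _ : Fin n => ℂ) i) 1 = x
  have h1 : h (0, π x) = π x := by
    have := hh' (π x)
    rwa [hπ', show f (π x) = 0 from (π x).2] at this
  have h2 := hh' x
  have h3 : ((f x, π x) : _ × _) = (f x, 0) + (0, π x) := by simp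
  rw [h3, map_add, h1] at h2
  have h4 : e.symm.toLinearMap (e.toLinearMap (π x)) = π x := e.symm_apply_apply _
  rw [h4]
  exact h2

theorem ker_inj {p n d : ℕ} {M : Matrix (Fin p) (Fin n) ℂ} {S : Matrix (Fin n) (Fin p) ℂ} {B : Matrix (Fin n) (Fin d) ℂ}
    {β : Matrix (Fin d) (Fin n) ℂ} (hT : (S * M + B * β).det ≠ 0) :
    Function.Injective (β.mulVecLin.domRestrict (LinearMap.ker M.mulVecLin)) := by
  rw [← LinearMap.ker_eq_bot, LinearMap.ker_eq_bot']
  rintro ⟨v, hv⟩ hv2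
  have hv' : M.mulVec v = 0 := hv
  have hv2' : β.mulVec v = 0 := hv2
  have h1 : (S * M + B * β).mulVec v = 0 := by
    rw [Matrix.add_mulVec, ← Matrix.mulVec_mulVec, ← Matrix.mulVec_mulVec, hv', hv2']; simp
  have := Matrix.eq_zero_of_mulVec_eq_zero hT h1
  simpa using this

theorem ker_le {p n d : ℕ} {M : Matrix (Fin p) (Fin n) ℂ} {S : Matrix (Fin n) (Fin p) ℂ} {B : Matrix (Fin n) (Fin d) ℂ}
    {β : Matrix (Fin d) (Fin n) ℂ} (hT : (S * M + B * β).det ≠ 0) :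
    Module.finrank ℂ (LinearMap.ker M.mulVecLin) ≤ d := by
  simpa using LinearMap.finrank_le_finrank_of_injective (ker_inj hT)

theorem ker_triv {p n d : ℕ} {M : Matrix (Fin p) (Fin n) ℂ} {S : Matrix (Fin n) (Fin p) ℂ} {B : Matrix (Fin n) (Fin d) ℂ}
    {β : Matrix (Fin d) (Fin n) ℂ} (hT : (S * M + B * β).det ≠ 0) (hd : Module.finrank ℂ (LinearMap.ker M.mulVecLin) = d) :
    (∀ v, M.mulVec v = 0 → (S * M + B * β)⁻¹.mulVec (B.mulVec (β.mulVec v)) = v) ∧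
    (∀ w, M.mulVec ((S * M + B * β)⁻¹.mulVec (B.mulVec w)) = 0 ∧ β.mulVec ((S * M + B * β)⁻¹.mulVec (B.mulVec w)) = w) := by
  have h1 : ∀ v, M.mulVec v = 0 → (S * M + B * β)⁻¹.mulVec (B.mulVec (β.mulVec v)) = v := by
    intro v hv
    have h2 : B.mulVec (β.mulVec v) = (S * M + B * β).mulVec v := by
      rw [Matrix.add_mulVec, ← Matrix.mulVec_mulVec, ← Matrix.mulVec_mulVec, hv]; simp
    rw [h2, Matrix.mulVec_mulVec, Matrix.nonsing_inv_mul _ (isUnit_iff_ne_zero.mpr hT), Matrix.one_mulVec]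
  refine ⟨h1, fun w => ?_⟩
  have hs := (LinearMap.injective_iff_surjective_of_finrank_eq_finrank (by simpa using hd)).mp (ker_inj hT) w
  obtain ⟨⟨v, hv⟩, hv2⟩ := hs
  have hv' : M.mulVec v = 0 := hv
  have hv2' : β.mulVec v = w := hv2
  rw [← hv2', h1 v hv']
  exact ⟨hv', rfl⟩

section
variable {N p n : ℕ} {U : Set (Fin N → ℂ)} {A : (Fin N → ℂ) → Matrix (Fin p) (Fin n) ℂ}

theorem contT {d : ℕ} (hA : ContinuousOn A U) (S : Matrix (Fin n) (Fin p) ℂ) (B : Matrix (Fin n) (Fin d) ℂ)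
    (β : Matrix (Fin d) (Fin n) ℂ) : ContinuousOn (fun z => S * A z + B * β) U := by
  have h : Continuous (fun M : Matrix (Fin p) (Fin n) ℂ => S * M + B * β) := by fun_prop
  exact h.comp_continuousOn hA

theorem part_1a (hU : IsOpen U) (hA : ContinuousOn A U) (i : ℕ) :
    ∃ C : Set (Fin N → ℂ), IsClosed C ∧ {x ∈ U | i ≤ Module.finrank ℂ (LinearMap.ker (A x).mulVecLin)} = C ∩ U := by
  refine ⟨{x ∈ U | Module.finrank ℂ (LinearMap.ker (A x).mulVecLin) < i}ᶜ, ?_, ?_⟩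
  · rw [isClosed_compl_iff, isOpen_iff_mem_nhds]
    rintro z ⟨hzU, hz⟩
    obtain ⟨S, B, β, h⟩ := lin_data (A z) _ rfl
    have hc : ContinuousAt (fun z => (S * A z + B * β).det) z := 
      (continuous_id.matrix_det.comp_continuousOn (contT hA S B β)).continuousAt (hU.mem_nhds hzU)
    have h2 := hc.eventually_ne (y := 0) (by simp [h])
    filter_upwards [h2, hU.mem_nhds hzU] with y hy hyU
    exact ⟨hyU, (ker_le hy).trans_lt hz⟩
  · ext x
    constructor
    · rintro ⟨h1, h2⟩; exact ⟨fun h => absurd h.2 (not_lt.mpr h2), h1⟩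
    · rintro ⟨h1, h2⟩; refine ⟨h2, ?_⟩
      by_contra h; exact h1 ⟨h2, not_le.mp h⟩

theorem part_1c (hU : IsOpen U) (hA : ContinuousOn A U) (i : ℕ) (Y : Set (Fin N → ℂ)) 
    (hY : ∀ z ∈ Y, z ∈ U ∧ Module.finrank ℂ (LinearMap.ker (A z).mulVecLin) = i)
    (L : Set ((Fin N → ℂ) × (Fin n → ℂ))) (hL : L = {q | q.1 ∈ U ∧ (A q.1).mulVec q.2 = 0}) (z₀) (hz₀ : z₀ ∈ Y) : 
      ∃ V : Set (Fin N → ℂ),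
        (∃ W : Set (Fin N → ℂ), IsOpen W ∧ V = W ∩ Y) ∧ z₀ ∈ V ∧
        ∃ φ : (V × (Fin i → ℂ)) ≃ₜ {q ∈ L | q.1 ∈ V},
          (∀ (z : V) (w : Fin i → ℂ),
            ((φ (z, w) : (Fin N → ℂ) × (Fin n → ℂ))).1 = (z : Fin N → ℂ)) ∧
          ∀ z : V,
            IsLinearMap ℂ
              (fun w : Fin i → ℂ => ((φ (z, w) : (Fin N → ℂ) × (Fin n → ℂ))).2) ∧
            Function.Injective
              (fun w : Fin i → ℂ => ((φ (z, w) : (Fin N → ℂ) × (Fin n → ℂ))).2) ∧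
            ∀ v : Fin n → ℂ, (A (z : Fin N → ℂ)).mulVec v = 0 →
              ∃ w : Fin i → ℂ, ((φ (z, w) : (Fin N → ℂ) × (Fin n → ℂ))).2 = v := by
  subst hL
  obtain ⟨S, B, β, h⟩ := lin_data (A z₀) i (hY z₀ hz₀).2
  have hTc := contT hA S B β
  have hdc : ContinuousOn (fun z => (S * A z + B * β).det) U := continuous_id.matrix_det.comp_continuousOn hTc
  have hWo : IsOpen (U ∩ (fun z => (S * A z + B * β).det) ⁻¹' {0}ᶜ) := hdc.isOpen_inter_preimage hU isOpen_compl_singleton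
  set W := U ∩ (fun z => (S * A z + B * β).det) ⁻¹' {0}ᶜ with hW
  have hdet : ∀ z ∈ W ∩ Y, (S * A z + B * β).det ≠ 0 := fun z hz => hz.1.2
  have hk := fun z (hz : z ∈ W ∩ Y) => ker_triv (hdet z hz) (hY z hz.2).2
  refine ⟨W ∩ Y, ⟨W, hWo, rfl⟩, ⟨⟨(hY z₀ hz₀).1, by simp [h]⟩, hz₀⟩, ?_⟩
  have hinv : ContinuousOn (fun z => (S * A z + B * β)⁻¹) (W ∩ Y) := by
    have h1 : ContinuousOn (fun z => ((S * A z + B * β).det)⁻¹ • (S * A z + B * β).adjugate) (W ∩ Y) := by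
      have h2 : ContinuousOn (fun z => ((S * A z + B * β).det)⁻¹) (W ∩ Y) := (hdc.mono (fun z hz => hz.1.1)).inv₀ hdet
      have h3 : ContinuousOn (fun z => (S * A z + B * β).adjugate) (W ∩ Y) :=
        continuous_id.matrix_adjugate.comp_continuousOn (hTc.mono (fun z hz => hz.1.1))
      exact h2.smul h3
    refine h1.congr (fun z hz => ?_)
    simp only [Matrix.inv_def, Ring.inverse_eq_inv']
  refine ⟨{ toFun := fun x => ⟨(x.1, (S * A x.1 + B * β)⁻¹.mulVec (B.mulVec x.2)), ⟨(hY _ x.1.2.2).1, ((hk x.1 x.1.2).2 x.2).1⟩, x.1.2⟩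
            invFun := fun e => (⟨e.1.1, e.2.2⟩, β.mulVec e.1.2)
            left_inv := fun x => Prod.ext rfl ((hk x.1 x.1.2).2 x.2).2
            right_inv := fun e => Subtype.ext (Prod.ext rfl ((hk e.1.1 e.2.2).1 e.1.2 e.2.1.2))
            continuous_toFun := ?_
            continuous_invFun := ?_ }, fun z w => rfl, fun z => ⟨?_, ?_, ?_⟩⟩
  · refine Continuous.subtype_mk ((continuous_subtype_val.comp continuous_fst).prodMk ?_) _
    have h2 : Continuous (fun z : ↑(W ∩ Y) => (S * A z + B * β)⁻¹) := hinv.comp_continuous continuous_subtype_val (fun z => z.2)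
    exact (h2.comp continuous_fst).matrix_mulVec ((continuous_const.matrix_mulVec continuous_snd))
  · refine Continuous.prodMk (Continuous.subtype_mk (continuous_fst.comp continuous_subtype_val) _) ?_
    exact continuous_const.matrix_mulVec (continuous_snd.comp continuous_subtype_val)
  · show IsLinearMap ℂ (fun w => (S * A z + B * β)⁻¹.mulVec (B.mulVec w))
    exact ⟨fun x y => by rw [Matrix.mulVec_add, Matrix.mulVec_add], fun c x => by rw [Matrix.mulVec_smul, Matrix.mulVec_smul]⟩
  · intro x y hxy
    have h1 : (S * A z + B * β)⁻¹.mulVec (B.mulVec x) = (S * A z + B * β)⁻¹.mulVec (B.mulVec y) := hxy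
    rw [← ((hk z z.2).2 x).2, ← ((hk z z.2).2 y).2, h1]
  · intro v hv
    exact ⟨β.mulVec v, (hk z z.2).1 v hv⟩
end
end Piece20

section Piece21
open unitInterval Topology Set Filter Polynomial
open scoped Matrix

def Fib {p n : ℕ} (M : Matrix (Fin p) (Fin n) ℂ) (i : ℕ) (Q : Matrix (Fin n) (Fin n) ℂ) : Prop :=
  Q * Q = Q ∧ Qᴴ = Q ∧ Q.trace = i ∧ M * Q = 0

section
variable {p n : ℕ} {M : Matrix (Fin p) (Fin n) ℂ} {i : ℕ} {Q : Matrix (Fin n) (Fin n) ℂ}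

theorem Fib.exists_of_le (h : i ≤ Module.finrank ℂ (LinearMap.ker M.mulVecLin)) : ∃ Q, Fib M i Q := by
  let e := WithLp.linearEquiv 2 ℂ (Fin n → ℂ)
  let K : Submodule ℂ (EuclideanSpace ℂ (Fin n)) := (LinearMap.ker M.mulVecLin).comap e.toLinearMap
  have hK : Module.finrank ℂ K = Module.finrank ℂ (LinearMap.ker M.mulVecLin) := 
    (e.ofSubmodule' (LinearMap.ker M.mulVecLin)).finrank_eq
  have hle : i ≤ Module.finrank ℂ K := by rw [hK]; exact h
  let b := stdOrthonormalBasis ℂ K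
  let B : Matrix (Fin n) (Fin i) ℂ := fun a j => (b (Fin.castLE hle j) : EuclideanSpace ℂ (Fin n)) a
  have hB : Bᴴ * B = 1 := by
    ext j j'
    rw [Matrix.mul_apply, Matrix.one_apply]
    have h1 := orthonormal_iff_ite.mp b.orthonormal (Fin.castLE hle j) (Fin.castLE hle j')
    rw [Submodule.coe_inner, PiLp.inner_apply] at h1
    simp only [Fin.castLE_inj] at h1
    rw [← h1]
    refine Finset.sum_congr rfl (fun a _ => ?_)
    rw [RCLike.inner_apply, mul_comm, Matrix.conjTranspose_apply]
    rfl
  have hMB : M * B = 0 := by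
    ext a j
    have h1 := (b (Fin.castLE hle j)).2
    have h2 : M.mulVec (fun a => B a j) = 0 := h1
    exact congrFun h2 a
  refine ⟨B * Bᴴ, ?_, ?_, ?_, ?_⟩
  · rw [Matrix.mul_assoc, ← Matrix.mul_assoc Bᴴ, hB, Matrix.one_mul]
  · simp [Matrix.conjTranspose_mul]
  · rw [Matrix.trace_mul_comm, hB]; simp
  · rw [← Matrix.mul_assoc, hMB, Matrix.zero_mul]

theorem Fib.finrank_range (h : Fib M i Q) : Module.finrank ℂ (LinearMap.range Q.mulVecLin) = i := by
  have h1 : LinearMap.IsProj (LinearMap.range Q.mulVecLin) Q.mulVecLin := by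
    refine ⟨fun x => ⟨x, rfl⟩, ?_⟩
    rintro _ ⟨x, rfl⟩
    simp only [Matrix.mulVecLin_apply, Matrix.mulVec_mulVec, h.1]
  have h2 := h1.trace
  have h3 : LinearMap.trace ℂ (Fin n → ℂ) Q.mulVecLin = Q.trace := by
    rw [← Matrix.toLin'_apply']; exact Matrix.trace_toLin'_eq Q
  rw [h3, h.2.2.1] at h2
  exact_mod_cast h2.symm

theorem Fib.range_le (h : Fib M i Q) : LinearMap.range Q.mulVecLin ≤ LinearMap.ker M.mulVecLin := by
  rintro _ ⟨x, rfl⟩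
  show M.mulVec (Q.mulVec x) = 0
  rw [Matrix.mulVec_mulVec, h.2.2.2, Matrix.zero_mulVec]

theorem Fib.le (h : Fib M i Q) : i ≤ Module.finrank ℂ (LinearMap.ker M.mulVecLin) := by
  rw [← h.finrank_range]
  exact Submodule.finrank_mono h.range_le

theorem Fib.fix (h : Fib M i Q) (hd : ¬ i + 1 ≤ Module.finrank ℂ (LinearMap.ker M.mulVecLin)) {v : Fin n → ℂ} (hv : M.mulVec v = 0) :
    Q.mulVec v = v := by
  have h1 := Submodule.eq_of_le_of_finrank_eq h.range_le (by rw [h.finrank_range]; have := h.le; omega)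
  have h2 : v ∈ LinearMap.range Q.mulVecLin := by rw [h1]; exact hv
  obtain ⟨x, rfl⟩ := h2
  simp only [Matrix.mulVecLin_apply, Matrix.mulVec_mulVec, h.1]

theorem Fib.mul_eq (h : Fib M i Q) (hd : ¬ i + 1 ≤ Module.finrank ℂ (LinearMap.ker M.mulVecLin)) {Q' : Matrix (Fin n) (Fin n) ℂ}
    (hv : M * Q' = 0) : Q * Q' = Q' := by
  ext a j
  have h1 : M.mulVec (fun a => Q' a j) = 0 := by
    ext b; exact congrFun (congrFun hv b) j
  exact congrFun (h.fix hd h1) a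

theorem Fib.unique (h : Fib M i Q) (hd : ¬ i + 1 ≤ Module.finrank ℂ (LinearMap.ker M.mulVecLin)) {Q' : Matrix (Fin n) (Fin n) ℂ}
    (h' : Fib M i Q') : Q = Q' := by
  have h1 := h.mul_eq hd h'.2.2.2
  have h2 := h'.mul_eq hd h.2.2.2
  have h3 := congrArg Matrix.conjTranspose h2
  rw [Matrix.conjTranspose_mul, h.2.1, h'.2.1, h1] at h3
  exact h3.symm

open scoped ComplexOrder in
theorem Fib.det_iff (h : Fib M i Q) : (Mᴴ * M + Q).det = 0 ↔ i + 1 ≤ Module.finrank ℂ (LinearMap.ker M.mulVecLin) := by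
  constructor
  · intro hdet
    by_contra hd
    obtain ⟨v, hv, hv2⟩ := Matrix.exists_mulVec_eq_zero_iff.mpr hdet
    apply hv
    have h1 : star (M.mulVec v) ⬝ᵥ (M.mulVec v) + star (Q.mulVec v) ⬝ᵥ (Q.mulVec v) = 0 := by
      have h2 := congrArg (fun x => star v ⬝ᵥ x) hv2
      simp only [Matrix.add_mulVec, dotProduct_add, dotProduct_zero] at h2
      rw [← h2]
      congr 1
      · rw [Matrix.star_mulVec, ← Matrix.dotProduct_mulVec, Matrix.mulVec_mulVec]
      · rw [Matrix.star_mulVec, ← Matrix.dotProduct_mulVec, Matrix.mulVec_mulVec, h.2.1, h.1]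
    have h3 := dotProduct_star_self_nonneg (M.mulVec v)
    have h4 := dotProduct_star_self_nonneg (Q.mulVec v)
    obtain ⟨h5, h6⟩ := (add_eq_zero_iff_of_nonneg h3 h4).mp h1
    have h7 : M.mulVec v = 0 := dotProduct_star_self_eq_zero.mp h5
    have h8 : Q.mulVec v = 0 := dotProduct_star_self_eq_zero.mp h6
    rw [← h.fix hd h7, h8]
  · intro hd
    have h1 : ¬ Function.Injective (Q.mulVecLin.rangeRestrict.domRestrict (LinearMap.ker M.mulVecLin)) := by
      intro hinj
      have := LinearMap.finrank_le_finrank_of_injective hinj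
      rw [h.finrank_range] at this
      omega
    rw [← LinearMap.ker_eq_bot, LinearMap.ker_eq_bot'] at h1
    push Not at h1
    obtain ⟨⟨v, hv⟩, hv2, hv3⟩ := h1
    refine Matrix.exists_mulVec_eq_zero_iff.mp ⟨v, fun h0 => hv3 (Subtype.ext h0), ?_⟩
    have h2 : Q.mulVec v = 0 := congrArg Subtype.val hv2
    have h3 : M.mulVec v = 0 := hv
    rw [Matrix.add_mulVec, h2, ← Matrix.mulVec_mulVec, h3]; simp

theorem Fib.bound (h : Fib M i Q) (a b : Fin n) : ‖Q a b‖ ≤ 1 := by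
  have h1 : Qᴴ * Q = Q := by rw [h.2.1, h.1]
  have h2 : ∀ b, Q b b = ((∑ a, ‖Q a b‖ ^ 2 : ℝ) : ℂ) := by
    intro b
    conv_lhs => rw [← h1]
    rw [Matrix.mul_apply]
    push_cast
    refine Finset.sum_congr rfl (fun a _ => ?_)
    rw [Matrix.conjTranspose_apply]
    exact RCLike.conj_mul _
  have h3 : ∀ a b, ‖Q a b‖ ^ 2 ≤ ∑ a, ‖Q a b‖ ^ 2 := fun a b =>
    Finset.single_le_sum (f := fun a => ‖Q a b‖ ^ 2) (fun _ _ => by positivity) (Finset.mem_univ a)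
  have h4 : ‖Q b b‖ = ∑ a, ‖Q a b‖ ^ 2 := by
    conv_lhs => rw [h2 b]
    rw [Complex.norm_real, Real.norm_of_nonneg (by positivity)]
  have h5 := h3 b b
  have h6 := h3 a b
  rw [← h4] at h5 h6
  have h7 := norm_nonneg (Q b b)
  have h8 : ‖Q b b‖ ≤ 1 := by nlinarith
  nlinarith [norm_nonneg (Q a b)]
end
end Piece21

section Piece22
open unitInterval Topology Set Filter Polynomial
open scoped Matrix

section
variable {N p n : ℕ} {U : Set (Fin N → ℂ)} {A : (Fin N → ℂ) → Matrix (Fin p) (Fin n) ℂ}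

theorem an_normSq {V : Type} [NormedAddCommGroup V] [NormedSpace ℝ V] {h : V → ℂ} {x : V} (hh : AnalyticAt ℝ h x) :
    AnalyticAt ℝ (fun x => Complex.normSq (h x)) x := by
  have h1 : AnalyticAt ℝ (fun x => (h x).re) x := (Complex.reCLM.analyticAt _).comp' hh
  have h2 : AnalyticAt ℝ (fun x => (h x).im) x := (Complex.imCLM.analyticAt _).comp' hh
  simp only [Complex.normSq_apply]
  exact (h1.fun_mul h1).fun_add (h2.fun_mul h2)

theorem an_conj {V : Type} [NormedAddCommGroup V] [NormedSpace ℝ V] {h : V → ℂ} {x : V} (hh : AnalyticAt ℝ h x) :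
    AnalyticAt ℝ (fun x => star (h x)) x :=
  (Complex.conjCLE.toContinuousLinearMap.analyticAt _).comp' hh

theorem an_sum2 {V : Type} [NormedAddCommGroup V] [NormedSpace ℝ V] {a b : ℕ} {h : V → Matrix (Fin a) (Fin b) ℂ} {x : V}
    (hh : ∀ j k, AnalyticAt ℝ (fun x => h x j k) x) : AnalyticAt ℝ (fun x => ∑ j, ∑ k, Complex.normSq (h x j k)) x :=
  Finset.analyticAt_fun_sum _ (fun j _ => Finset.analyticAt_fun_sum _ (fun k _ => an_normSq (hh j k)))

theorem sum2_zero {a b : ℕ} {h : Fin a → Fin b → ℂ} : ∑ j, ∑ k, Complex.normSq (h j k) = 0 ↔ h = 0 := by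
  constructor
  · intro hz
    rw [Finset.sum_eq_zero_iff_of_nonneg (fun j _ => Finset.sum_nonneg (fun k _ => Complex.normSq_nonneg _))] at hz
    funext j k
    have h1 := hz j (Finset.mem_univ _)
    rw [Finset.sum_eq_zero_iff_of_nonneg (fun k _ => Complex.normSq_nonneg _)] at h1
    exact Complex.normSq_eq_zero.mp (h1 k (Finset.mem_univ _))
  · rintro rfl; simp

theorem sum2_nonneg {a b : ℕ} (h : Fin a → Fin b → ℂ) : 0 ≤ ∑ j, ∑ k, Complex.normSq (h j k) :=
  Finset.sum_nonneg (fun j _ => Finset.sum_nonneg (fun k _ => Complex.normSq_nonneg _))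

theorem proj_sdr (hU : IsOpen U) (hA : ∀ (i : Fin p) (j : Fin n), AnalyticOnNhd ℂ (fun x => A x i j) U) (i : ℕ) :
    HasSDR {w : (Fin N → ℂ) × (Fin n → Fin n → ℂ) | w.1 ∈ U ∧ Fib (A w.1) i w.2}
      {w | w.1 ∈ U ∧ Fib (A w.1) i w.2 ∧ i + 1 ≤ Module.finrank ℂ (LinearMap.ker (A w.1).mulVecLin)} ∧
    ∃ f : (Fin N → ℂ) × (Fin n → Fin n → ℂ) → ℝ, ContinuousOn f {w | w.1 ∈ U} ∧ ∀ w, w.1 ∈ U → (Fib (A w.1) i w.2 ↔ f w = 0) := by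
  let V := (Fin N → ℂ) × (Fin n → Fin n → ℂ)
  let Ω : Set V := {w | w.1 ∈ U}
  have hΩ : IsOpen Ω := hU.preimage continuous_fst
  let QQ : V → Matrix (Fin n) (Fin n) ℂ := fun w => w.2
  have hQ : ∀ w a b, AnalyticAt ℝ (fun w : V => QQ w a b) w := by
    intro w a b
    let ev : V →L[ℝ] ℂ := (ContinuousLinearMap.proj (R := ℝ) (φ := fun _ : Fin n => ℂ) b).comp
      ((ContinuousLinearMap.proj (R := ℝ) (φ := fun _ : Fin n => Fin n → ℂ) a).comp (ContinuousLinearMap.snd ℝ _ _))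
    exact ev.analyticAt w
  have hAa : ∀ w ∈ Ω, ∀ a b, AnalyticAt ℝ (fun w : V => A w.1 a b) w := by
    intro w hw a b
    have h1 : AnalyticAt ℝ (fun x => A x a b) w.1 := (hA a b w.1 hw).restrictScalars
    exact h1.comp' analyticAt_fst
  let f1 : V → ℝ := fun w => (∑ j, ∑ k, Complex.normSq ((QQ w * QQ w - QQ w) j k)) + (∑ j, ∑ k, Complex.normSq (((QQ w)ᴴ - QQ w) j k))
    + Complex.normSq ((QQ w).trace - i) + ∑ j, ∑ k, Complex.normSq ((A w.1 * QQ w) j k)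
  let f2 : V → ℝ := fun w => Complex.normSq (((A w.1)ᴴ * A w.1 + QQ w).det)
  have hf1 : AnalyticOnNhd ℝ f1 Ω := by
    intro w hw
    refine AnalyticAt.fun_add (AnalyticAt.fun_add (AnalyticAt.fun_add (an_sum2 ?_) (an_sum2 ?_)) (an_normSq ?_)) (an_sum2 ?_)
    · intro j k
      simp only [Matrix.sub_apply, Matrix.mul_apply]
      exact (Finset.analyticAt_fun_sum _ (fun l _ => (hQ w j l).mul (hQ w l k))).sub (hQ w j k)
    · intro j k
      simp only [Matrix.sub_apply, Matrix.conjTranspose_apply]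
      exact (an_conj (hQ w k j)).sub (hQ w j k)
    · simp only [Matrix.trace, Matrix.diag]
      exact (Finset.analyticAt_fun_sum _ (fun l _ => hQ w l l)).sub analyticAt_const
    · intro j k
      simp only [Matrix.mul_apply]
      exact Finset.analyticAt_fun_sum _ (fun l _ => (hAa w hw j l).mul (hQ w l k))
  have hf2 : AnalyticOnNhd ℝ f2 Ω := by
    intro w hw
    refine an_normSq ?_
    simp only [Matrix.det_apply, Matrix.add_apply, Matrix.mul_apply, Matrix.conjTranspose_apply]
    refine Finset.analyticAt_fun_sum _ (fun τ _ => ?_)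
    have h1 : AnalyticAt ℝ (fun w : V => ∏ x, (∑ l, star (A w.1 l (τ x)) * A w.1 l x + QQ w (τ x) x)) w :=
      Finset.analyticAt_fun_prod _ (fun x _ => (Finset.analyticAt_fun_sum _ (fun l _ => (an_conj (hAa w hw l (τ x))).mul (hAa w hw l x))).add (hQ w _ x))
    simp only [Units.smul_def, zsmul_eq_mul]
    exact analyticAt_const.mul h1
  have hF : ∀ w, Fib (A w.1) i w.2 ↔ f1 w = 0 := by
    intro w
    have h1 := sum2_nonneg (QQ w * QQ w - QQ w)
    have h2 := sum2_nonneg ((QQ w)ᴴ - QQ w)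
    have h3 := Complex.normSq_nonneg ((QQ w).trace - i)
    have h4 := sum2_nonneg (A w.1 * QQ w)
    constructor
    · rintro ⟨h5, h6, h7, h8⟩
      have h5' : QQ w * QQ w - QQ w = 0 := sub_eq_zero.mpr h5
      have h6' : (QQ w)ᴴ - QQ w = 0 := sub_eq_zero.mpr h6
      have h7' : (QQ w).trace - i = 0 := sub_eq_zero.mpr h7
      have h8' : A w.1 * QQ w = 0 := h8
      simp only [f1, h5', h6', h7', h8']
      simp
    · intro h0
      have h0' : (∑ j, ∑ k, Complex.normSq ((QQ w * QQ w - QQ w) j k)) + (∑ j, ∑ k, Complex.normSq (((QQ w)ᴴ - QQ w) j k))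
        + Complex.normSq ((QQ w).trace - i) + ∑ j, ∑ k, Complex.normSq ((A w.1 * QQ w) j k) = 0 := h0
      exact ⟨sub_eq_zero.mp (sum2_zero.mp (by linarith)), sub_eq_zero.mp (sum2_zero.mp (by linarith)),
        sub_eq_zero.mp (Complex.normSq_eq_zero.mp (by linarith)), sum2_zero.mp (by linarith)⟩
  refine ⟨?_, f1, hf1.continuousOn, fun w _ => hF w⟩
  have h := core hΩ f1 f2 hf1 hf2
  have e1 : {w : V | w.1 ∈ U ∧ Fib (A w.1) i w.2} = {x ∈ Ω | f1 x = 0} := by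
    ext w; exact and_congr_right (fun _ => hF w)
  have e2 : {w : V | w.1 ∈ U ∧ Fib (A w.1) i w.2 ∧ i + 1 ≤ Module.finrank ℂ (LinearMap.ker (A w.1).mulVecLin)} = {x ∈ Ω | f1 x = 0 ∧ f2 x = 0} := by
    ext w
    refine and_congr_right (fun _ => ?_)
    rw [← hF w]
    refine and_congr_right (fun h5 => ?_)
    rw [← h5.det_iff]
    exact Complex.normSq_eq_zero.symm
  rw [e1, e2]; exact h
end
end Piece22

section Piece23
open unitInterval Topology Set Filter Polynomial
open scoped Matrix

theorem quot_cont {Z T P : Type*} [TopologicalSpace Z] [TopologicalSpace T] [TopologicalSpace P] {D : Set P} (hD : IsCompact D)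
    {S : Set (Z × P)} (hS : IsClosed S) (hSD : ∀ x ∈ S, x.2 ∈ D) (G : Z × P → T) (hG : ContinuousOn G S) (sec : Z → P)
    (hsec : ∀ z, (z, sec z) ∈ S) (hind : ∀ z a b, (z, a) ∈ S → (z, b) ∈ S → G (z, a) = G (z, b)) :
    Continuous (fun z => G (z, sec z)) := by
  rw [continuous_iff_continuousAt]
  intro z0 O hO
  have h1 : ∀ a ∈ D, ∀ᶠ x in 𝓝 (z0, a), x ∈ S → G x ∈ O := by
    intro a ha
    by_cases h : (z0, a) ∈ S
    · have h2 := hG (z0, a) h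
      rw [ContinuousWithinAt, hind z0 a (sec z0) h (hsec z0)] at h2
      exact eventually_nhdsWithin_iff.mp (h2.eventually_mem hO)
    · filter_upwards [hS.isOpen_compl.mem_nhds h] with x hx hx2
      exact absurd hx2 hx
  have h2 := hD.eventually_forall_of_forall_eventually (P := fun z a => (z, a) ∈ S → G (z, a) ∈ O) h1
  rw [mem_map]
  filter_upwards [h2] with z hz
  exact hz (sec z) (hSD _ (hsec z)) (hsec z)

/-- the nearby projections condition gives injectivity -/
theorem inj_of_close {n : ℕ} {Q Q' : Matrix (Fin n) (Fin n) ℂ} (h : ∀ a b, ‖Q a b - Q' a b‖ < 1 / (n + 1 : ℝ)) {v : Fin n → ℂ}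
    (hv : Q'.mulVec v + v - Q.mulVec v = 0) : v = 0 := by
  have h1 : v = (Q - Q').mulVec v := by
    rw [Matrix.sub_mulVec]
    have : v = v - (Q'.mulVec v + v - Q.mulVec v) := by rw [hv, sub_zero]
    rw [this]
    conv_rhs => rw [← this]
    abel
  have hn : (0:ℝ) < n + 1 := by positivity
  have h2 : ‖v‖ ≤ n / (n + 1 : ℝ) * ‖v‖ := by
    refine (pi_norm_le_iff_of_nonneg (by positivity)).mpr (fun a => ?_)
    conv_lhs => rw [h1]
    have h3 : (Q - Q').mulVec v a = ∑ b, (Q a b - Q' a b) * v b := rfl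
    rw [h3]
    refine (norm_sum_le _ _).trans ?_
    have h4 : ∀ b ∈ (Finset.univ : Finset (Fin n)), ‖(Q a b - Q' a b) * v b‖ ≤ 1 / (n + 1 : ℝ) * ‖v‖ := fun b _ => by
      rw [norm_mul]
      exact mul_le_mul (h a b).le (norm_le_pi_norm v b) (norm_nonneg _) (by positivity)
    refine (Finset.sum_le_card_nsmul _ _ _ h4).trans (le_of_eq ?_)
    simp; ring
  have h3 : (n / (n + 1 : ℝ)) < 1 := by rw [div_lt_one hn]; linarith
  have h4 := norm_nonneg v
  have h5 : ‖v‖ = 0 := by nlinarith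
  exact norm_eq_zero.mp h5
end Piece23

section Piece24
open unitInterval Topology Set Filter Polynomial
open scoped Matrix

theorem HasSDR.shrink {E : Type} [TopologicalSpace E] {X A : Set E} (h : HasSDR X A) {R : Set (E × E)} (hR : IsOpen R) (hd : ∀ x, (x, x) ∈ R) :
    ∃ (W : Set E) (H : E → ℝ → E), A ⊆ W ∧ W ⊆ X ∧ (∀ w ∈ W, ∀ᶠ w' in 𝓝 w, w' ∈ X → w' ∈ W) ∧ 
    ContinuousOn (fun q : E × ℝ => H q.1 q.2) (W ×ˢ Icc 0 1) ∧
    (∀ x ∈ W, ∀ t ∈ Icc (0:ℝ) 1, H x t ∈ W) ∧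
    (∀ x ∈ W, H x 0 = x) ∧ (∀ x ∈ W, H x 1 ∈ A) ∧ (∀ x ∈ A, ∀ t ∈ Icc (0:ℝ) 1, H x t = x) ∧
    (∀ x ∈ W, ∀ s ∈ Icc (0:ℝ) 1, ∀ t ∈ Icc (0:ℝ) 1, (H x s, H x t) ∈ R) := by
  obtain ⟨W, H, hAW, ⟨O, hO, rfl⟩, hc, hm, h0, h1, hfix, htr, hend⟩ := h
  refine ⟨{x ∈ O ∩ X | ∀ s ∈ Icc (0:ℝ) 1, ∀ t ∈ Icc (0:ℝ) 1, (H x s, H x t) ∈ R}, H, ?_, fun x hx => hx.1.2, ?_, 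
    hc.mono (prod_mono (fun x hx => hx.1) subset_rfl), ?_, fun x hx => h0 x hx.1, fun x hx => h1 x hx.1, hfix, fun x hx => hx.2⟩
  · intro x hx
    refine ⟨hAW hx, fun s hs t ht => ?_⟩
    rw [hfix x hx s hs, hfix x hx t ht]; exact hd x
  · rintro w ⟨hw, hw2⟩
    have hK : IsCompact (Icc (0:ℝ) 1 ×ˢ Icc (0:ℝ) 1) := isCompact_Icc.prod isCompact_Icc
    have hcc : ContinuousOn (fun q : E × (ℝ × ℝ) => (H q.1 q.2.1, H q.1 q.2.2)) ((O ∩ X) ×ˢ (Icc (0:ℝ) 1 ×ˢ Icc (0:ℝ) 1)) := by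
      refine ContinuousOn.prodMk (hc.comp (f := fun q : E × (ℝ × ℝ) => (q.1, q.2.1)) ?_ ?_) (hc.comp (f := fun q : E × (ℝ × ℝ) => (q.1, q.2.2)) ?_ ?_)
      · fun_prop
      · intro q hq; exact ⟨hq.1, hq.2.1⟩
      · fun_prop
      · intro q hq; exact ⟨hq.1, hq.2.2⟩
    have h2 : ∀ a ∈ Icc (0:ℝ) 1 ×ˢ Icc (0:ℝ) 1, ∀ᶠ q in 𝓝 (w, a), q.1 ∈ O ∩ X → q.2 ∈ Icc (0:ℝ) 1 ×ˢ Icc (0:ℝ) 1 → (H q.1 q.2.1, H q.1 q.2.2) ∈ R := by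
      intro a ha
      have h3 := hcc (w, a) ⟨hw, ha⟩
      have h4 := eventually_nhdsWithin_iff.mp (h3.eventually_mem (hR.mem_nhds (hw2 a.1 ha.1 a.2 ha.2)))
      filter_upwards [h4] with q hq hq1 hq2
      exact hq ⟨hq1, hq2⟩
    have h3 := hK.eventually_forall_of_forall_eventually 
      (P := fun x a => x ∈ O ∩ X → a ∈ Icc (0:ℝ) 1 ×ˢ Icc (0:ℝ) 1 → (H x a.1, H x a.2) ∈ R) h2
    filter_upwards [h3, hO.mem_nhds hw.1] with w' hw' hwO hwX
    exact ⟨⟨hwO, hwX⟩, fun s hs t ht => hw' (s, t) ⟨hs, ht⟩ ⟨hwO, hwX⟩ ⟨hs, ht⟩⟩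
  · rintro x ⟨hx, hx2⟩ t ht
    refine ⟨hm x hx t ht, fun a ha b hb => ?_⟩
    obtain ⟨u, hu, hue⟩ := htr x hx t ht a ha
    obtain ⟨u', hu', hue'⟩ := htr x hx t ht b hb
    rw [hue, hue']
    exact hx2 u hu u' hu'

section
variable {N p n : ℕ} {U : Set (Fin N → ℂ)} {A : (Fin N → ℂ) → Matrix (Fin p) (Fin n) ℂ}

theorem part_2 (hU : IsOpen U) (hA : ∀ (i : Fin p) (j : Fin n), AnalyticOnNhd ℂ (fun x => A x i j) U) 
    (Xi : ℕ → Set (Fin N → ℂ))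
    (hXi : ∀ i, Xi i = {x ∈ U | i ≤ Module.finrank ℂ (LinearMap.ker (A x).mulVecLin)})
    (L : Set ((Fin N → ℂ) × (Fin n → ℂ)))
    (hL : L = {q | q.1 ∈ U ∧ (A q.1).mulVec q.2 = 0}) (i : ℕ) :
      ∃ (Ui : Set (Fin N → ℂ)) (hUiU : Ui ⊆ U)
        (r : Ui × unitInterval → Ui)
        (ρ : ({q ∈ L | q.1 ∈ Ui} : Set ((Fin N → ℂ) × (Fin n → ℂ))) × unitInterval →
          ({q ∈ L | q.1 ∈ Ui} : Set ((Fin N → ℂ) × (Fin n → ℂ)))),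
        (∃ W : Set (Fin N → ℂ), IsOpen W ∧ Ui = W ∩ Xi i) ∧ Xi (i + 1) ⊆ Ui ∧
        (Continuous r ∧ (∀ z, r (z, 0) = z) ∧ (∀ z, r (z, 1) ∈ {z : Ui | (z : Fin N → ℂ) ∈ Xi (i + 1)}) ∧
          ∀ z ∈ {z : Ui | (z : Fin N → ℂ) ∈ Xi (i + 1)}, ∀ t, r (z, t) = z) ∧
        (Continuous ρ ∧ (∀ z, ρ (z, 0) = z) ∧ (∀ z, ρ (z, 1) ∈ {e : ({q ∈ L | q.1 ∈ Ui} : Set ((Fin N → ℂ) × (Fin n → ℂ))) |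
            (e : (Fin N → ℂ) × (Fin n → ℂ)).1 ∈ Xi (i + 1)}) ∧
          ∀ z ∈ {e : ({q ∈ L | q.1 ∈ Ui} : Set ((Fin N → ℂ) × (Fin n → ℂ))) |
            (e : (Fin N → ℂ) × (Fin n → ℂ)).1 ∈ Xi (i + 1)}, ∀ t, ρ (z, t) = z) ∧
        (∀ (e : ({q ∈ L | q.1 ∈ Ui} : Set ((Fin N → ℂ) × (Fin n → ℂ))))
            (t : unitInterval),
          ((ρ (e, t) : (Fin N → ℂ) × (Fin n → ℂ))).1 =
            (r (⟨(e : (Fin N → ℂ) × (Fin n → ℂ)).1, e.2.2⟩, t) : Fin N → ℂ)) ∧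
        ∀ x : Ui,
          ∃ g : LinearMap.ker (A (x : Fin N → ℂ)).mulVecLin →ₗ[ℂ]
              LinearMap.ker (A ((r (x, 1) : Ui) : Fin N → ℂ)).mulVecLin,
            Function.Injective g ∧
            ∀ v : LinearMap.ker (A (x : Fin N → ℂ)).mulVecLin,
              ((ρ (⟨((x : Fin N → ℂ), (v : Fin n → ℂ)),
                  ⟨hL.symm.subset ⟨hUiU x.2, v.2⟩, x.2⟩⟩, 1) :
                (Fin N → ℂ) × (Fin n → ℂ))).2 = (g v : Fin n → ℂ) := by
  subst hL
  obtain ⟨hsdr, f, hfc, hff⟩ := proj_sdr hU hA i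
  let R : Set (((Fin N → ℂ) × (Fin n → Fin n → ℂ)) × ((Fin N → ℂ) × (Fin n → Fin n → ℂ))) :=
    ⋂ a : Fin n, ⋂ b : Fin n, {x | ‖x.1.2 a b - x.2.2 a b‖ < 1 / (n + 1 : ℝ)}
  have hRo : IsOpen R := isOpen_iInter_of_finite (fun a => isOpen_iInter_of_finite (fun b => isOpen_lt (by fun_prop) continuous_const))
  have hRd : ∀ x, (x, x) ∈ R := fun x => by
    simp only [R, mem_iInter, mem_ofPred_eq, sub_self, norm_zero]
    intro _ _; positivity
  obtain ⟨W, H, hAW, hWX, hWo, hHc, hHm, hH0, hH1, hHfix, hHR⟩ := hsdr.shrink hRo hRd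
  have mXi : ∀ j z, z ∈ Xi j ↔ z ∈ U ∧ j ≤ Module.finrank ℂ (LinearMap.ker (A z).mulVecLin) := fun j z => by rw [hXi]; rfl
  have hmono : Xi (i + 1) ⊆ Xi i := fun z hz => by
    rw [mXi] at hz ⊢; exact ⟨hz.1, by omega⟩
  -- the set of points over `X_{i+1}` is in `W` and fixed
  have hE : ∀ z (Q : Fin n → Fin n → ℂ), z ∈ Xi (i + 1) → Fib (A z) i Q → (z, Q) ∈ W ∧ ∀ t ∈ Icc (0:ℝ) 1, H (z, Q) t = (z, Q) := by
    intro z Q hz hQ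
    rw [mXi] at hz
    have h1 : ((z, Q) : (Fin N → ℂ) × (Fin n → Fin n → ℂ)) ∈ {w : (Fin N → ℂ) × (Fin n → Fin n → ℂ) | w.1 ∈ U ∧ Fib (A w.1) i w.2 ∧ i + 1 ≤ Module.finrank ℂ (LinearMap.ker (A w.1).mulVecLin)} := ⟨hz.1, hQ, hz.2⟩
    exact ⟨hAW h1, fun t ht => hHfix _ h1 t ht⟩
  have huniq : ∀ z (Q Q' : Fin n → Fin n → ℂ), z ∈ U → z ∉ Xi (i + 1) → Fib (A z) i Q → Fib (A z) i Q' → Q = Q' := by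
    intro z Q Q' hzU hz hQ hQ'
    rw [mXi] at hz
    exact hQ.unique (fun h => hz ⟨hzU, h⟩) hQ'
  let Ui : Set (Fin N → ℂ) := {z ∈ Xi i | ∀ Q : Fin n → Fin n → ℂ, Fib (A z) i Q → (z, Q) ∈ W}
  have hUiU : Ui ⊆ U := fun z hz => ((mXi i z).mp hz.1).1
  have hWUi : ∀ w ∈ W, w.1 ∈ Ui := by
    intro w hw
    have h1 := hWX hw
    refine ⟨(mXi i _).mpr ⟨h1.1, h1.2.le⟩, fun Q hQ => ?_⟩
    by_cases hz : w.1 ∈ Xi (i + 1)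
    · exact (hE _ _ hz hQ).1
    · rw [huniq w.1 Q w.2 h1.1 hz hQ h1.2]; exact hw
  have hsec : ∀ z ∈ Ui, ∃ Q : Fin n → Fin n → ℂ, Fib (A z) i Q := fun z hz => Fib.exists_of_le ((mXi i z).mp hz.1).2
  choose! sec hsecF using hsec
  have hsecW : ∀ z ∈ Ui, (z, sec z) ∈ W := fun z hz => hz.2 _ (hsecF z hz)
  let D : Set (Fin n → Fin n → ℂ) := Set.pi univ (fun _ => Set.pi univ (fun _ => Metric.closedBall (0:ℂ) 1))
  have hD : IsCompact D := isCompact_univ_pi (fun _ => isCompact_univ_pi (fun _ => isCompact_closedBall _ _))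
  have hFD : ∀ z (Q : Fin n → Fin n → ℂ), Fib (A z) i Q → Q ∈ D := by
    intro z Q hQ a _ b _
    rw [mem_closedBall_zero_iff]; exact hQ.bound a b
  -- closedness
  have hSc : ∀ (Z : Type) [TopologicalSpace Z] (q : Z → (Fin N → ℂ)), Continuous q → (∀ z, q z ∈ U) →
      IsClosed {x : Z × (Fin n → Fin n → ℂ) | Fib (A (q x.1)) i x.2} := by
    intro Z _ q hq hqU
    have h1 : {x : Z × (Fin n → Fin n → ℂ) | Fib (A (q x.1)) i x.2} = (fun x : Z × (Fin n → Fin n → ℂ) => f (q x.1, x.2)) ⁻¹' {0} := by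
      ext x; exact hff (q x.1, x.2) (hqU _)
    rw [h1]
    refine isClosed_singleton.preimage (hfc.comp_continuous ?_ (fun x => hqU _))
    exact (hq.comp continuous_fst).prodMk continuous_snd
  have hIcc : ∀ t : unitInterval, (t : ℝ) ∈ Icc (0:ℝ) 1 := fun t => t.2
  let r : Ui × unitInterval → Ui := fun x => ⟨(H ((x.1 : Fin N → ℂ), sec x.1) x.2).1, hWUi _ (hHm _ (hsecW _ x.1.2) _ (hIcc _))⟩
  have hHX : ∀ w ∈ W, ∀ t ∈ Icc (0:ℝ) 1, Fib (A (H w t).1) i (H w t).2 := fun w hw t ht => (hWX (hHm w hw t ht)).2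
  -- the fibre map
  let vt : (Fin N → ℂ) → (Fin n → Fin n → ℂ) → (Fin n → ℂ) → ℝ → (Fin n → ℂ) := fun z Q v t =>
    Matrix.mulVec (H (z, Q) t).2 v + v - Matrix.mulVec Q v
  have hvt : ∀ z ∈ Ui, ∀ Q : Fin n → Fin n → ℂ, Fib (A z) i Q → ∀ v, (A z).mulVec v = 0 → ∀ t ∈ Icc (0:ℝ) 1, (A (H (z, Q) t).1).mulVec (vt z Q v t) = 0 := by
    intro z hz Q hQ v hv t ht
    by_cases hz1 : z ∈ Xi (i + 1)
    · simp only [vt, (hE z Q hz1 hQ).2 t ht]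
      rw [add_sub_cancel_left]; exact hv
    · have h1 : Matrix.mulVec Q v = v := hQ.fix (fun h => hz1 ((mXi _ _).mpr ⟨hUiU hz, h⟩)) hv
      simp only [vt]
      rw [h1, add_sub_cancel_right]
      have h2 := (hHX _ (hz.2 Q hQ) t ht).2.2.2
      have h3 : A (H (z, Q) t).1 * (show Matrix (Fin n) (Fin n) ℂ from (H (z, Q) t).2) = 0 := h2
      refine (Matrix.mulVec_mulVec v (A (H (z, Q) t).1) (show Matrix (Fin n) (Fin n) ℂ from (H (z, Q) t).2)).trans ?_
      exact (congrArg (fun M : Matrix (Fin p) (Fin n) ℂ => M.mulVec v) h3).trans (Matrix.zero_mulVec v)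
  let Lu : Set ((Fin N → ℂ) × (Fin n → ℂ)) := {q ∈ {q : (Fin N → ℂ) × (Fin n → ℂ) | q.1 ∈ U ∧ (A q.1).mulVec q.2 = 0} | q.1 ∈ Ui}
  let ρ : Lu × unitInterval → Lu := fun x => ⟨((H (x.1.1.1, sec x.1.1.1) x.2).1, vt x.1.1.1 (sec x.1.1.1) x.1.1.2 x.2),
    ⟨hUiU (hWUi _ (hHm _ (hsecW _ x.1.2.2) _ (hIcc _))), hvt _ x.1.2.2 _ (hsecF _ x.1.2.2) _ x.1.2.1.2 _ (hIcc _)⟩,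
    hWUi _ (hHm _ (hsecW _ x.1.2.2) _ (hIcc _))⟩
  have h1X : ∀ z ∈ Ui, (H (z, sec z) 1).1 ∈ Xi (i + 1) := fun z hz => by
    have := hH1 _ (hsecW z hz)
    exact (mXi _ _).mpr ⟨this.1, this.2.2⟩
  have hHS : ∀ (Z : Type) [TopologicalSpace Z] (q : Z → (Fin N → ℂ)) (τ : Z → unitInterval), Continuous q → Continuous τ → (∀ z, q z ∈ Ui) →
      ContinuousOn (fun x : Z × (Fin n → Fin n → ℂ) => H (q x.1, x.2) (τ x.1)) {x : Z × (Fin n → Fin n → ℂ) | Fib (A (q x.1)) i x.2} := by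
    intro Z _ q τ hq hτ hqU
    refine hHc.comp (f := fun x : Z × (Fin n → Fin n → ℂ) => ((q x.1, x.2), (τ x.1 : ℝ))) ?_ ?_
    · exact Continuous.continuousOn (by fun_prop)
    · intro x hx
      exact ⟨(hqU x.1).2 _ hx, hIcc _⟩
  refine ⟨Ui, hUiU, r, ρ, ?_, ?_, ⟨?_, ?_, ?_, ?_⟩, ⟨?_, ?_, ?_, ?_⟩, ?_, ?_⟩
  · -- relatively open
    refine ⟨interior {z | z ∈ Xi i → z ∈ Ui}, isOpen_interior, ?_⟩
    apply Subset.antisymm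
    · intro z hz
      refine ⟨?_, hz.1⟩
      rw [mem_interior_iff_mem_nhds]
      have h1 : ∀ Q ∈ D, ∀ᶠ x in 𝓝 (z, Q), x.1 ∈ U → Fib (A x.1) i x.2 → x ∈ W := by
        intro Q hQ
        by_cases hF : Fib (A z) i Q
        · filter_upwards [hWo _ (hz.2 Q hF)] with x hx hx1 hx2
          exact hx ⟨hx1, hx2⟩
        · have h2 : f (z, Q) ≠ 0 := fun h => hF ((hff (z, Q) (hUiU hz)).mpr h)
          have h3 : ContinuousAt f (z, Q) := hfc.continuousAt ((hU.preimage continuous_fst).mem_nhds (hUiU hz))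
          filter_upwards [h3.eventually_ne h2] with x hx hx1 hx2
          exact absurd ((hff x hx1).mp hx2) hx
      have h2 := hD.eventually_forall_of_forall_eventually (P := fun z Q => z ∈ U → Fib (A z) i Q → (z, Q) ∈ W) h1
      filter_upwards [h2] with y hy hyX
      exact ⟨hyX, fun Q hQ => hy Q (hFD y Q hQ) ((mXi _ _).mp hyX).1 hQ⟩
    · rintro z ⟨hz1, hz2⟩
      exact interior_subset hz1 hz2
  · intro z hz
    exact ⟨hmono hz, fun Q hQ => (hE z Q hz hQ).1⟩
  · refine Continuous.subtype_mk ?_ _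
    have hq : Continuous (fun x : Ui × unitInterval => (x.1 : Fin N → ℂ)) := by fun_prop
    refine quot_cont hD (hSc (Ui × unitInterval) (fun x => (x.1 : Fin N → ℂ)) hq (fun x => hUiU x.1.2)) (fun x hx => hFD _ _ hx)
      (fun x => (H ((x.1.1 : Fin N → ℂ), x.2) x.1.2).1) ?_ (fun x => sec x.1) (fun x => hsecF _ x.1.2) ?_
    · exact continuous_fst.comp_continuousOn (hHS (Ui × unitInterval) (fun x => (x.1 : Fin N → ℂ)) (fun x => x.2) hq continuous_snd (fun x => x.1.2))
    · intro x a b ha hb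
      by_cases hz : (x.1 : Fin N → ℂ) ∈ Xi (i + 1)
      · simp only [(hE _ _ hz ha).2 _ (hIcc _), (hE _ _ hz hb).2 _ (hIcc _)]
      · rw [huniq _ _ _ (hUiU x.1.2) hz ha hb]
  · intro z
    apply Subtype.ext
    show (H ((z : Fin N → ℂ), sec z) (((0 : unitInterval) : ℝ))).1 = z
    rw [Set.Icc.coe_zero, hH0 _ (hsecW z z.2)]
  · intro z
    show (H ((z : Fin N → ℂ), sec z) (((1 : unitInterval) : ℝ))).1 ∈ Xi (i + 1)
    rw [Set.Icc.coe_one]; exact h1X z z.2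
  · intro z hz t
    apply Subtype.ext
    show (H ((z : Fin N → ℂ), sec z) t).1 = z
    rw [(hE _ _ hz (hsecF _ z.2)).2 _ (hIcc _)]
  · refine Continuous.subtype_mk ?_ _
    have hq : Continuous (fun x : Lu × unitInterval => x.1.1.1) := by fun_prop
    have hH' := hHS (Lu × unitInterval) (fun x => x.1.1.1) (fun x => x.2) hq continuous_snd (fun x => x.1.2.2)
    refine quot_cont hD (hSc (Lu × unitInterval) (fun x => x.1.1.1) hq (fun x => hUiU x.1.2.2)) (fun x hx => hFD _ _ hx)
      (fun x => ((H (x.1.1.1.1, x.2) x.1.2).1, vt x.1.1.1.1 x.2 x.1.1.1.2 x.1.2)) ?_ (fun x => sec x.1.1.1) (fun x => hsecF _ x.1.2.2) ?_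
    · refine (continuous_fst.comp_continuousOn hH').prodMk ?_
      have hmv : Continuous (fun y : (Fin n → Fin n → ℂ) × (Fin n → ℂ) => Matrix.mulVec y.1 y.2) := continuous_fst.matrix_mulVec continuous_snd
      have hv : Continuous (fun x : (Lu × unitInterval) × (Fin n → Fin n → ℂ) => x.1.1.1.2) := by fun_prop
      refine ContinuousOn.sub (ContinuousOn.add ?_ hv.continuousOn) ?_
      · exact hmv.comp_continuousOn ((continuous_snd.comp_continuousOn hH').prodMk hv.continuousOn)
      · exact (hmv.comp (continuous_snd.prodMk hv)).continuousOn
    · intro x a b ha hb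
      by_cases hz : x.1.1.1 ∈ Xi (i + 1)
      · simp only [vt, (hE _ _ hz ha).2 _ (hIcc _), (hE _ _ hz hb).2 _ (hIcc _), add_sub_cancel_left]
      · rw [huniq _ _ _ (hUiU x.1.2.2) hz ha hb]
  · intro e
    apply Subtype.ext
    show ((H (e.1.1, sec e.1.1) ((0 : unitInterval) : ℝ)).1, vt e.1.1 (sec e.1.1) e.1.2 ((0 : unitInterval) : ℝ)) = e.1
    simp only [vt, Set.Icc.coe_zero, hH0 _ (hsecW _ e.2.2), add_sub_cancel_left]
  · intro e
    show (H (e.1.1, sec e.1.1) ((1 : unitInterval) : ℝ)).1 ∈ Xi (i + 1)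
    rw [Set.Icc.coe_one]; exact h1X _ e.2.2
  · intro e he t
    apply Subtype.ext
    show ((H (e.1.1, sec e.1.1) t).1, vt e.1.1 (sec e.1.1) e.1.2 t) = e.1
    simp only [vt, (hE _ _ he (hsecF _ e.2.2)).2 _ (hIcc t), add_sub_cancel_left]
  · intro e t
    rfl
  · intro x
    have hr1 : ((r (x, 1) : Ui) : Fin N → ℂ) = (H ((x : Fin N → ℂ), sec x) ((1 : unitInterval) : ℝ)).1 := rfl
    refine ⟨LinearMap.codRestrict _ ((Matrix.mulVecLin (H ((x : Fin N → ℂ), sec x) ((1 : unitInterval) : ℝ)).2 + LinearMap.id - Matrix.mulVecLin (sec x)).domRestrict _) ?_, ?_, ?_⟩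
    · intro v
      exact hvt _ x.2 _ (hsecF _ x.2) _ v.2 _ (hIcc 1)
    · rw [← LinearMap.ker_eq_bot, LinearMap.ker_eq_bot']
      intro v hv
      have h1 := congrArg Subtype.val hv
      have h2 : Matrix.mulVec (H ((x : Fin N → ℂ), sec x) ((1 : unitInterval) : ℝ)).2 (v : Fin n → ℂ) + v - Matrix.mulVec (sec x) (v : Fin n → ℂ) = 0 := h1
      apply Subtype.ext
      refine inj_of_close ?_ h2
      intro a b
      have h3 := hHR _ (hsecW _ x.2) 0 ⟨le_rfl, zero_le_one⟩ 1 ⟨zero_le_one, le_rfl⟩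
      simp only [R, mem_iInter, mem_ofPred_eq] at h3
      have h4 := h3 a b
      rw [hH0 _ (hsecW _ x.2)] at h4
      rw [Set.Icc.coe_one]
      exact h4
    · intro v
      rfl
end
end Piece24

/-- The filtration theorem for the kernel pseudo vector bundle of a holomorphic morphism of
trivial bundles over an open set `U ⊆ ℂ^N`: the sets `X_i = {x ∈ U | dim ker A(x) ≥ i}` are
closed in `U`, `X_k = U` where `k` is the minimal kernel dimension, the restriction of
`L = ker A` over each stratum `X_i \ X_{i+1}` is a locally trivial ℂ-vector bundle of rank `i`,
and each `X_{i+1}` has a neighbourhood in `X_i` with compatible strong deformation retractions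
of the base and of the total space which are fibrewise linear monomorphisms at time 1. -/
theorem kernel_pseudo_vector_bundle_filtration
    {N p n : ℕ}
    (U : Set (Fin N → ℂ)) (hUopen : IsOpen U) (hUne : U.Nonempty)
    (A : (Fin N → ℂ) → Matrix (Fin p) (Fin n) ℂ)
    (hA : ∀ (i : Fin p) (j : Fin n), AnalyticOnNhd ℂ (fun x => A x i j) U)
    (k : ℕ)
    (hk : IsLeast {d : ℕ | ∃ x ∈ U,
      Module.finrank ℂ (LinearMap.ker (A x).mulVecLin) = d} k)
    (Xi : ℕ → Set (Fin N → ℂ))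
    (hXi : ∀ i, Xi i = {x ∈ U | i ≤ Module.finrank ℂ (LinearMap.ker (A x).mulVecLin)})
    (L : Set ((Fin N → ℂ) × (Fin n → ℂ)))
    (hL : L = {q | q.1 ∈ U ∧ (A q.1).mulVec q.2 = 0}) :
    -- (1a) each `X_i` is closed in `U`
    (∀ i : ℕ, ∃ C : Set (Fin N → ℂ), IsClosed C ∧ Xi i = C ∩ U) ∧
    -- (1b) `X_k = U`
    Xi k = U ∧
    -- (1c) over each stratum `X_i \ X_{i+1}`, `L` is a locally trivial vector bundle of rank `i`
    (∀ i : ℕ, ∀ z₀ ∈ Xi i \ Xi (i + 1),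
      ∃ V : Set (Fin N → ℂ),
        (∃ W : Set (Fin N → ℂ), IsOpen W ∧ V = W ∩ (Xi i \ Xi (i + 1))) ∧ z₀ ∈ V ∧
        ∃ φ : (V × (Fin i → ℂ)) ≃ₜ {q ∈ L | q.1 ∈ V},
          (∀ (z : V) (w : Fin i → ℂ),
            ((φ (z, w) : (Fin N → ℂ) × (Fin n → ℂ))).1 = (z : Fin N → ℂ)) ∧
          ∀ z : V,
            IsLinearMap ℂ
              (fun w : Fin i → ℂ => ((φ (z, w) : (Fin N → ℂ) × (Fin n → ℂ))).2) ∧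
            Function.Injective
              (fun w : Fin i → ℂ => ((φ (z, w) : (Fin N → ℂ) × (Fin n → ℂ))).2) ∧
            ∀ v : Fin n → ℂ, (A (z : Fin N → ℂ)).mulVec v = 0 →
              ∃ w : Fin i → ℂ, ((φ (z, w) : (Fin N → ℂ) × (Fin n → ℂ))).2 = v) ∧
    -- (2) compatible strong deformation retractions onto the next filtration step
    ∀ i : ℕ,
      ∃ (Ui : Set (Fin N → ℂ)) (hUiU : Ui ⊆ U)
        (r : Ui × unitInterval → Ui)
        (ρ : ({q ∈ L | q.1 ∈ Ui} : Set ((Fin N → ℂ) × (Fin n → ℂ))) × unitInterval →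
          ({q ∈ L | q.1 ∈ Ui} : Set ((Fin N → ℂ) × (Fin n → ℂ)))),
        (∃ W : Set (Fin N → ℂ), IsOpen W ∧ Ui = W ∩ Xi i) ∧ Xi (i + 1) ⊆ Ui ∧
        IsStrongDeformationRetraction {z : Ui | (z : Fin N → ℂ) ∈ Xi (i + 1)} r ∧
        IsStrongDeformationRetraction
          {e : ({q ∈ L | q.1 ∈ Ui} : Set ((Fin N → ℂ) × (Fin n → ℂ))) |
            (e : (Fin N → ℂ) × (Fin n → ℂ)).1 ∈ Xi (i + 1)} ρ ∧
        (∀ (e : ({q ∈ L | q.1 ∈ Ui} : Set ((Fin N → ℂ) × (Fin n → ℂ))))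
            (t : unitInterval),
          ((ρ (e, t) : (Fin N → ℂ) × (Fin n → ℂ))).1 =
            (r (⟨(e : (Fin N → ℂ) × (Fin n → ℂ)).1, e.2.2⟩, t) : Fin N → ℂ)) ∧
        ∀ x : Ui,
          ∃ g : LinearMap.ker (A (x : Fin N → ℂ)).mulVecLin →ₗ[ℂ]
              LinearMap.ker (A ((r (x, 1) : Ui) : Fin N → ℂ)).mulVecLin,
            Function.Injective g ∧
            ∀ v : LinearMap.ker (A (x : Fin N → ℂ)).mulVecLin,
              ((ρ (⟨((x : Fin N → ℂ), (v : Fin n → ℂ)),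
                  ⟨hL.symm.subset ⟨hUiU x.2, v.2⟩, x.2⟩⟩, 1) :
                (Fin N → ℂ) × (Fin n → ℂ))).2 = (g v : Fin n → ℂ) := by
  have hAc : ContinuousOn A U :=
    continuousOn_pi.mpr fun i => continuousOn_pi.mpr fun j => (hA i j).continuousOn
  refine ⟨fun i => ?_, ?_, fun i z₀ hz₀ => ?_, fun i => part_2 hUopen hA Xi hXi L hL i⟩
  · rw [hXi]
    exact part_1a hUopen hAc i
  · rw [hXi]
    ext x
    exact ⟨fun h => h.1, fun h => ⟨h, hk.2 ⟨x, h, rfl⟩⟩⟩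
  · refine part_1c hUopen hAc i (Xi i \ Xi (i + 1)) ?_ L hL z₀ hz₀
    rintro z ⟨h1, h2⟩
    rw [hXi] at h1 h2
    refine ⟨h1.1, le_antisymm ?_ h1.2⟩
    by_contra h3
    exact h2 ⟨h1.1, by omega⟩
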